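/- arXiv:2002.03077 — 3 statements merged into one kernel-verified Lean document; each statement's English description precedes it below -/
import Mathlib

section
/- Let 𝓡 = (R, <, +, 0, …) be an expansion of a densely linearly ordered abelian group with 𝓡 ⊨ DC and 𝓡 ⊨ LUF₂, and let X ⊆ R be a definable set. Then the following are equivalent: (1) X is a D_Σ-set; (2) for every x ∈ R there exists an open interval I containing x such that X ∩ I is a finite union of points and open intervals; (3) X is constructible. -/
open FirstOrder Set Topology

section CommonDefs

/-- A subset of `R^n` (coded as `Fin n → R`) is definable in the structure `𝓡` (with
universe `R` and language `L`) with parameters. -/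
def IsDefinable (L : FirstOrder.Language) {R : Type*} [L.Structure R] {n : ℕ}
    (X : Set (Fin n → R)) : Prop :=
  Set.Definable (Set.univ : Set R) L X

/-- An open box in `R^n`: a product of `n` open intervals. -/
def OpenBox {R : Type*} [LT R] {n : ℕ} (B : Set (Fin n → R)) : Prop :=
  ∃ c d : Fin n → R, B = {x | ∀ i, c i < x i ∧ x i < d i}

/-- A closed box in `R^n`: a product of `n` closed intervals. -/
def ClosedBox {R : Type*} [LE R] {n : ℕ} (B : Set (Fin n → R)) : Prop :=
  ∃ c d : Fin n → R, B = {x | ∀ i, c i ≤ x i ∧ x i ≤ d i}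

/-- A subset of `R` which is a finite union of points and open intervals. -/
def FinUnionPtsIntervals {R : Type*} [Preorder R] (s : Set R) : Prop :=
  ∃ (P : Finset R) (Q : Finset (R × R)), s = ↑P ∪ ⋃ p ∈ Q, Set.Ioo p.1 p.2

/-- The fiber `X_x ⊆ R` of a set `X ⊆ R^{m+1}` over `x ∈ R^m`. -/
def fiber1 {R : Type*} {m : ℕ} (X : Set (Fin (m + 1) → R)) (x : Fin m → R) : Set R :=
  {y | Fin.snoc x y ∈ X}

/-- The fiber `X_x ⊆ R^n` of a set `X ⊆ R^{m+n}` over `x ∈ R^m`. -/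
def fiberN {R : Type*} {m n : ℕ} (X : Set (Fin (m + n) → R)) (x : Fin m → R) :
    Set (Fin n → R) :=
  {y | Fin.append x y ∈ X}

/-- The member `X_{r,s} ⊆ R^n` of a parameterized family coded by `F ⊆ R^{2+n}`. -/
def famFiber {R : Type*} {n : ℕ} (F : Set (Fin (2 + n) → R)) (r s : R) : Set (Fin n → R) :=
  {y | Fin.append ![r, s] y ∈ F}

/-- A bounded subset of `R^n`: contained in some closed box. -/
def BddSet {R : Type*} [LE R] {n : ℕ} (X : Set (Fin n → R)) : Prop :=
  ∃ c d : R, ∀ y ∈ X, ∀ i, c ≤ y i ∧ y i ≤ d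

/-- A discrete subset of a topological space: each of its points is isolated. -/
def DiscreteSet {α : Type*} [TopologicalSpace α] (S : Set α) : Prop :=
  ∀ y ∈ S, ∃ U : Set α, IsOpen U ∧ y ∈ U ∧ U ∩ S = {y}

/-- A locally finite subset: each point of the space has an open neighborhood meeting
the set in a finite set. -/
def LocFin {α : Type*} [TopologicalSpace α] (S : Set α) : Prop :=
  ∀ x : α, ∃ U : Set α, IsOpen U ∧ x ∈ U ∧ (S ∩ U).Finite

/-- `F ⊆ R^{2+n}` codes a `D_Σ`-family `{X_{r,s}}_{r>0,s>0}` of CBD subsets of `R^n`: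
each fiber is closed, bounded and definable, the family is increasing in `r` and
decreasing in `s`. -/
def IsDSigmaFamily (L : FirstOrder.Language) {R : Type*} [L.Structure R] [LinearOrder R]
    [Zero R] [TopologicalSpace R] {n : ℕ} (F : Set (Fin (2 + n) → R)) : Prop :=
  IsDefinable L F ∧
    (∀ r s : R, 0 < r → 0 < s →
      IsDefinable L (famFiber F r s) ∧ IsClosed (famFiber F r s) ∧ BddSet (famFiber F r s)) ∧
    (∀ r r' s : R, 0 < r → 0 < s → r ≤ r' → famFiber F r s ⊆ famFiber F r' s) ∧
    (∀ r s s' : R, 0 < r → 0 < s → s ≤ s' → famFiber F r s' ⊆ famFiber F r s)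

/-- A `D_Σ`-set: the union `⋃_{r>0,s>0} X_{r,s}` of a `D_Σ`-family. -/
def IsDSigma (L : FirstOrder.Language) {R : Type*} [L.Structure R] [LinearOrder R]
    [Zero R] [TopologicalSpace R] {n : ℕ} (X : Set (Fin n → R)) : Prop :=
  ∃ F : Set (Fin (2 + n) → R), IsDSigmaFamily L F ∧
    X = ⋃ (r : R) (_ : 0 < r) (s : R) (_ : 0 < s), famFiber F r s

/-- Constructible sets: finite boolean combinations of open sets. -/
inductive IsConstructibleSet {α : Type*} [TopologicalSpace α] : Set α → Prop
  | of_isOpen (s : Set α) : IsOpen s → IsConstructibleSet s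
  | compl (s : Set α) : IsConstructibleSet s → IsConstructibleSet sᶜ
  | union (s t : Set α) : IsConstructibleSet s → IsConstructibleSet t →
      IsConstructibleSet (s ∪ t)

/-- `𝓡 ⊨ DC`: every nonempty definable subset of `R` bounded above has a supremum. -/
def DCProp (L : FirstOrder.Language) (R : Type*) [L.Structure R] [Preorder R] : Prop :=
  ∀ s : Set R, IsDefinable L {v : Fin 1 → R | v 0 ∈ s} → s.Nonempty → BddAbove s →
    ∃ a : R, IsLUB s a

/-- `𝓡 ⊨ LUF₂` (locally uniform finiteness of the second kind). -/
def LUF2 (L : FirstOrder.Language) (R : Type*) [L.Structure R] [LinearOrder R]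
    [TopologicalSpace R] : Prop :=
  ∀ (m : ℕ) (X : Set (Fin (m + 1) → R)), IsDefinable L X → ∀ (a : R) (b : Fin m → R),
    ∃ N : ℕ, 0 < N ∧ ∃ p q : R, a ∈ interior (Set.Icc p q) ∧
      ∃ U : Set (Fin m → R), OpenBox U ∧ b ∈ U ∧
        ∀ x ∈ U, ∀ p' q' : R, a ∈ interior (Set.Icc p' q') → Set.Icc p' q' ⊆ Set.Icc p q →
          (fiber1 X x ∩ Set.Icc p' q').Infinite ∨ (fiber1 X x ∩ Set.Icc p' q').ncard ≤ N

/-- `𝓡 ⊨ LUF₁`: `LUF₂` with `U` always taken to be all of `R^m`. -/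
def LUF1 (L : FirstOrder.Language) (R : Type*) [L.Structure R] [LinearOrder R]
    [TopologicalSpace R] : Prop :=
  ∀ (m : ℕ) (X : Set (Fin (m + 1) → R)), IsDefinable L X → ∀ a : R,
    ∃ N : ℕ, 0 < N ∧ ∃ p q : R, a ∈ interior (Set.Icc p q) ∧
      ∀ (x : Fin m → R), ∀ p' q' : R,
        a ∈ interior (Set.Icc p' q') → Set.Icc p' q' ⊆ Set.Icc p q →
          (fiber1 X x ∩ Set.Icc p' q').Infinite ∨ (fiber1 X x ∩ Set.Icc p' q').ncard ≤ N

/-- `𝓡 ⊨ SLUF`: `LUF₁` with the interval `I` chosen independently of the definable set. -/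
def SLUF (L : FirstOrder.Language) (R : Type*) [L.Structure R] [LinearOrder R]
    [TopologicalSpace R] : Prop :=
  ∀ a : R, ∃ p q : R, a ∈ interior (Set.Icc p q) ∧
    ∀ (m : ℕ) (X : Set (Fin (m + 1) → R)), IsDefinable L X →
      ∃ N : ℕ, 0 < N ∧
        ∀ (x : Fin m → R), ∀ p' q' : R,
          a ∈ interior (Set.Icc p' q') → Set.Icc p' q' ⊆ Set.Icc p q →
            (fiber1 X x ∩ Set.Icc p' q').Infinite ∨ (fiber1 X x ∩ Set.Icc p' q').ncard ≤ N

/-- The language of the open core of `𝓡`: one `n`-ary relation symbol for each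
`𝓡`-definable open subset of `R^n`. -/
def openCoreLang (L : FirstOrder.Language) (R : Type*) [L.Structure R] [TopologicalSpace R] :
    FirstOrder.Language where
  Functions := fun _ => Empty
  Relations := fun n => { s : Set (Fin n → R) // Set.Definable (Set.univ : Set R) L s ∧ IsOpen s }

/-- The open core of `𝓡`: the structure on `R` interpreting each relation symbol by the
corresponding `𝓡`-definable open set. -/
def openCoreStructure (L : FirstOrder.Language) (R : Type*) [L.Structure R]
    [TopologicalSpace R] : (openCoreLang L R).Structure R where
  funMap := fun f _ => f.elim
  RelMap := fun s x => x ∈ s.1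

/-- A set is definable in the open core of `𝓡` if it is definable (with parameters) in the
structure generated by the `𝓡`-definable open sets. -/
def DefinableInOpenCore (L : FirstOrder.Language) (R : Type*) [L.Structure R]
    [TopologicalSpace R] {n : ℕ} (X : Set (Fin n → R)) : Prop :=
  letI := openCoreStructure L R
  Set.Definable (Set.univ : Set R) (openCoreLang L R) X

/-- The local dimension `dim_x X` of `X ⊆ R^n` at `x`, an element of `{-∞} ∪ ℕ ∪ {∞}`:
the supremum of the nonnegative integers `d` such that for every open box `B` containing
`x`, some coordinate projection of `B ∩ X` to `R^d` has nonempty interior (and `-∞` if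
some open box containing `x` misses `X`). -/
noncomputable def locDim {R : Type*} [LT R] [TopologicalSpace R] {n : ℕ}
    (X : Set (Fin n → R)) (x : Fin n → R) : WithBot ℕ∞ :=
  sSup {e : WithBot ℕ∞ | ∃ d : ℕ, e = ((d : ℕ∞) : WithBot ℕ∞) ∧
    ∀ B : Set (Fin n → R), OpenBox B → x ∈ B →
      ∃ f : Fin d → Fin n, Function.Injective f ∧
        (interior ((fun y => y ∘ f) '' (B ∩ X))).Nonempty}

/-- The dimension of `X ⊆ R^n`: the supremum of the local dimensions. -/
noncomputable def setDim {R : Type*} [LT R] [TopologicalSpace R] {n : ℕ}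
    (X : Set (Fin n → R)) : WithBot ℕ∞ :=
  ⨆ x : Fin n → R, locDim X x

/-- The projective dimension of `X ⊆ R^n`: the supremum of the nonnegative integers `d`
such that some coordinate projection of `X` to `R^d` has nonempty interior (`-∞` for the
empty set). -/
noncomputable def projDim {R : Type*} [TopologicalSpace R] {n : ℕ}
    (X : Set (Fin n → R)) : WithBot ℕ∞ :=
  sSup {e : WithBot ℕ∞ | ∃ d : ℕ, e = ((d : ℕ∞) : WithBot ℕ∞) ∧
    ∃ f : Fin d → Fin n, Function.Injective f ∧
      (interior ((fun y => y ∘ f) '' X)).Nonempty}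

/-- A subset of `R` which is a union of at most `N` open intervals. -/
def UnionAtMostOpenIntervals {R : Type*} [Preorder R] (N : ℕ) (s : Set R) : Prop :=
  ∃ Q : Finset (R × R), Q.card ≤ N ∧ s = ⋃ p ∈ Q, Set.Ioo p.1 p.2

/-- A subset of `R` which is a union of at most `N₁` points and `N₂` closed intervals. -/
def UnionAtMostPtsClosedIntervals {R : Type*} [Preorder R] (N₁ N₂ : ℕ) (s : Set R) : Prop :=
  ∃ (P : Finset R) (Q : Finset (R × R)), P.card ≤ N₁ ∧ Q.card ≤ N₂ ∧
    s = ↑P ∪ ⋃ p ∈ Q, Set.Icc p.1 p.2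

/-- A subset of `R` which is a union of at most `N₁` points and `N₂` open intervals. -/
def UnionAtMostPtsOpenIntervals {R : Type*} [Preorder R] (N₁ N₂ : ℕ) (s : Set R) : Prop :=
  ∃ (P : Finset R) (Q : Finset (R × R)), P.card ≤ N₁ ∧ Q.card ≤ N₂ ∧
    s = ↑P ∪ ⋃ p ∈ Q, Set.Ioo p.1 p.2

/-- `X ∩ B` is the graph of a continuous map defined on the coordinate-projection image
of `B` (the projection being given by the injection `f` of coordinates). -/
def IsGraphOn {R : Type*} [TopologicalSpace R] {n d : ℕ} (f : Fin d → Fin n)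
    (S : Set (Fin n → R)) (D : Set (Fin d → R)) : Prop :=
  ∃ g : (Fin d → R) → (Fin n → R), ContinuousOn g D ∧ (∀ z ∈ D, (g z) ∘ f = z) ∧ S = g '' D

end CommonDefs
section Helpers
set_option linter.unusedSectionVars false
variable {L : FirstOrder.Language} {R : Type*} [L.Structure R]

/-- Definable predicate. -/
def DP (L : FirstOrder.Language) {R : Type*} [L.Structure R] {n : ℕ}
    (P : (Fin n → R) → Prop) : Prop := IsDefinable L {v | P v}

/-- Definable term. -/
def DT (L : FirstOrder.Language) {R : Type*} [L.Structure R] {n : ℕ}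
    (f : (Fin n → R) → R) : Prop := (Set.univ : Set R).DefinableFun L f

namespace DP
variable {n : ℕ} {P Q : (Fin n → R) → Prop}

theorem and (hP : DP L P) (hQ : DP L Q) : DP L (fun v => P v ∧ Q v) :=
  Set.Definable.inter hP hQ
theorem or (hP : DP L P) (hQ : DP L Q) : DP L (fun v => P v ∨ Q v) :=
  Set.Definable.union hP hQ
theorem not (hP : DP L P) : DP L (fun v => ¬ P v) :=
  Set.Definable.compl hP
theorem imp (hP : DP L P) (hQ : DP L Q) : DP L (fun v => P v → Q v) := by
  have := (hP.not).or hQ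
  simpa only [← imp_iff_not_or] using this

theorem ex {P : (Fin n → R) → R → Prop}
    (h : DP L (fun w : Fin (n+1) → R => P (fun i => w i.castSucc) (w (Fin.last n)))) :
    DP L (fun v => ∃ y, P v y) := by
  have := Set.Definable.image_comp h (Fin.castSucc : Fin n → Fin (n+1))
  unfold DP IsDefinable
  convert! this using 1
  ext v
  constructor
  · rintro ⟨y, hy⟩
    refine ⟨Fin.snoc v y, ?_, ?_⟩
    · simpa using hy
    · ext i; simp
  · rintro ⟨w, hw, rfl⟩
    exact ⟨_, hw⟩

theorem all {P : (Fin n → R) → R → Prop}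
    (h : DP L (fun w : Fin (n+1) → R => P (fun i => w i.castSucc) (w (Fin.last n)))) :
    DP L (fun v => ∀ y, P v y) := by
  have := (ex (P := fun v y => ¬ P v y) h.not).not
  simpa only [not_exists, not_not] using this

theorem comp {k : ℕ} {A : Set (Fin k → R)} (hA : IsDefinable L A)
    {F : (Fin n → R) → (Fin k → R)} (hF : ∀ i, DT L (fun v => F v i)) :
    DP L (fun v => F v ∈ A) :=
  Set.Definable.preimage_map (F := F) hF hA

theorem mem1 {S : R → Prop} (hS : DP L (fun v : Fin 1 → R => S (v 0)))
    {f : (Fin n → R) → R} (hf : DT L f) : DP L (fun v => S (f v)) :=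
  comp (F := fun v => ![f v]) hS (fun i => by fin_cases i; exact hf)

theorem mem2 {S : R → R → Prop} (hS : DP L (fun v : Fin 2 → R => S (v 0) (v 1)))
    {f g : (Fin n → R) → R} (hf : DT L f) (hg : DT L g) : DP L (fun v => S (f v) (g v)) :=
  comp (F := fun v => ![f v, g v]) hS
    (fun i => by fin_cases i; exacts [hf, hg])

theorem mem3 {S : R → R → R → Prop} (hS : DP L (fun v : Fin 3 → R => S (v 0) (v 1) (v 2)))
    {f g h : (Fin n → R) → R} (hf : DT L f) (hg : DT L g) (hh : DT L h) :
    DP L (fun v => S (f v) (g v) (h v)) :=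
  comp (F := fun v => ![f v, g v, h v]) hS
    (fun i => by fin_cases i; exacts [hf, hg, hh])

end DP

namespace DT
variable {n : ℕ}
theorem var (i : Fin n) : DT L (fun v : Fin n → R => v i) := Set.DefinableFun.proj L
theorem const (c : R) : DT L (fun _ : Fin n → R => c) :=
  FirstOrder.Language.definableFun_const L _ (Set.mem_univ c)
end DT

section order
variable [LinearOrder R] [AddCommGroup R] {n : ℕ} {f g : (Fin n → R) → R}

theorem DT.of_graph {n : ℕ} {f : (Fin n → R) → R}
    (h : DP L (fun w : Fin (n+1) → R => f (fun i => w i.castSucc) = w (Fin.last n))) : DT L f := by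
  have := Set.Definable.preimage_comp
    (Fin.lastCases none some : Fin (n+1) → Option (Fin n)) h
  unfold DT Set.DefinableFun
  convert! this using 1
  ext w
  simp [Function.tupleGraph]
  rfl

theorem DT.add (hadd : IsDefinable L {v : Fin 3 → R | v 0 + v 1 = v 2})
    (hf : DT L f) (hg : DT L g) : DT L (fun v => f v + g v) := by
  have h : DT L (fun v : Fin 2 → R => v 0 + v 1) := DT.of_graph hadd
  exact Set.DefinableFun.comp (f := fun v : Fin 2 → R => v 0 + v 1) (g := fun v => ![f v, g v])
    (fun i => by fin_cases i; exacts [hf, hg]) h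

theorem DP.eq (hf : DT L f) (hg : DT L g) : DP L (fun v => f v = g v) :=
  Set.DefinableFun.ofPred_eq hf hg

theorem DT.neg (hadd : IsDefinable L {v : Fin 3 → R | v 0 + v 1 = v 2})
    (hf : DT L f) : DT L (fun v => - f v) := by
  have h : DT L (fun v : Fin 1 → R => - v 0) := by
    apply DT.of_graph
    have := DP.eq (DT.add hadd (DT.var (L := L) (R := R) (n := 2) 0) (DT.var 1)) (DT.const 0)
    simpa [neg_eq_iff_add_eq_zero] using! this
  exact Set.DefinableFun.comp (f := fun v : Fin 1 → R => - v 0) (g := fun v => ![f v])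
    (fun i => by fin_cases i; exacts [hf]) h

theorem DP.lt (hlt : IsDefinable L {v : Fin 2 → R | v 0 < v 1})
    (hf : DT L f) (hg : DT L g) : DP L (fun v => f v < g v) :=
  DP.mem2 (S := fun x y => x < y) hlt hf hg
theorem DP.le (hlt : IsDefinable L {v : Fin 2 → R | v 0 < v 1})
    (hf : DT L f) (hg : DT L g) : DP L (fun v => f v ≤ g v) := by
  simpa only [not_lt] using (DP.lt hlt hg hf).not
end order

/-- Locally a single point at most: closed and discrete. -/
def LD {R : Type*} [LinearOrder R] (S : R → Prop) : Prop :=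
  ∀ a, ∃ c d, c < a ∧ a < d ∧ ∀ x, S x → c < x → x < d → x = a

section main
variable [LinearOrder R] [AddCommGroup R] [IsOrderedAddMonoid R] [Nontrivial R] [DenselyOrdered R]

theorem LD.mono {S T : R → Prop} (h : LD S) (hT : ∀ x, T x → S x) : LD T := by
  intro a
  obtain ⟨c, d, hc, hd, H⟩ := h a
  exact ⟨c, d, hc, hd, fun x hx => H x (hT x hx)⟩

theorem LD.of_pairs {S : R → Prop} {a c d : R} (hc : c < a) (hd : a < d)
    (h1 : ∀ x y, S x → S y → c < x → x < y → y < a → False)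
    (h2 : ∀ x y, S x → S y → a < x → x < y → y < d → False) :
    ∃ c d, c < a ∧ a < d ∧ ∀ x, S x → c < x → x < d → x = a := by
  have A : ∃ c', c' < a ∧ ∀ x, S x → c' < x → x < a → False := by
    by_cases h : ∃ x, S x ∧ c < x ∧ x < a
    · obtain ⟨x, hx, hcx, hxa⟩ := h
      exact ⟨x, hxa, fun y hy hxy hya => h1 x y hx hy hcx hxy hya⟩
    · push Not at h
      exact ⟨c, hc, fun x hx hcx hxa => absurd hxa (not_lt.2 (h x hx hcx))⟩
  have B : ∃ d', a < d' ∧ ∀ x, S x → a < x → x < d' → False := by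
    by_cases h : ∃ x, S x ∧ a < x ∧ x < d
    · obtain ⟨x, hx, hcx, hxa⟩ := h
      exact ⟨x, hcx, fun y hy hxy hya => h2 y x hy hx hxy hya hxa⟩
    · push Not at h
      exact ⟨d, hd, fun x hx hcx hxa => absurd hxa (not_lt.2 (h x hx hcx))⟩
  obtain ⟨c', hc', H1⟩ := A
  obtain ⟨d', hd', H2⟩ := B
  refine ⟨c', d', hc', hd', fun x hx h3 h4 => ?_⟩
  rcases lt_trichotomy x a with h | h | h
  · exact (H1 x hx h3 h).elim
  · exact h
  · exact (H2 x hx h h4).elim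

theorem LD.of_sep {S : R → Prop} {t : R} (ht : 0 < t)
    (h : ∀ x y, S x → S y → x < y → x + t ≤ y) : LD S := by
  intro a
  refine LD.of_pairs (c := a - t) (d := a + t) (by simpa using ht) (by simpa using ht) ?_ ?_
  · intro x y hx hy h1 h2 h3
    exact absurd (h x y hx hy h2) (not_le.2 (h3.trans (sub_lt_iff_lt_add.1 h1)))
  · intro x y hx hy h1 h2 h3
    exact absurd (h x y hx hy h2) (not_le.2 (h3.trans (by gcongr)))

theorem LD.neg {S : R → Prop} (h : LD S) : LD (fun x => S (-x)) := by
  intro a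
  obtain ⟨c, d, hc, hd, H⟩ := h (-a)
  refine ⟨-d, -c, neg_lt.1 hd, lt_neg.1 hc, fun x hx h1 h2 => ?_⟩
  exact neg_injective (H (-x) hx (lt_neg.1 h2) (neg_lt.1 h1))

theorem LD.exists_min (hlt : IsDefinable L {v : Fin 2 → R | v 0 < v 1}) (hDC : DCProp L R)
    {S : R → Prop} (hS : DP L (fun v : Fin 1 → R => S (v 0))) (h : LD S) {y x₀ : R}
    (hx₀ : S x₀) (hy : y < x₀) :
    ∃ m, S m ∧ y < m ∧ ∀ x, S x → y < x → m ≤ x := by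
  have hB : DP L (fun v : Fin 1 → R => ∀ x, S x → y < x → v 0 ≤ x) := by
    repeat' first
      | exact hlt | exact hS | apply DT.var | apply DT.const | apply DP.all | apply DP.ex
      | apply DP.and | apply DP.or | apply DP.not | apply DP.imp | apply DP.lt | apply DP.le
      | apply DP.mem1 hS
  obtain ⟨m, hm⟩ := hDC {z | ∀ x, S x → y < x → z ≤ x} hB ⟨y, fun x _ h => h.le⟩
    ⟨x₀, fun z hz => hz x₀ hx₀ hy⟩
  have hmx : ∀ x, S x → y < x → m ≤ x := fun x hx hyx => hm.2 (fun z hz => hz x hx hyx)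
  by_cases hmS : S m ∧ y < m
  · exact ⟨m, hmS.1, hmS.2, hmx⟩
  exfalso
  obtain ⟨c, d, hc, hd, H⟩ := h m
  have : d ≤ m := hm.1 (fun x hx hyx => by
    by_contra hxd
    have := H x hx (hc.trans_le (hmx x hx hyx)) (not_le.1 hxd)
    subst this
    exact hmS ⟨hx, hyx⟩)
  exact absurd hd (not_lt.2 this)

theorem LD.grow (hlt : IsDefinable L {v : Fin 2 → R | v 0 < v 1}) (hDC : DCProp L R)
    {S : R → Prop} (hS : DP L (fun v : Fin 1 → R => S (v 0))) (h : LD S) {a q : R} (haq : a < q)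
    {N : ℕ} (H : ∀ y, a < y → y ≤ q → ({x | S x ∧ a ≤ x ∧ x ≤ y}).Infinite ∨
      ({x | S x ∧ a ≤ x ∧ x ≤ y}).ncard ≤ N) :
    ({x | S x ∧ a ≤ x ∧ x ≤ q}).Finite ∧ ({x | S x ∧ a ≤ x ∧ x ≤ q}).ncard ≤ N := by
  have key : ∀ k : ℕ, ({x | S x ∧ a ≤ x ∧ x ≤ q}).Finite ∨
      ∃ y, a < y ∧ y ≤ q ∧ ({x | S x ∧ a ≤ x ∧ x ≤ y}).Finite ∧
        k ≤ ({x | S x ∧ a ≤ x ∧ x ≤ y}).ncard := by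
    intro k
    induction k with
    | zero =>
      right
      obtain ⟨c, d, hc, hd, h1⟩ := h a
      obtain ⟨y, hy1, hy2⟩ := exists_between (lt_min hd haq)
      refine ⟨y, hy1, (hy2.trans_le (min_le_right _ _)).le, ?_, Nat.zero_le _⟩
      refine (Set.finite_singleton a).subset ?_
      rintro x ⟨hx, hax, hxy⟩
      exact h1 x hx (hc.trans_le hax) (hxy.trans_lt (hy2.trans_le (min_le_left _ _)))
    | succ k ih =>
      rcases ih with ih | ⟨y, hay, hyq, hfin, hk⟩
      · exact Or.inl ih
      by_cases hne : ∃ x, S x ∧ y < x ∧ x ≤ q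
      · right
        obtain ⟨x₀, hx₀, hyx, hxq⟩ := hne
        obtain ⟨m, hm, hym, hmin⟩ := h.exists_min hlt hDC hS hx₀ hyx
        have he : {x | S x ∧ a ≤ x ∧ x ≤ m} = insert m {x | S x ∧ a ≤ x ∧ x ≤ y} := by
          ext x
          constructor
          · rintro ⟨h1, h2, h3⟩
            by_cases hxy : x ≤ y
            · exact Or.inr ⟨h1, h2, hxy⟩
            · exact Or.inl (le_antisymm h3 (hmin x h1 (not_le.1 hxy)))
          · rintro (rfl | ⟨h1, h2, h3⟩)
            · exact ⟨hm, (hay.trans hym).le, le_rfl⟩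
            · exact ⟨h1, h2, h3.trans hym.le⟩
        refine ⟨m, hay.trans hym, (hmin x₀ hx₀ hyx).trans hxq, ?_, ?_⟩
        · rw [he]; exact hfin.insert m
        · rw [he, Set.ncard_insert_of_notMem _ hfin]
          · omega
          · rintro ⟨_, _, h3⟩
            exact absurd h3 (not_le.2 hym)
      · left
        refine hfin.subset ?_
        rintro x ⟨h1, h2, h3⟩
        refine ⟨h1, h2, ?_⟩
        by_contra hxy
        exact hne ⟨x, h1, not_le.1 hxy, h3⟩
  have hfin : ({x | S x ∧ a ≤ x ∧ x ≤ q}).Finite := by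
    rcases key (N+1) with h1 | ⟨y, hay, hyq, hf, hk⟩
    · exact h1
    · rcases H y hay hyq with h2 | h2
      · exact absurd hf h2
      · omega
  refine ⟨hfin, ?_⟩
  rcases H q haq le_rfl with h2 | h2
  · exact absurd hfin h2
  · exact h2

variable [TopologicalSpace R] [OrderTopology R]

theorem G_right (hlt : IsDefinable L {v : Fin 2 → R | v 0 < v 1}) (hDC : DCProp L R)
    (hLUF2 : LUF2 L R) {P : R → R → Prop} (hP : DP L (fun v : Fin 2 → R => P (v 0) (v 1)))
    (hLD : ∀ t, 0 < t → LD (P t))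
    (hmono : ∀ t t' x, 0 < t → t ≤ t' → P t' x → P t x) (a : R) :
    ∃ d, a < d ∧ ∀ x, (∃ t, 0 < t ∧ P t x) → a < x → x < d → False := by
  have hX : DP L (fun v : Fin 2 → R => P (v 0) (v 1) ∧ a ≤ v 1) :=
    hP.and (DP.le hlt (DT.const a) (DT.var 1))
  obtain ⟨N, -, p, q, hapq, U, ⟨c, d, rfl⟩, h0, H⟩ := hLUF2 1 _ hX a (fun _ => 0)
  rw [interior_Icc] at hapq
  have key : ∀ t, 0 < t → t < d 0 → ({x | P t x ∧ a ≤ x ∧ x ≤ q}).Finite ∧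
      ({x | P t x ∧ a ≤ x ∧ x ≤ q}).ncard ≤ N := by
    intro t ht htd
    refine LD.grow hlt hDC (S := P t) (DP.mem2 hP (DT.const t) (DT.var 0)) (hLD t ht) hapq.2 ?_
    intro y hay hyq
    have := H (fun _ => t) (fun i => by
      rw [Subsingleton.elim i 0]
      exact ⟨(h0 0).1.trans ht, htd⟩) p y (by rw [interior_Icc]; exact ⟨hapq.1, hay⟩)
      (Set.Icc_subset_Icc le_rfl hyq)
    have he : fiber1 {v : Fin 2 → R | P (v 0) (v 1) ∧ a ≤ v 1} (fun _ => t) ∩ Set.Icc p y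
        = {x | P t x ∧ a ≤ x ∧ x ≤ y} := by
      ext x
      constructor
      · rintro ⟨⟨h1, h2⟩, h3, h4⟩
        exact ⟨h1, h2, h4⟩
      · rintro ⟨h1, h2, h3⟩
        exact ⟨⟨h1, h2⟩, hapq.1.le.trans h2, h3⟩
    rwa [he] at this
  have hfin : ({x | (∃ t, 0 < t ∧ P t x) ∧ a ≤ x ∧ x ≤ q}).Finite := by
    by_contra hinf
    obtain ⟨F, hF, hcard⟩ := Set.Infinite.exists_subset_card_eq hinf (N+1)
    have : ∀ F : Finset R, ↑F ⊆ {x | (∃ t, 0 < t ∧ P t x) ∧ a ≤ x ∧ x ≤ q} →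
        ∃ t, 0 < t ∧ t < d 0 ∧ ∀ x ∈ F, P t x := by
      classical
      intro F
      induction F using Finset.induction_on with
      | empty =>
        intro _
        obtain ⟨t, h1, h2⟩ := exists_between (h0 0).2
        exact ⟨t, h1, h2, by simp⟩
      | insert x F hx ih =>
        intro hF
        obtain ⟨t, h1, h2, h3⟩ := ih (fun y hy => hF (by simp at hy ⊢; exact Or.inr hy))
        obtain ⟨⟨t', h4, h5⟩, -⟩ := hF (show x ∈ _ by simp)
        refine ⟨min t t', lt_min h1 h4, (min_le_left _ _).trans_lt h2, ?_⟩
        intro y hy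
        rcases Finset.mem_insert.1 hy with rfl | hy
        · exact hmono _ _ _ (lt_min h1 h4) (min_le_right _ _) h5
        · exact hmono _ _ _ (lt_min h1 h4) (min_le_left _ _) (h3 y hy)
    obtain ⟨t, h1, h2, h3⟩ := this F hF
    obtain ⟨k1, k2⟩ := key t h1 h2
    have h4 : (↑F : Set R) ⊆ {x | P t x ∧ a ≤ x ∧ x ≤ q} := fun x hx => ⟨h3 x hx, (hF hx).2⟩
    have := Set.ncard_le_ncard h4 k1
    rw [Set.ncard_coe_finset] at this
    omega
  have hfin2 : ({x | (∃ t, 0 < t ∧ P t x) ∧ a < x ∧ x ≤ q}).Finite :=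
    hfin.subset (fun x hx => ⟨hx.1, hx.2.1.le, hx.2.2⟩)
  by_cases hne : ({x | (∃ t, 0 < t ∧ P t x) ∧ a < x ∧ x ≤ q}).Nonempty
  · obtain ⟨m, hm, hmin⟩ := Set.exists_min_image _ id hfin2 hne
    refine ⟨m, hm.2.1, fun x hx h1 h2 => ?_⟩
    exact absurd h2 (not_lt.2 (hmin x ⟨hx, h1, h2.le.trans hm.2.2⟩))
  · exact ⟨q, hapq.2, fun x hx h1 h2 => hne ⟨x, hx, h1, h2.le⟩⟩

theorem G_lem (hlt : IsDefinable L {v : Fin 2 → R | v 0 < v 1})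
    (hadd : IsDefinable L {v : Fin 3 → R | v 0 + v 1 = v 2}) (hDC : DCProp L R)
    (hLUF2 : LUF2 L R) {P : R → R → Prop} (hP : DP L (fun v : Fin 2 → R => P (v 0) (v 1)))
    (hLD : ∀ t, 0 < t → LD (P t))
    (hmono : ∀ t t' x, 0 < t → t ≤ t' → P t' x → P t x) :
    LD (fun x => ∃ t, 0 < t ∧ P t x) := by
  intro a
  obtain ⟨d, hd, H⟩ := G_right hlt hDC hLUF2 hP hLD hmono a
  obtain ⟨c, hc, H'⟩ := G_right hlt hDC hLUF2 (P := fun t x => P t (-x))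
    (DP.mem2 hP (DT.var 0) (DT.neg hadd (DT.var 1))) (fun t ht => (hLD t ht).neg)
    (fun t t' x => hmono t t' (-x)) (-a)
  refine ⟨-c, d, neg_lt.1 hc, hd, fun x hx h1 h2 => ?_⟩
  rcases lt_trichotomy x a with h | h | h
  · exact (H' (-x) (by simpa using hx) (neg_lt_neg h) (neg_lt.1 h1)).elim
  · exact h
  · exact (H x hx h h2).elim

theorem E_lem (hlt : IsDefinable L {v : Fin 2 → R | v 0 < v 1})
    (hadd : IsDefinable L {v : Fin 3 → R | v 0 + v 1 = v 2}) (hDC : DCProp L R)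
    (hLUF2 : LUF2 L R) {E : R → Prop} (hE : DP L (fun v : Fin 1 → R => E (v 0)))
    (hcl : IsClosed {x | E x}) (hint : ∀ c d, c < d → ∃ x, c < x ∧ x < d ∧ ¬ E x) : LD E := by
  have hP : DP L (fun v : Fin 2 → R => E (v 1) ∧ ∀ y, E y → v 1 < y → v 1 + v 0 ≤ y) := by
    repeat' first
      | exact hlt | exact hadd | exact hE
      | apply DT.var | apply DT.const | apply DT.add | apply DP.all | apply DP.ex
      | apply DP.and | apply DP.or | apply DP.not | apply DP.imp | apply DP.lt | apply DP.le
      | apply DP.mem1 hE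
  have hG := G_lem hlt hadd hDC hLUF2 (P := fun t x => E x ∧ ∀ y, E y → x < y → x + t ≤ y) hP
    (fun t ht => LD.of_sep ht (fun x y hx hy hxy => hx.2 y hy.1 hxy))
    (fun t t' x ht htt' h => ⟨h.1, fun y hy hxy =>
      (add_le_add_right htt' x).trans (h.2 y hy hxy)⟩)
  have hpair : ∀ x y, E x → E y → x < y → ∃ e, x ≤ e ∧ e < y ∧
      ∃ t, 0 < t ∧ E e ∧ ∀ y, E y → e < y → e + t ≤ y := by
    intro x y hx hy hxy
    obtain ⟨z, hxz, hzy, hz⟩ := hint x y hxy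
    have hB : DP L (fun v : Fin 1 → R => E (v 0) ∧ v 0 ≤ z) :=
      hE.and (DP.le hlt (DT.var 0) (DT.const z))
    obtain ⟨e, he⟩ := hDC {w | E w ∧ w ≤ z} hB ⟨x, hx, hxz.le⟩ ⟨z, fun w hw => hw.2⟩
    have hEe : E e := by
      have h1 := he.mem_closure ⟨x, hx, hxz.le⟩
      have h2 : closure {w | E w ∧ w ≤ z} ⊆ {x | E x} :=
        closure_minimal (fun w hw => hw.1) hcl
      exact h2 h1
    have hez : e ≤ z := he.2 (fun w hw => hw.2)
    have hez' : e < z := lt_of_le_of_ne hez (by rintro rfl; exact hz hEe)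
    refine ⟨e, he.1 ⟨hx, hxz.le⟩, hez'.trans hzy, z - e, sub_pos.2 hez', hEe, ?_⟩
    intro w hw hew
    rw [add_sub_cancel]
    by_contra hwz
    exact absurd (he.1 ⟨hw, (not_le.1 hwz).le⟩) (not_le.2 hew)
  intro a
  obtain ⟨c, d, hc, hd, H⟩ := hG a
  have hk : ∀ x y, E x → E y → c < x → x < y → y < d → x ≤ a ∧ a < y := by
    intro x y hx hy h1 h2 h3
    obtain ⟨e, h4, h5, h6⟩ := hpair x y hx hy h2
    have := H e h6 (h1.trans_le h4) (h5.trans h3)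
    subst this
    exact ⟨h4, h5⟩
  refine LD.of_pairs hc hd ?_ ?_
  · intro x y hx hy h1 h2 h3
    exact absurd (hk x y hx hy h1 h2 (h3.trans hd)).2 (not_lt.2 h3.le)
  · intro x y hx hy h1 h2 h3
    exact absurd (hk x y hx hy (hc.trans h1) h2 h3).1 (not_le.2 h1)

theorem gap_lem (hlt : IsDefinable L {v : Fin 2 → R | v 0 < v 1})
    (hadd : IsDefinable L {v : Fin 3 → R | v 0 + v 1 = v 2}) (hDC : DCProp L R)
    {S : R → Prop} (hS : DP L (fun v : Fin 1 → R => S (v 0))) (h : LD S) {u w : R} (huw : u ≤ w) :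
    ∃ t, 0 < t ∧ ∀ x, S x → ∀ y, S y → u ≤ x → x < y → y ≤ w → x + t ≤ y := by
  have hB : DP L (fun v : Fin 1 → R => v 0 ≤ w ∧
      ∃ t, 0 < t ∧ ∀ x, S x → ∀ y, S y → u ≤ x → x < y → y ≤ v 0 → x + t ≤ y) := by
    repeat' first
      | exact hlt | exact hadd | exact hS
      | apply DT.var | apply DT.const | apply DT.add | apply DP.all | apply DP.ex
      | apply DP.and | apply DP.or | apply DP.not | apply DP.imp | apply DP.lt | apply DP.le
      | apply DP.mem1 hS
  obtain ⟨t0, ht0⟩ := exists_gt (0 : R)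
  have hu : u ∈ {z | z ≤ w ∧
      ∃ t, 0 < t ∧ ∀ x, S x → ∀ y, S y → u ≤ x → x < y → y ≤ z → x + t ≤ y} :=
    ⟨huw, t0, ht0, fun x _ y _ h1 h2 h3 => absurd (h1.trans_lt h2) (not_lt.2 h3)⟩
  obtain ⟨m, hm⟩ := hDC {z | z ≤ w ∧
      ∃ t, 0 < t ∧ ∀ x, S x → ∀ y, S y → u ≤ x → x < y → y ≤ z → x + t ≤ y} hB ⟨u, hu⟩
      ⟨w, fun z hz => hz.1⟩
  obtain ⟨c, d, hc, hd, H⟩ := h m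
  obtain ⟨z, ⟨hzw, t, ht, hz⟩, hcz, hzm⟩ := hm.exists_between hc
  obtain ⟨d', hmd', hd'd⟩ := exists_between hd
  have hw' : min d' w ∈ {z | z ≤ w ∧
      ∃ t, 0 < t ∧ ∀ x, S x → ∀ y, S y → u ≤ x → x < y → y ≤ z → x + t ≤ y} := by
    refine ⟨min_le_right _ _, min t (m - c), lt_min ht (sub_pos.2 hc), ?_⟩
    intro x hx y hy h1 h2 h3
    by_cases hyz : y ≤ z
    · exact (add_le_add_right (min_le_left _ _) x).trans (hz x hx y hy h1 h2 hyz)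
    · have hym : y = m := H y hy (hcz.trans (not_le.1 hyz))
        ((h3.trans (min_le_left _ _)).trans_lt hd'd)
      subst hym
      have hxc : x ≤ c := by
        by_contra hxc
        exact h2.ne (H x hx (not_le.1 hxc) (h2.trans hd))
      calc x + min t (y - c) ≤ c + (y - c) := add_le_add hxc (min_le_right _ _)
        _ = y := by abel
  have h1 : min d' w ≤ m := hm.1 hw'
  have h2 : w ≤ d' := by
    rcases min_le_iff.1 h1 with h | h
    · exact absurd hmd' (not_lt.2 h)
    · exact h.trans hmd'.le
  rw [min_eq_right h2] at hw'
  exact hw'.2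

theorem D_lem (hlt : IsDefinable L {v : Fin 2 → R | v 0 < v 1})
    (hadd : IsDefinable L {v : Fin 3 → R | v 0 + v 1 = v 2}) (hDC : DCProp L R)
    (hLUF2 : LUF2 L R) {Q : R → R → R → Prop}
    (hQ : DP L (fun v : Fin 3 → R => Q (v 0) (v 1) (v 2)))
    (hcl : ∀ r s, 0 < r → 0 < s → IsClosed {x | Q r s x})
    (hr : ∀ r r' s x, 0 < r → 0 < s → r ≤ r' → Q r s x → Q r' s x)
    (hs : ∀ r s s' x, 0 < r → 0 < s → s ≤ s' → Q r s' x → Q r s x)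
    {u w : R} (huw : u ≤ w) (hK : ∀ r s x, Q r s x → u ≤ x ∧ x ≤ w)
    (hint : ∀ c d, c < d → ∃ x, c < x ∧ x < d ∧ ¬ ∃ r, 0 < r ∧ ∃ s, 0 < s ∧ Q r s x) :
    LD (fun x => ∃ r, 0 < r ∧ ∃ s, 0 < s ∧ Q r s x) := by
  set Y : R → R → Prop := fun r x => ∃ s, 0 < s ∧ Q r s x with hYdef
  have hY : DP L (fun v : Fin 2 → R => Y (v 0) (v 1)) := by
    simp only [hYdef]
    repeat' first
      | exact hlt
      | apply DT.var | apply DT.const | apply DP.ex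
      | apply DP.and | apply DP.lt | apply DP.mem3 hQ
  have hYLD : ∀ r, 0 < r → LD (Y r) := by
    intro r hr0
    refine G_lem hlt hadd hDC hLUF2 (P := fun s x => Q r s x)
      (DP.mem3 hQ (DT.const r) (DT.var 0) (DT.var 1)) ?_ (fun t t' x => hs r t t' x hr0)
    intro s hs0
    refine E_lem hlt hadd hDC hLUF2 (DP.mem3 hQ (DT.const r) (DT.const s) (DT.var 0))
      (hcl r s hr0 hs0) ?_
    intro c d hcd
    obtain ⟨x, h1, h2, h3⟩ := hint c d hcd
    exact ⟨x, h1, h2, fun h => h3 ⟨r, hr0, s, hs0, h⟩⟩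
  have hYm : ∀ r r' x, 0 < r → r ≤ r' → Y r x → Y r' x := by
    rintro r r' x h0 h1 ⟨s, hs0, h2⟩
    exact ⟨s, hs0, hr r r' s x h0 hs0 h1 h2⟩
  have hZ : DP L (fun v : Fin 2 → R => ∃ r, 0 < r ∧ Y r (v 1) ∧
      ∀ x, Y r x → ∀ y, Y r y → x < y → x + v 0 ≤ y) := by
    clear_value Y
    repeat' first
      | exact hlt | exact hadd
      | apply DT.var | apply DT.const | apply DT.add | apply DP.all | apply DP.ex
      | apply DP.and | apply DP.or | apply DP.not | apply DP.imp | apply DP.lt | apply DP.le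
      | apply DP.mem2 hY
  have hG := G_lem hlt hadd hDC hLUF2 (P := fun t x => ∃ r, 0 < r ∧ Y r x ∧
      ∀ x, Y r x → ∀ y, Y r y → x < y → x + t ≤ y) hZ ?_ ?_
  · refine hG.mono ?_
    rintro x ⟨r, hr0, hx⟩
    obtain ⟨t, ht, h1⟩ := gap_lem hlt hadd hDC (DP.mem2 hY (DT.const r) (DT.var 0))
      (hYLD r hr0) huw
    refine ⟨t, ht, r, hr0, hx, ?_⟩
    rintro y hy z hz hyz
    obtain ⟨_, _, hy'⟩ := id hy
    obtain ⟨_, _, hz'⟩ := id hz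
    exact h1 y hy z hz (hK _ _ _ hy').1 hyz (hK _ _ _ hz').2
  · intro t ht
    refine LD.of_sep ht ?_
    rintro x y ⟨r, h1, h2, h3⟩ ⟨r', h1', h2', h3'⟩ hxy
    rcases le_total r r' with h | h
    · exact h3' x (hYm _ _ _ h1 h h2) y h2' hxy
    · exact h3 x h2 y (hYm _ _ _ h1' h h2') hxy
  · rintro t t' x ht htt' ⟨r, h1, h2, h3⟩
    exact ⟨r, h1, h2, fun x hx y hy hxy => (add_le_add_right htt' x).trans (h3 x hx y hy hxy)⟩

theorem fr_iff (X : Set R) (x : R) : x ∈ frontier X ↔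
    ∀ c d, c < x → x < d → (∃ y, c < y ∧ y < d ∧ y ∈ X) ∧ (∃ y, c < y ∧ y < d ∧ ¬ y ∈ X) := by
  rw [frontier_eq_closure_inter_closure, Set.mem_inter_iff,
    mem_closure_iff_nhds_basis (nhds_basis_Ioo x), mem_closure_iff_nhds_basis (nhds_basis_Ioo x)]
  constructor
  · rintro ⟨h1, h2⟩ c d hc hd
    obtain ⟨y, hy, hy'⟩ := h1 (c, d) ⟨hc, hd⟩
    obtain ⟨z, hz, hz'⟩ := h2 (c, d) ⟨hc, hd⟩
    exact ⟨⟨y, hy'.1, hy'.2, hy⟩, ⟨z, hz'.1, hz'.2, hz⟩⟩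
  · intro h
    constructor
    · rintro ⟨c, d⟩ ⟨hc, hd⟩
      obtain ⟨⟨y, h1, h2, h3⟩, -⟩ := h c d hc hd
      exact ⟨y, h3, h1, h2⟩
    · rintro ⟨c, d⟩ ⟨hc, hd⟩
      obtain ⟨-, ⟨y, h1, h2, h3⟩⟩ := h c d hc hd
      exact ⟨y, h3, h1, h2⟩

theorem fr_def (hlt : IsDefinable L {v : Fin 2 → R | v 0 < v 1}) {X : Set R}
    (hX : DP L (fun v : Fin 1 → R => v 0 ∈ X)) :
    DP L (fun v : Fin 1 → R => v 0 ∈ frontier X) := by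
  simp only [fr_iff]
  repeat' first
    | exact hlt
    | apply DT.var | apply DT.const | apply DP.all | apply DP.ex
    | apply DP.and | apply DP.or | apply DP.not | apply DP.imp | apply DP.lt | apply DP.le
    | apply DP.mem1 (S := fun x => x ∈ X) hX

theorem conn0 (hlt : IsDefinable L {v : Fin 2 → R | v 0 < v 1}) (hDC : DCProp L R) {X : Set R}
    (hX : DP L (fun v : Fin 1 → R => v 0 ∈ X)) {x y : R} (hxy : x < y) (hx : x ∈ X)
    (hy : y ∉ X) : ∃ z, x ≤ z ∧ z ≤ y ∧ z ∈ frontier X := by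
  have hB : DP L (fun v : Fin 1 → R => v 0 ∈ X ∧ v 0 ≤ y) :=
    hX.and (DP.le hlt (DT.var 0) (DT.const y))
  obtain ⟨z, hz⟩ := hDC {w | w ∈ X ∧ w ≤ y} hB ⟨x, hx, hxy.le⟩ ⟨y, fun w hw => hw.2⟩
  have hzy : z ≤ y := hz.2 (fun w hw => hw.2)
  refine ⟨z, hz.1 ⟨hx, hxy.le⟩, hzy, ?_⟩
  rw [fr_iff]
  intro c d hc hd
  constructor
  · obtain ⟨w, hw, h1, h2⟩ := hz.exists_between hc
    exact ⟨w, h1, h2.trans_lt hd, hw.1⟩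
  · by_contra hcon
    push Not at hcon
    have hzX := hcon z hc hd
    have hzy' : z < y := lt_of_le_of_ne hzy (by rintro rfl; exact hy hzX)
    obtain ⟨w, h1, h2⟩ := exists_between (lt_min hd hzy')
    have hw := hcon w (hc.trans h1) (h2.trans_le (min_le_left _ _))
    exact absurd (hz.1 ⟨hw, (h2.trans_le (min_le_right _ _)).le⟩) (not_le.2 h1)

theorem conn (hlt : IsDefinable L {v : Fin 2 → R | v 0 < v 1}) (hDC : DCProp L R) {X : Set R}
    (hX : DP L (fun v : Fin 1 → R => v 0 ∈ X)) {c d : R}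
    (h : ∀ x, c < x → x < d → x ∉ frontier X) :
    Set.Ioo c d ⊆ X ∨ Set.Ioo c d ⊆ Xᶜ := by
  by_contra hcon
  rw [not_or, Set.not_subset, Set.not_subset] at hcon
  obtain ⟨⟨y, ⟨hy1, hy2⟩, hy⟩, ⟨x, ⟨hx1, hx2⟩, hx⟩⟩ := hcon
  rw [Set.notMem_compl_iff] at hx
  have hXc : DP L (fun v : Fin 1 → R => v 0 ∈ Xᶜ) := hX.not
  rcases lt_trichotomy x y with hlt' | rfl | hlt'
  · obtain ⟨z, h1, h2, h3⟩ := conn0 hlt hDC hX hlt' hx hy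
    exact h z (hx1.trans_le h1) (h2.trans_lt hy2) h3
  · exact hy hx
  · obtain ⟨z, h1, h2, h3⟩ := conn0 hlt hDC hXc hlt' hy (by simpa using hx)
    rw [frontier_compl] at h3
    exact h z (hy1.trans_le h1) (h2.trans_lt hx2) h3

theorem FU_empty : FinUnionPtsIntervals (∅ : Set R) := ⟨∅, ∅, by simp⟩
theorem FU_single (a : R) : FinUnionPtsIntervals ({a} : Set R) := ⟨{a}, ∅, by simp⟩
theorem FU_Ioo (a b : R) : FinUnionPtsIntervals (Set.Ioo a b) := ⟨∅, {(a, b)}, by simp⟩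
theorem FU_union {s t : Set R} (hs : FinUnionPtsIntervals s) (ht : FinUnionPtsIntervals t) :
    FinUnionPtsIntervals (s ∪ t) := by
  classical
  obtain ⟨P, Q, rfl⟩ := hs
  obtain ⟨P', Q', rfl⟩ := ht
  refine ⟨P ∪ P', Q ∪ Q', ?_⟩
  ext x
  simp only [Set.mem_union, Finset.mem_coe, Set.mem_iUnion, Finset.mem_union, exists_prop]
  constructor
  · rintro ((h | ⟨i, h, h'⟩) | (h | ⟨i, h, h'⟩))
    · exact Or.inl (Or.inl h)
    · exact Or.inr ⟨i, Or.inl h, h'⟩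
    · exact Or.inl (Or.inr h)
    · exact Or.inr ⟨i, Or.inr h, h'⟩
  · rintro ((h | h) | ⟨i, h | h, h'⟩)
    · exact Or.inl (Or.inl h)
    · exact Or.inr (Or.inl h)
    · exact Or.inl (Or.inr ⟨i, h, h'⟩)
    · exact Or.inr (Or.inr ⟨i, h, h'⟩)

theorem FL_to_two (hlt : IsDefinable L {v : Fin 2 → R | v 0 < v 1}) (hDC : DCProp L R) {X : Set R}
    (hX : DP L (fun v : Fin 1 → R => v 0 ∈ X)) (h : LD (fun x => x ∈ frontier X)) (a : R) :
    ∃ c d : R, c < a ∧ a < d ∧ FinUnionPtsIntervals (X ∩ Set.Ioo c d) := by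
  obtain ⟨c, d, hc, hd, H⟩ := h a
  refine ⟨c, d, hc, hd, ?_⟩
  have hI : ∀ p q, (Set.Ioo p q ⊆ X ∨ Set.Ioo p q ⊆ Xᶜ) →
      FinUnionPtsIntervals (X ∩ Set.Ioo p q) := by
    rintro p q (h | h)
    · rw [Set.inter_eq_right.2 h]; exact FU_Ioo p q
    · have : X ∩ Set.Ioo p q = ∅ := by
        ext x; simp only [Set.mem_inter_iff, Set.mem_empty_iff_false, iff_false]
        rintro ⟨h1, h2⟩
        exact h h2 h1
      rw [this]; exact FU_empty
  have h1 := hI c a (conn hlt hDC hX (fun x hx hx' hf =>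
    hx'.ne (H x hf hx (hx'.trans hd))))
  have h2 := hI a d (conn hlt hDC hX (fun x hx hx' hf =>
    hx.ne' (H x hf (hc.trans hx) hx')))
  have h3 : FinUnionPtsIntervals (X ∩ {a}) := by
    by_cases ha : a ∈ X
    · rw [Set.inter_eq_right.2 (by simpa using ha)]; exact FU_single a
    · have : X ∩ {a} = ∅ := by simpa using ha
      rw [this]; exact FU_empty
  have := FU_union (FU_union h1 h3) h2
  rw [← Set.inter_union_distrib_left, ← Set.inter_union_distrib_left] at this
  convert this using 2
  ext x
  simp only [Set.mem_Ioo, Set.mem_union, Set.mem_singleton_iff]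
  constructor
  · rintro ⟨h1, h2⟩
    rcases lt_trichotomy x a with h | h | h
    · exact Or.inl (Or.inl ⟨h1, h⟩)
    · exact Or.inl (Or.inr h)
    · exact Or.inr ⟨h, h2⟩
  · rintro ((⟨h1, h2⟩ | rfl) | ⟨h1, h2⟩)
    · exact ⟨h1, h2.trans hd⟩
    · exact ⟨hc, hd⟩
    · exact ⟨hc.trans h1, h2⟩

theorem FU_left {s : Set R} (hs : FinUnionPtsIntervals s) (a : R) :
    (∀ᶠ x in 𝓝[<] a, x ∈ s) ∨ (∀ᶠ x in 𝓝[<] a, x ∉ s) := by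
  by_contra hcon
  obtain ⟨h1, h2⟩ := not_or.1 hcon
  obtain ⟨P, Q, rfl⟩ := hs
  apply h2
  have hP : ∀ᶠ x in 𝓝[<] a, x ∉ (↑P : Set R) := by
    have : (↑(P.erase a) : Set R)ᶜ ∈ 𝓝 a :=
      (P.erase a).finite_toSet.isClosed.isOpen_compl.mem_nhds (by simp)
    filter_upwards [mem_nhdsWithin_of_mem_nhds this, self_mem_nhdsWithin] with x hx hx' hxP
    exact hx (Finset.mem_coe.2 (Finset.mem_erase.2 ⟨hx'.ne, Finset.mem_coe.1 hxP⟩))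
  have hQ : ∀ p ∈ Q, ∀ᶠ x in 𝓝[<] a, x ∉ Set.Ioo p.1 p.2 := by
    intro p hp
    by_cases hpa : p.1 < a
    · by_cases hqa : a ≤ p.2
      · exfalso
        apply h1
        filter_upwards [Ioo_mem_nhdsLT hpa] with x hx
        exact Or.inr (Set.mem_biUnion hp ⟨hx.1, hx.2.trans_le hqa⟩)
      · filter_upwards [Ioo_mem_nhdsLT (not_le.1 hqa)] with x hx hx'
        exact absurd hx'.2 (not_lt.2 hx.1.le)
    · filter_upwards [self_mem_nhdsWithin] with x hx hx'
      exact absurd (hx'.1.trans hx) hpa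
  have hQ' := (Filter.eventually_all_finset Q).2 hQ
  filter_upwards [hP, hQ'] with x h3 h4
  rintro (h | h)
  · exact h3 h
  · obtain ⟨p, hp, hx⟩ := Set.mem_iUnion₂.1 h
    exact h4 p hp hx

theorem FU_right {s : Set R} (hs : FinUnionPtsIntervals s) (a : R) :
    (∀ᶠ x in 𝓝[>] a, x ∈ s) ∨ (∀ᶠ x in 𝓝[>] a, x ∉ s) := by
  by_contra hcon
  obtain ⟨h1, h2⟩ := not_or.1 hcon
  obtain ⟨P, Q, rfl⟩ := hs
  apply h2
  have hP : ∀ᶠ x in 𝓝[>] a, x ∉ (↑P : Set R) := by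
    have : (↑(P.erase a) : Set R)ᶜ ∈ 𝓝 a :=
      (P.erase a).finite_toSet.isClosed.isOpen_compl.mem_nhds (by simp)
    filter_upwards [mem_nhdsWithin_of_mem_nhds this, self_mem_nhdsWithin] with x hx hx' hxP
    exact hx (Finset.mem_coe.2 (Finset.mem_erase.2 ⟨ne_of_gt hx', Finset.mem_coe.1 hxP⟩))
  have hQ : ∀ p ∈ Q, ∀ᶠ x in 𝓝[>] a, x ∉ Set.Ioo p.1 p.2 := by
    intro p hp
    by_cases hpa : a < p.2
    · by_cases hqa : p.1 ≤ a
      · exfalso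
        apply h1
        filter_upwards [Ioo_mem_nhdsGT hpa] with x hx
        exact Or.inr (Set.mem_biUnion hp ⟨hqa.trans_lt hx.1, hx.2⟩)
      · filter_upwards [Ioo_mem_nhdsGT (not_le.1 hqa)] with x hx hx'
        exact absurd hx'.1 (not_lt.2 hx.2.le)
    · filter_upwards [self_mem_nhdsWithin] with x hx hx'
      exact absurd (lt_trans hx hx'.2) hpa
  have hQ' := (Filter.eventually_all_finset Q).2 hQ
  filter_upwards [hP, hQ'] with x h3 h4
  rintro (h | h)
  · exact h3 h
  · obtain ⟨p, hp, hx⟩ := Set.mem_iUnion₂.1 h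
    exact h4 p hp hx

theorem two_to_FL {X : Set R}
    (h : ∀ x : R, ∃ c d : R, c < x ∧ x < d ∧ FinUnionPtsIntervals (X ∩ Set.Ioo c d)) :
    LD (fun x => x ∈ frontier X) := by
  intro a
  obtain ⟨c, d, hc, hd, hF⟩ := h a
  have hl : ∃ c', c' < a ∧ ∀ x, c' < x → x < a → x ∉ frontier X := by
    have key : ∃ c', c' < a ∧ ((∀ x, c' < x → x < a → x ∈ X) ∨ (∀ x, c' < x → x < a → x ∉ X)) := by
      have hm := Ioo_mem_nhdsLT hc
      rcases FU_left hF a with h1 | h1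
      · obtain ⟨l, hl, hl'⟩ := mem_nhdsLT_iff_exists_Ioo_subset.1 h1
        exact ⟨l, hl, Or.inl fun x h2 h3 => (hl' ⟨h2, h3⟩).1⟩
      · obtain ⟨l, hl, hl'⟩ := mem_nhdsLT_iff_exists_Ioo_subset.1 (Filter.inter_mem h1 hm)
        exact ⟨l, hl, Or.inr fun x h2 h3 hx => (hl' ⟨h2, h3⟩).1
          ⟨hx, (hl' ⟨h2, h3⟩).2.1, h3.trans hd⟩⟩
    obtain ⟨c', hc', h1 | h1⟩ := key
    · refine ⟨c', hc', fun x h2 h3 h4 => ?_⟩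
      obtain ⟨-, y, h5, h6, h7⟩ := (fr_iff X x).1 h4 c' a h2 h3
      exact h7 (h1 y h5 h6)
    · refine ⟨c', hc', fun x h2 h3 h4 => ?_⟩
      obtain ⟨⟨y, h5, h6, h7⟩, -⟩ := (fr_iff X x).1 h4 c' a h2 h3
      exact h1 y h5 h6 h7
  have hr : ∃ d', a < d' ∧ ∀ x, a < x → x < d' → x ∉ frontier X := by
    have key : ∃ d', a < d' ∧ ((∀ x, a < x → x < d' → x ∈ X) ∨ (∀ x, a < x → x < d' → x ∉ X)) := by
      have hm := Ioo_mem_nhdsGT hd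
      rcases FU_right hF a with h1 | h1
      · obtain ⟨l, hl, hl'⟩ := mem_nhdsGT_iff_exists_Ioo_subset.1 h1
        exact ⟨l, hl, Or.inl fun x h2 h3 => (hl' ⟨h2, h3⟩).1⟩
      · obtain ⟨l, hl, hl'⟩ := mem_nhdsGT_iff_exists_Ioo_subset.1 (Filter.inter_mem h1 hm)
        exact ⟨l, hl, Or.inr fun x h2 h3 hx => (hl' ⟨h2, h3⟩).1
          ⟨hx, hc.trans h2, (hl' ⟨h2, h3⟩).2.2⟩⟩
    obtain ⟨d', hd', h1 | h1⟩ := key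
    · refine ⟨d', hd', fun x h2 h3 h4 => ?_⟩
      obtain ⟨-, y, h5, h6, h7⟩ := (fr_iff X x).1 h4 a d' h2 h3
      exact h7 (h1 y h5 h6)
    · refine ⟨d', hd', fun x h2 h3 h4 => ?_⟩
      obtain ⟨⟨y, h5, h6, h7⟩, -⟩ := (fr_iff X x).1 h4 a d' h2 h3
      exact h1 y h5 h6 h7
  obtain ⟨c', hc', H1⟩ := hl
  obtain ⟨d', hd', H2⟩ := hr
  refine ⟨c', d', hc', hd', fun x hx h1 h2 => ?_⟩
  rcases lt_trichotomy x a with h | h | h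
  · exact (H1 x h1 h hx).elim
  · exact h
  · exact (H2 x h h2 hx).elim

theorem LD.isClosed {S : R → Prop} (h : LD S) : IsClosed {x | S x} := by
  rw [← isOpen_compl_iff, isOpen_iff_mem_nhds]
  intro a ha
  obtain ⟨c, d, hc, hd, H⟩ := h a
  filter_upwards [Ioo_mem_nhds hc hd] with x hx hxS
  exact ha (H x hxS hx.1 hx.2 ▸ hxS)

theorem closed_part {X : Set R} (h : LD (fun x => x ∈ frontier X)) :
    IsClosed {x | x ∈ X ∧ x ∈ frontier X} :=
  (h.mono (T := fun x => x ∈ X ∧ x ∈ frontier X) (fun _ hx => hx.2)).isClosed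

theorem FL_to_three {X : Set R} (h : LD (fun x => x ∈ frontier X)) : IsConstructibleSet X := by
  have h1 : X = interior X ∪ ({x | x ∈ X ∧ x ∈ frontier X}ᶜ)ᶜ := by
    rw [compl_compl]
    ext x
    constructor
    · intro hx
      by_cases hi : x ∈ interior X
      · exact Or.inl hi
      · exact Or.inr ⟨hx, subset_closure hx, hi⟩
    · rintro (h | h)
      · exact interior_subset h
      · exact h.1
  rw [h1]
  exact .union _ _ (.of_isOpen _ isOpen_interior)
    (.compl _ (.of_isOpen _ (closed_part h).isOpen_compl))

theorem three_fr {X : Set R} (h : IsConstructibleSet X) : interior (frontier X) = ∅ := by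
  induction h with
  | of_isOpen s hs => rw [← frontier_compl]; exact interior_frontier hs.isClosed_compl
  | compl s _ ih => rwa [frontier_compl]
  | union s t _ _ h1 h2 =>
    have : frontier (s ∪ t) ⊆ frontier s ∪ frontier t :=
      (frontier_union_subset s t).trans
        (Set.union_subset_union Set.inter_subset_left Set.inter_subset_right)
    have h3 : interior (frontier s ∪ frontier t) = ∅ := by
      rw [interior_union_isClosed_of_interior_empty isClosed_frontier h2, h1]
    exact Set.subset_empty_iff.1 (h3 ▸ interior_mono this)

theorem FL_of_not (hlt : IsDefinable L {v : Fin 2 → R | v 0 < v 1})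
    (hadd : IsDefinable L {v : Fin 3 → R | v 0 + v 1 = v 2}) (hDC : DCProp L R)
    (hLUF2 : LUF2 L R) {X : Set R} (hX : DP L (fun v : Fin 1 → R => v 0 ∈ X))
    (h : ∀ c d, c < d → ¬ Set.Ioo c d ⊆ frontier X) : LD (fun x => x ∈ frontier X) := by
  refine E_lem hlt hadd hDC hLUF2 (E := fun x => x ∈ frontier X) (fr_def hlt hX)
    isClosed_frontier ?_
  intro c d hcd
  obtain ⟨x, hx, hx'⟩ := Set.not_subset.1 (h c d hcd)
  exact ⟨x, hx.1, hx.2, hx'⟩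

theorem three_to_FL (hlt : IsDefinable L {v : Fin 2 → R | v 0 < v 1})
    (hadd : IsDefinable L {v : Fin 3 → R | v 0 + v 1 = v 2}) (hDC : DCProp L R)
    (hLUF2 : LUF2 L R) {X : Set R} (hX : DP L (fun v : Fin 1 → R => v 0 ∈ X))
    (h : IsConstructibleSet X) : LD (fun x => x ∈ frontier X) := by
  refine FL_of_not hlt hadd hDC hLUF2 hX ?_
  intro c d hcd hsub
  obtain ⟨x, hx⟩ := exists_between hcd
  have : x ∈ interior (frontier X) := interior_maximal hsub isOpen_Ioo hx
  rw [three_fr h] at this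
  exact this

theorem one_to_FL (hlt : IsDefinable L {v : Fin 2 → R | v 0 < v 1})
    (hadd : IsDefinable L {v : Fin 3 → R | v 0 + v 1 = v 2}) (hDC : DCProp L R)
    (hLUF2 : LUF2 L R) {X : Set R} (hX : DP L (fun v : Fin 1 → R => v 0 ∈ X))
    (h : IsDSigma L {v : Fin 1 → R | v 0 ∈ X}) : LD (fun x => x ∈ frontier X) := by
  obtain ⟨F, ⟨hF, hcl, hr, hs⟩, hU⟩ := h
  have hU' : ∀ x, x ∈ X ↔ ∃ r, 0 < r ∧ ∃ s, 0 < s ∧ (fun _ => x : Fin 1 → R) ∈ famFiber F r s := by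
    intro x
    have := Set.ext_iff.1 hU (fun _ => x)
    simpa using this
  refine FL_of_not hlt hadd hDC hLUF2 hX ?_
  intro c d hcd hsub
  obtain ⟨u, hcu, hud⟩ := exists_between hcd
  obtain ⟨w, huw, hwd⟩ := exists_between hud
  have hQ0 : DP L (fun v : Fin 3 → R => (fun _ => v 2 : Fin 1 → R) ∈ famFiber F (v 0) (v 1)) := by
    have : (fun v : Fin 3 → R => (fun _ => v 2 : Fin 1 → R) ∈ famFiber F (v 0) (v 1))
        = fun v => v ∈ F := by
      funext v
      have hv : Fin.append ![v 0, v 1] (fun _ => v 2 : Fin 1 → R) = v := by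
        ext i; fin_cases i <;> rfl
      show (Fin.append ![v 0, v 1] (fun _ => v 2 : Fin 1 → R) ∈ F) = _
      rw [hv]
    rw [this]
    exact hF
  have hLD := D_lem hlt hadd hDC hLUF2
    (Q := fun r s x => (fun _ => x : Fin 1 → R) ∈ famFiber F r s ∧ u ≤ x ∧ x ≤ w)
    (hQ0.and ((DP.le hlt (DT.const u) (DT.var 2)).and (DP.le hlt (DT.var 2) (DT.const w))))
    (fun r s h1 h2 => ((hcl r s h1 h2).2.1.preimage
      (continuous_pi (fun _ => continuous_id))).inter isClosed_Icc)
    (fun r r' s x h1 h2 h3 h4 => ⟨hr r r' s h1 h2 h3 h4.1, h4.2⟩)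
    (fun r s s' x h1 h2 h3 h4 => ⟨hs r s s' h1 h2 h3 h4.1, h4.2⟩)
    huw.le (fun r s x h => h.2) ?_
  · obtain ⟨a, hua, haw⟩ := exists_between huw
    obtain ⟨c', d', hc', hd', H⟩ := hLD a
    obtain ⟨x, hax, hx⟩ := exists_between (lt_min hd' haw)
    have hxd' := hx.trans_le (min_le_left _ _)
    have hxw := hx.trans_le (min_le_right _ _)
    have hfr := hsub ⟨hcu.trans (hua.trans hax), hxw.trans hwd⟩
    obtain ⟨⟨y, h1, h2, h3⟩, -⟩ := (fr_iff X x).1 hfr a (min d' w) hax hx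
    obtain ⟨r, hr0, s, hs0, hm⟩ := (hU' y).1 h3
    have := H y ⟨r, hr0, s, hs0, hm, (hua.trans h1).le, (h2.trans_le (min_le_right _ _)).le⟩
      (hc'.trans h1) (h2.trans_le (min_le_left _ _))
    exact h1.ne' this
  · intro c' d' hcd'
    by_contra hcon
    push Not at hcon
    have hall : ∀ x, c' < x → x < d' → x ∈ X ∧ u ≤ x ∧ x ≤ w := by
      intro x h1 h2
      obtain ⟨r, hr0, s, hs0, h3, h4⟩ := hcon x h1 h2
      exact ⟨(hU' x).2 ⟨r, hr0, s, hs0, h3⟩, h4⟩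
    obtain ⟨x, h1, h2⟩ := exists_between hcd'
    have h3 := hall x h1 h2
    have hfr := hsub ⟨hcu.trans_le h3.2.1, h3.2.2.trans_lt hwd⟩
    obtain ⟨-, y, h4, h5, h6⟩ := (fr_iff X x).1 hfr c' d' h1 h2
    exact h6 (hall y h4 h5).1

theorem FL_to_one (hlt : IsDefinable L {v : Fin 2 → R | v 0 < v 1})
    (hadd : IsDefinable L {v : Fin 3 → R | v 0 + v 1 = v 2})
    {X : Set R} (hX : DP L (fun v : Fin 1 → R => v 0 ∈ X))
    (h : LD (fun x => x ∈ frontier X)) : IsDSigma L {v : Fin 1 → R | v 0 ∈ X} := by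
  set P : R → R → R → Prop := fun r s x => (-r ≤ x ∧ x ≤ r) ∧
    ((x ∈ X ∧ x ∈ frontier X) ∨ ∀ y, x < y + s → y < x + s → y ∈ X) with hPdef
  have hfr := fr_def hlt hX
  have hP : DP L (fun v : Fin 3 → R => P (v 0) (v 1) (v 2)) := by
    simp only [hPdef]
    repeat' first
      | with_reducible apply DP.mem1 (S := fun x => x ∈ frontier X) hfr
      | with_reducible apply DP.mem1 (S := fun x => x ∈ X) hX
      | exact hlt | exact hadd
      | apply DT.var | apply DT.const | apply DT.add | apply DT.neg | apply DP.all | apply DP.ex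
      | apply DP.and | apply DP.or | apply DP.not | apply DP.imp | apply DP.lt | apply DP.le
  have hcl : ∀ r s, IsClosed {x | P r s x} := by
    intro r s
    have hB : IsClosed {x : R | ∀ y, x < y + s → y < x + s → y ∈ X} := by
      rw [← isOpen_compl_iff, isOpen_iff_mem_nhds]
      intro x hx
      have hx' : ¬ ∀ y, x < y + s → y < x + s → y ∈ X := hx
      push Not at hx'
      obtain ⟨y, h1, h2, h3⟩ := hx'
      filter_upwards [Ioo_mem_nhds (sub_lt_iff_lt_add.2 h2) h1] with z hz hz'
      exact h3 (hz' y hz.2 (sub_lt_iff_lt_add.1 hz.1))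
    exact (isClosed_Icc (a := -r) (b := r)).inter ((closed_part h).union hB)
  have hfam : ∀ r s, famFiber {v : Fin (2 + 1) → R | P (v 0) (v 1) (v 2)} r s
      = {v | P r s (v 0)} := fun r s => rfl
  refine ⟨{v : Fin (2 + 1) → R | P (v 0) (v 1) (v 2)}, ⟨hP, ?_, ?_, ?_⟩, ?_⟩
  · intro r s _ _
    rw [hfam]
    have h2 : IsClosed {v : Fin 1 → R | P r s (v 0)} :=
      IsClosed.preimage (f := fun v : Fin 1 → R => v 0) (continuous_apply 0) (hcl r s)
    refine ⟨DP.mem3 hP (DT.const r) (DT.const s) (DT.var 0),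
      h2, -r, r, ?_⟩
    intro y hy i
    rw [Subsingleton.elim i 0]
    exact hy.1
  · intro r r' s _ _ hrr' v hv
    rw [hfam] at hv ⊢
    exact ⟨⟨(neg_le_neg hrr').trans hv.1.1, hv.1.2.trans hrr'⟩, hv.2⟩
  · intro r s s' _ _ hss' v hv
    rw [hfam] at hv ⊢
    refine ⟨hv.1, hv.2.imp_right fun h y h1 h2 => h y (h1.trans_le ?_) (h2.trans_le ?_)⟩
    · exact add_le_add_right hss' y
    · exact add_le_add_right hss' (v 0)
  · ext v
    simp only [hfam, Set.mem_iUnion, exists_prop]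
    constructor
    · intro hv
      have hv : v 0 ∈ X := hv
      obtain ⟨r, hr⟩ := exists_gt (max (v 0) (max (-(v 0)) 0))
      obtain ⟨hr1, hr'⟩ := max_lt_iff.1 hr
      obtain ⟨hr2, hr3⟩ := max_lt_iff.1 hr'
      by_cases hi : v 0 ∈ frontier X
      · exact ⟨r, hr3, r, hr3, ⟨(neg_lt.1 hr2).le, hr1.le⟩, Or.inl ⟨hv, hi⟩⟩
      · have hi' : v 0 ∈ interior X := by
          by_contra h2
          exact hi ⟨subset_closure hv, h2⟩
        obtain ⟨⟨c, d⟩, ⟨hc, hd⟩, hsub⟩ :=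
          (nhds_basis_Ioo (v 0)).mem_iff.1 (mem_interior_iff_mem_nhds.1 hi')
        refine ⟨r, hr3, min (v 0 - c) (d - v 0), lt_min (sub_pos.2 hc) (sub_pos.2 hd),
          ⟨(neg_lt.1 hr2).le, hr1.le⟩, Or.inr fun y h1 h2 => hsub ⟨?_, ?_⟩⟩
        · have h3 := h1.trans_le (add_le_add_right (min_le_left _ _) y)
          have h4 : y + (v 0 - c) = v 0 + (y - c) := by abel
          rw [h4] at h3
          exact sub_pos.1 (pos_of_lt_add_right h3)
        · have h3 := h2.trans_le (add_le_add_right (min_le_right _ _) (v 0))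
          rwa [add_sub_cancel] at h3
    · rintro ⟨r, hr, s, hs, h1, h2 | h2⟩
      · exact h2.1
      · exact h2 (v 0) (lt_add_of_pos_right _ hs) (lt_add_of_pos_right _ hs)

end main
end Helpers

/-- Let `𝓡` be a definably complete expansion of a densely linearly
ordered abelian group satisfying `LUF₂` and let `X ⊆ R` be definable. The following are
equivalent: (1) `X` is a `D_Σ`-set; (2) every point of `R` has an open interval
neighborhood `I` such that `X ∩ I` is a finite union of points and open intervals;
(3) `X` is constructible. -/
theorem dSigma_tfae_dimOne
    {R : Type*} (L : FirstOrder.Language) [L.Structure R]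
    [LinearOrder R] [DenselyOrdered R] [AddCommGroup R]
    [CovariantClass R R (· + ·) (· < ·)] [TopologicalSpace R] [OrderTopology R]
    (hlt : IsDefinable L {v : Fin 2 → R | v 0 < v 1})
    (hadd : IsDefinable L {v : Fin 3 → R | v 0 + v 1 = v 2})
    (hDC : DCProp L R) (hLUF2 : LUF2 L R)
    (X : Set R) (hX : IsDefinable L {v : Fin 1 → R | v 0 ∈ X}) :
    List.TFAE
      [IsDSigma L {v : Fin 1 → R | v 0 ∈ X},
       ∀ x : R, ∃ c d : R, c < x ∧ x < d ∧ FinUnionPtsIntervals (X ∩ Set.Ioo c d),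
       IsConstructibleSet X] := by
  haveI : IsOrderedAddMonoid R :=
    { add_le_add_left := fun a b hab c => by
        rcases hab.eq_or_lt with rfl | hab
        · exact le_rfl
        · have := CovariantClass.elim (M := R) (N := R) (μ := (· + ·)) (r := (· < ·)) c hab
          simpa [add_comm] using (show c + a < c + b from this).le }
  haveI : Nontrivial R := by
    obtain ⟨_, -, _, _, _, U, ⟨c, d, rfl⟩, h0, -⟩ :=
      hLUF2 1 Set.univ Set.definable_univ 0 (fun _ => 0)
    exact ⟨⟨c 0, 0, (h0 0).1.ne⟩⟩
  tfae_have 1 → 2 := fun h => FL_to_two hlt hDC hX (one_to_FL hlt hadd hDC hLUF2 hX h)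
  tfae_have 2 → 3 := fun h => FL_to_three (two_to_FL h)
  tfae_have 3 → 1 := fun h => FL_to_one hlt hadd hX (three_to_FL hlt hadd hDC hLUF2 hX h)
  tfae_finish
end

section
/- Let 𝓡 = (R, <, +, 0, …) be an expansion of a densely linearly ordered abelian group with 𝓡 ⊨ DC and 𝓡 ⊨ LUF₂, and let X ⊆ R^{m+1} be a D_Σ-set. Then for every a ∈ R and b ∈ R^m there exist positive integers N₁ and N₂, an open interval I containing a, and an open box B containing b, such that X_x ∩ I is the union of at most N₁ points and at most N₂ open intervals for every x ∈ B. Furthermore, B can be taken to be R^m if 𝓡 ⊨ LUF₁, and I can be taken independently of X if 𝓡 ⊨ SLUF. -/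
open FirstOrder Set Topology

namespace DS

open FirstOrder.Language

section Definability

variable (L : FirstOrder.Language) {R : Type*} [L.Structure R]

/-- A definable predicate (with parameters) on tuples. -/
def Dfn {α : Type} (P : (α → R) → Prop) : Prop :=
  Set.Definable (Set.univ : Set R) L {v | P v}

/-- A definable function (with parameters) on tuples. -/
def Tm {α : Type} (f : (α → R) → R) : Prop :=
  Set.DefinableFun L (Set.univ : Set R) f

variable {L} {α : Type}

theorem Tm.var (i : α) : Tm L (fun w : α → R => w i) := Set.DefinableFun.proj L

theorem Tm.const (c : R) : Tm L (fun _ : α → R => c) :=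
  L.definableFun_const α (Set.mem_univ c)

theorem Dfn.and {P Q : (α → R) → Prop} (hP : Dfn L P) (hQ : Dfn L Q) :
    Dfn L (fun v => P v ∧ Q v) := Set.Definable.inter hP hQ

theorem Dfn.or {P Q : (α → R) → Prop} (hP : Dfn L P) (hQ : Dfn L Q) :
    Dfn L (fun v => P v ∨ Q v) := Set.Definable.union hP hQ

theorem Dfn.not {P : (α → R) → Prop} (hP : Dfn L P) :
    Dfn L (fun v => ¬ P v) := Set.Definable.compl hP

theorem Dfn.congr {P Q : (α → R) → Prop} (hP : Dfn L P) (h : ∀ v, P v ↔ Q v) :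
    Dfn L Q := by
  have : P = Q := funext fun v => propext (h v)
  exact this ▸ hP

theorem Dfn.imp {P Q : (α → R) → Prop} (hP : Dfn L P) (hQ : Dfn L Q) :
    Dfn L (fun v => P v → Q v) :=
  (hP.not.or hQ).congr fun v => by tauto

theorem Dfn.ex {Q : (α → R) → R → Prop}
    (h : Dfn L (fun w : α ⊕ Fin 1 → R => Q (fun a => w (Sum.inl a)) (w (Sum.inr 0)))) :
    Dfn L (fun v => ∃ y, Q v y) := by
  have h2 := Set.Definable.exists_of_finite h
  refine Dfn.congr (P := _) h2 fun v => ?_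
  constructor
  · rintro ⟨u, hu⟩
    exact ⟨u 0, hu⟩
  · rintro ⟨y, hy⟩
    exact ⟨fun _ => y, hy⟩

theorem Dfn.all {Q : (α → R) → R → Prop}
    (h : Dfn L (fun w : α ⊕ Fin 1 → R => Q (fun a => w (Sum.inl a)) (w (Sum.inr 0)))) :
    Dfn L (fun v => ∀ y, Q v y) :=
  (Dfn.ex (Q := fun v y => ¬ Q v y) h.not).not.congr fun v => by
    simp only [not_exists, not_not]

theorem Dfn.mem {n : ℕ} {S : Set (Fin n → R)} (hS : IsDefinable L S)
    {F : (α → R) → Fin n → R} (hF : ∀ i, Tm L (fun w => F w i)) :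
    Dfn L (fun w => F w ∈ S) :=
  Set.Definable.preimage_map (F := F) hF hS

theorem Tm.snoc {m : ℕ} {x : (α → R) → Fin m → R} {y : (α → R) → R}
    (hx : ∀ i, Tm L (fun w => x w i)) (hy : Tm L y) :
    ∀ i, Tm L (fun w => (Fin.snoc (x w) (y w) : Fin (m + 1) → R) i) := by
  intro i
  refine Fin.lastCases ?_ (fun j => ?_) i
  · simpa using hy
  · simpa using hx j

theorem Tm.append2 {m : ℕ} {x : (α → R) → Fin m → R} {r s : (α → R) → R}
    (hr : Tm L r) (hs : Tm L s) (hx : ∀ i, Tm L (fun w => x w i)) :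
    ∀ i, Tm L (fun w => (Fin.append ![r w, s w] (x w) : Fin (2 + m) → R) i) := by
  intro i
  refine Fin.addCases (fun j => ?_) (fun j => ?_) i
  · simp only [Fin.append_left]
    fin_cases j
    · simpa using hr
    · simpa using hs
  · simpa using hx j

theorem Dfn.lt [LT R] (hlt : IsDefinable L {v : Fin 2 → R | v 0 < v 1})
    {f g : (α → R) → R} (hf : Tm L f) (hg : Tm L g) : Dfn L (fun w => f w < g w) := by
  refine Dfn.congr (Dfn.mem hlt (F := fun w => ![f w, g w]) ?_) (fun v => by simp)
  intro i
  fin_cases i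
  · simpa using hf
  · simpa using hg

theorem Dfn.le [LinearOrder R] (hlt : IsDefinable L {v : Fin 2 → R | v 0 < v 1})
    {f g : (α → R) → R} (hf : Tm L f) (hg : Tm L g) : Dfn L (fun w => f w ≤ g w) :=
  (Dfn.lt hlt hg hf).not.congr fun v => by simp

theorem Tm.add [Add R] (hadd : IsDefinable L {v : Fin 3 → R | v 0 + v 1 = v 2})
    {f g : (α → R) → R} (hf : Tm L f) (hg : Tm L g) : Tm L (fun w => f w + g w) := by
  have h1 : Tm L (fun v : Fin 2 → R => v 0 + v 1) := by
    have := Set.Definable.preimage_comp (![some 0, some 1, none] : Fin 3 → Option (Fin 2)) hadd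
    unfold Tm Set.DefinableFun
    convert this using 1
    ext v
    simp [Function.tupleGraph]
  have := Set.DefinableFun.comp (g := fun w => ![f w, g w]) (f := fun v : Fin 2 → R => v 0 + v 1)
    (A := (Set.univ : Set R)) (L := L) ?_ h1
  · exact this
  · intro i
    fin_cases i
    · exact hf
    · exact hg

/-- A definable subset of the line. -/
def DSet (L : FirstOrder.Language) {R : Type*} [L.Structure R] (S : Set R) : Prop :=
  ∀ {α : Type} {f : (α → R) → R}, Tm L f → Dfn L (fun w => f w ∈ S)

/-- A definable family of subsets of the line. -/
def DFam (L : FirstOrder.Language) {R : Type*} [L.Structure R] {m : ℕ}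
    (S : (Fin m → R) → Set R) : Prop :=
  ∀ {α : Type} {x : (α → R) → Fin m → R} {f : (α → R) → R},
    (∀ i, Tm L (fun w => x w i)) → Tm L f → Dfn L (fun w => f w ∈ S (x w))

/-- A definable family of subsets of the line with an additional scalar parameter. -/
def DFam1 (L : FirstOrder.Language) {R : Type*} [L.Structure R] {m : ℕ}
    (S : (Fin m → R) → R → Set R) : Prop :=
  ∀ {α : Type} {x : (α → R) → Fin m → R} {d f : (α → R) → R},
    (∀ i, Tm L (fun w => x w i)) → Tm L d → Tm L f → Dfn L (fun w => f w ∈ S (x w) (d w))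

theorem Dfn.memG {β : Type} [Finite β] {P : (β → R) → Prop} (hP : Dfn L P)
    {F : (α → R) → β → R} (hF : ∀ i, Tm L (fun w => F w i)) :
    Dfn L (fun w => P (F w)) :=
  Set.Definable.preimage_map (F := F) hF hP

theorem DSet.mk {S : Set R} (h : Dfn L (fun v : Fin 1 → R => v 0 ∈ S)) : DSet L S := by
  intro α f hf
  exact Dfn.memG h (F := fun w _ => f w) (fun _ => hf)

theorem DFam.mk {m : ℕ} {S : (Fin m → R) → Set R}
    (h : Dfn L (fun v : Fin m ⊕ Fin 1 → R => v (Sum.inr 0) ∈ S (fun i => v (Sum.inl i)))) :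
    DFam L S := by
  intro α x f hx hf
  refine Dfn.memG h (F := fun w => Sum.elim (x w) (fun _ => f w)) ?_
  rintro (i | i)
  · exact hx i
  · exact hf

theorem DFam1.mk {m : ℕ} {S : (Fin m → R) → R → Set R}
    (h : Dfn L (fun v : Fin m ⊕ Fin 2 → R =>
      v (Sum.inr 1) ∈ S (fun i => v (Sum.inl i)) (v (Sum.inr 0)))) :
    DFam1 L S := by
  intro α x d f hx hd hf
  refine Dfn.memG h (F := fun w => Sum.elim (x w) (![d w, f w])) ?_
  rintro (i | i)
  · exact hx i
  · fin_cases i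
    · exact hd
    · exact hf

theorem DFam.dset {m : ℕ} {S : (Fin m → R) → Set R} (h : DFam L S) (x : Fin m → R) :
    DSet L (S x) := fun hf => h (fun i => Tm.const (x i)) hf

theorem DFam1.dset {m : ℕ} {S : (Fin m → R) → R → Set R} (h : DFam1 L S) (x : Fin m → R)
    (d : R) : DSet L (S x d) := fun hf => h (fun i => Tm.const (x i)) (Tm.const d) hf

end Definability

section Comb

theorem finite_Ioo_right {R : Type*} [LinearOrder R] [DenselyOrdered R]
    {F : Set R} (hF : F.Finite) (a b : R) (hab : a < b) :
    ∃ e, a < e ∧ e ≤ b ∧ ∀ z, a < z → z < e → z ∉ F := by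
  induction F, hF using Set.Finite.induction_on with
  | empty => exact ⟨b, hab, le_rfl, by simp⟩
  | @insert y F _ _ ih =>
    obtain ⟨e, he, heb, h⟩ := ih
    by_cases hy : a < y
    · refine ⟨min e y, lt_min he hy, (min_le_left _ _).trans heb, ?_⟩
      rintro z hz hz2 (rfl | hz3)
      · exact absurd (hz2.trans_le (min_le_right _ _)) (lt_irrefl _)
      · exact h z hz (hz2.trans_le (min_le_left _ _)) hz3
    · refine ⟨e, he, heb, ?_⟩
      rintro z hz hz2 (rfl | hz3)
      · exact hy hz
      · exact h z hz hz2 hz3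

theorem directed_encard {R : Type*} [LinearOrder R] [Zero R] {β : Type*} {W : R → Set β}
    (hW : ∀ d d', 0 < d → d ≤ d' → W d' ⊆ W d) {d0 : R}
    (hdense : ∃ e, 0 < e ∧ e < d0)
    {N : ℕ} {K : Set β} (hN : ∀ d, 0 < d → d < d0 → (W d ∩ K).encard ≤ N) :
    ({y | ∃ d, 0 < d ∧ y ∈ W d} ∩ K).encard ≤ N := by
  by_contra hcon
  rw [not_le] at hcon
  have h1 : ((N + 1 : ℕ) : ℕ∞) ≤ ({y | ∃ d, 0 < d ∧ y ∈ W d} ∩ K).encard := by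
    have := Order.add_one_le_of_lt hcon
    exact_mod_cast this
  obtain ⟨t, ht, htc⟩ := Set.exists_subset_encard_eq h1
  have htf : t.Finite := Set.finite_of_encard_eq_coe htc
  have key : ∃ d, 0 < d ∧ d < d0 ∧ t ⊆ W d := by
    have ht2 : t ⊆ {y | ∃ d, 0 < d ∧ y ∈ W d} := fun y hy => (ht hy).1
    clear htc ht
    induction t, htf using Set.Finite.induction_on with
    | empty => obtain ⟨e, he, he2⟩ := hdense; exact ⟨e, he, he2, by simp⟩
    | @insert y F _ _ ih =>
      obtain ⟨d, hd, hdd, hF⟩ := ih (fun z hz => ht2 (Set.mem_insert_of_mem _ hz))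
      obtain ⟨d', hd', hy⟩ := ht2 (Set.mem_insert y F)
      refine ⟨min d d', lt_min hd hd', (min_le_left _ _).trans_lt hdd, ?_⟩
      rintro z (rfl | hz)
      · exact hW _ _ (lt_min hd hd') (min_le_right _ _) hy
      · exact hW _ _ (lt_min hd hd') (min_le_left _ _) (hF hz)
  obtain ⟨d, hd, hdd, hF⟩ := key
  have h2 : t.encard ≤ (W d ∩ K).encard := Set.encard_le_encard fun y hy => ⟨hF hy, (ht hy).2⟩
  have h3 := h2.trans (hN d hd hdd)
  rw [htc] at h3
  have : N + 1 ≤ N := by exact_mod_cast h3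
  omega

/-- `S` is `d`-separated. -/
def Sep {R : Type*} [LT R] [LE R] [Add R] (d : R) (S : Set R) : Prop :=
  ∀ y ∈ S, ∀ y' ∈ S, y < y' → y + d ≤ y'

theorem count {R : Type*} [LinearOrder R] {S : Set R}
    (hmin : ∀ y, (∃ z ∈ S, y ≤ z) → ∃ w ∈ S, y ≤ w ∧ ∀ z ∈ S, y ≤ z → w ≤ z)
    (hmin2 : ∀ y, (∃ z ∈ S, y < z) → ∃ w ∈ S, y < w ∧ ∀ z ∈ S, y < z → w ≤ z)
    (t u : R) (N : ℕ) (h : ¬ (S ∩ Set.Icc t u).encard ≤ N) :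
    ∃ u', t ≤ u' ∧ u' ≤ u ∧ (S ∩ Set.Icc t u').encard = (N + 1 : ℕ) := by
  induction N with
  | zero =>
    have : (S ∩ Set.Icc t u).Nonempty := by
      by_contra hne
      rw [Set.not_nonempty_iff_eq_empty] at hne
      simp [hne] at h
    obtain ⟨z, hz, hz1, hz2⟩ := this
    obtain ⟨w, hw, hw1, hw2⟩ := hmin t ⟨z, hz, hz1⟩
    refine ⟨w, hw1, (hw2 z hz hz1).trans hz2, ?_⟩
    have : S ∩ Set.Icc t w = {w} := by
      ext y
      simp only [Set.mem_inter_iff, Set.mem_Icc, Set.mem_singleton_iff]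
      constructor
      · rintro ⟨h1, h2, h3⟩
        exact le_antisymm h3 (hw2 y h1 h2)
      · rintro rfl
        exact ⟨hw, hw1, le_rfl⟩
    simp [this]
  | succ N ih =>
    obtain ⟨u', h1, h2, h3⟩ := ih (fun hh => h (hh.trans (by exact_mod_cast Nat.le_succ N)))
    have : ∃ z ∈ S, u' < z ∧ z ≤ u := by
      by_contra hne
      push Not at hne
      apply h
      rw [← h3]
      apply Set.encard_le_encard
      rintro y ⟨hy, hy1, hy2⟩
      refine ⟨hy, hy1, ?_⟩
      by_contra hlt
      exact absurd hy2 (not_le.2 (hne y hy (not_le.1 hlt)))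
    obtain ⟨z, hz, hz1, hz2⟩ := this
    obtain ⟨w, hw, hw1, hw2⟩ := hmin2 u' ⟨z, hz, hz1⟩
    refine ⟨w, h1.trans hw1.le, (hw2 z hz hz1).trans hz2, ?_⟩
    have : S ∩ Set.Icc t w = insert w (S ∩ Set.Icc t u') := by
      ext y
      simp only [Set.mem_inter_iff, Set.mem_Icc, Set.mem_insert_iff]
      constructor
      · rintro ⟨h1, h2, h3⟩
        rcases le_or_gt y u' with h4 | h4
        · exact Or.inr ⟨h1, h2, h4⟩
        · exact Or.inl (le_antisymm h3 (hw2 y h1 h4))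
      · rintro (rfl | ⟨h5, h6, h7⟩)
        · exact ⟨hw, h1.trans hw1.le, le_rfl⟩
        · exact ⟨h5, h6, h7.trans hw1.le⟩
    rw [this, Set.encard_insert_of_notMem, h3]
    · push_cast; rfl
    · rintro ⟨_, _, h8⟩
      exact absurd hw1 (not_lt.2 h8)

end Comb

section Main

set_option linter.unusedSectionVars false

variable {R : Type*} {L : FirstOrder.Language} [L.Structure R]
    [LinearOrder R] [DenselyOrdered R] [AddCommGroup R] [IsOrderedAddMonoid R] [Nontrivial R]

theorem exists_lub (hDC : DCProp L R) {S : Set R} (hS : DSet L S) (hne : S.Nonempty)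
    (hb : BddAbove S) : ∃ a, IsLUB S a := hDC S (hS (Tm.var 0)) hne hb

theorem exists_glb (hlt : IsDefinable L {v : Fin 2 → R | v 0 < v 1})
    (hDC : DCProp L R) {S : Set R} (hS : DSet L S) (hne : S.Nonempty)
    (hb : BddBelow S) : ∃ a, IsGLB S a := by
  have h1 : DSet L (lowerBounds S) := by
    apply DSet.mk
    have : Dfn L (fun w : Fin 1 → R => ∀ z, z ∈ S → w 0 ≤ z) := by
      apply Dfn.all
      exact Dfn.imp (hS (Tm.var _)) (Dfn.le hlt (Tm.var _) (Tm.var _))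
    exact this.congr fun v => by simp [lowerBounds]
  obtain ⟨a, ha⟩ := exists_lub hDC h1 hb ⟨hne.some, fun y hy => hy hne.some_mem⟩
  exact ⟨a, isLUB_lowerBounds.1 ha⟩

theorem sep_min (hlt : IsDefinable L {v : Fin 2 → R | v 0 < v 1})
    (hDC : DCProp L R) {S : Set R} (hS : DSet L S) {d : R} (hd : 0 < d) (hsep : Sep d S)
    (hne : S.Nonempty) (hb : BddBelow S) : ∃ w ∈ S, ∀ z ∈ S, w ≤ z := by
  obtain ⟨g, hg⟩ := exists_glb hlt hDC hS hne hb
  have h1 : ∃ w ∈ S, w < g + d := by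
    by_contra hcon
    push Not at hcon
    have := hg.2 hcon
    exact absurd this (not_le.2 (lt_add_of_pos_right g hd))
  obtain ⟨w, hw, hwg⟩ := h1
  refine ⟨w, hw, fun z hz => ?_⟩
  by_contra hlt'
  have h2 := hsep z hz w hw (not_le.1 hlt')
  have h3 := hg.1 hz
  have h4 : z + d < g + d := h2.trans_lt hwg
  exact absurd h3 (not_le.2 (lt_of_add_lt_add_right h4))

theorem core (hlt : IsDefinable L {v : Fin 2 → R | v 0 < v 1})
    (hDC : DCProp L R) {Z : R → Set R} (hZ : ∀ d, DSet L (Z d))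
    (hsep : ∀ d, 0 < d → Sep d (Z d)) (hmono : ∀ d d', 0 < d → d ≤ d' → Z d' ⊆ Z d)
    {c e d0 : R} {N : ℕ} (hd0 : 0 < d0)
    (hN : ∀ d, 0 < d → d < d0 → ∀ u, c ≤ u → u ≤ e →
      (Z d ∩ Set.Icc c u).Infinite ∨ (Z d ∩ Set.Icc c u).ncard ≤ N) :
    ({y | ∃ d, 0 < d ∧ y ∈ Z d} ∩ Set.Icc c e).encard ≤ N := by
  refine directed_encard hmono (exists_between hd0) fun d hd hdd => ?_
  by_contra hcon
  have hm1 : ∀ y, DSet L (Z d ∩ Set.Ici y) := fun y => DSet.mk <|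
    (Dfn.and (hZ d (Tm.var 0)) (Dfn.le hlt (Tm.const y) (Tm.var 0))).congr fun v => by simp
  have hm2 : ∀ y, DSet L (Z d ∩ Set.Ioi y) := fun y => DSet.mk <|
    (Dfn.and (hZ d (Tm.var 0)) (Dfn.lt hlt (Tm.const y) (Tm.var 0))).congr fun v => by simp
  have hs : ∀ T, Sep d (Z d ∩ T) := fun T y hy y' hy' h => hsep d hd y hy.1 y' hy'.1 h
  obtain ⟨u, hu1, hu2, hu3⟩ := count (S := Z d) (fun y ⟨z, hz, hyz⟩ => by
      obtain ⟨w, hw, h⟩ := sep_min hlt hDC (hm1 y) hd (hs _) ⟨z, hz, hyz⟩ ⟨y, fun _ h => h.2⟩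
      exact ⟨w, hw.1, hw.2, fun z hz hz' => h z ⟨hz, hz'⟩⟩)
    (fun y ⟨z, hz, hyz⟩ => by
      obtain ⟨w, hw, h⟩ := sep_min hlt hDC (hm2 y) hd (hs _) ⟨z, hz, hyz⟩
        ⟨y, fun _ h => le_of_lt h.2⟩
      exact ⟨w, hw.1, hw.2, fun z hz hz' => h z ⟨hz, hz'⟩⟩) c e N hcon
  rcases hN d hd hdd u hu1 hu2 with h | h
  · exact h (Set.finite_of_encard_eq_coe hu3)
  · have : (Z d ∩ Set.Icc c u).ncard = N + 1 := by
      simp [Set.ncard, hu3]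
    omega

/-- The auxiliary definable set to which the uniform finiteness properties are applied. -/
def lufset {m : ℕ} (Z : (Fin m → R) → R → Set R) : Set (Fin (m + 2 + 1) → R) :=
  {v | v (Fin.last _) ∈ Z (fun i => v (Fin.castSucc (Fin.castAdd 2 i)))
      (v (Fin.castSucc (Fin.natAdd m 0))) ∧
    v (Fin.last _) ≤ v (Fin.castSucc (Fin.natAdd m 1))}

theorem lufset_def (hlt : IsDefinable L {v : Fin 2 → R | v 0 < v 1})
    {m : ℕ} {Z : (Fin m → R) → R → Set R} (hZ : DFam1 L Z) :
    IsDefinable L (lufset Z) :=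
  Dfn.and (hZ (fun _ => Tm.var _) (Tm.var _) (Tm.var _)) (Dfn.le hlt (Tm.var _) (Tm.var _))

theorem lufset_fiber {m : ℕ} (Z : (Fin m → R) → R → Set R) (x : Fin m → R) (d u : R) :
    fiber1 (lufset Z) (Fin.append x ![d, u]) = {y | y ∈ Z x d ∧ y ≤ u} := by
  ext y
  simp only [fiber1, lufset, Set.mem_ofPred_eq, Fin.snoc_last, Fin.snoc_castSucc,
    Fin.append_left, Fin.append_right, Matrix.cons_val_zero, Matrix.cons_val_one]

theorem lufset_fiber_inter {m : ℕ} (Z : (Fin m → R) → R → Set R) (x : Fin m → R) (d u c e : R)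
    (hu : u ≤ e) :
    fiber1 (lufset Z) (Fin.append x ![d, u]) ∩ Set.Icc c e = Z x d ∩ Set.Icc c u := by
  rw [lufset_fiber]
  ext y
  simp only [Set.mem_inter_iff, Set.mem_ofPred_eq, Set.mem_Icc]
  constructor
  · rintro ⟨⟨h1, h2⟩, h3, h4⟩
    exact ⟨h1, h3, h2⟩
  · rintro ⟨h1, h2, h3⟩
    exact ⟨⟨h1, h3⟩, h2, h3.trans hu⟩

/-- Separated definable family, increasing as the separation tends to zero. -/
def SepFam {m : ℕ} (Z : (Fin m → R) → R → Set R) : Prop :=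
  (∀ x d, 0 < d → Sep d (Z x d)) ∧ ∀ x d d', 0 < d → d ≤ d' → Z x d' ⊆ Z x d

variable [TopologicalSpace R] [OrderTopology R]

theorem lemmaA2 (hlt : IsDefinable L {v : Fin 2 → R | v 0 < v 1})
    (hDC : DCProp L R) (hLUF2 : LUF2 L R) {m : ℕ} {Z : (Fin m → R) → R → Set R}
    (hZ : DFam1 L Z) (hs : SepFam Z) (a : R) (b : Fin m → R) :
    ∃ N : ℕ, 0 < N ∧ ∃ c e : R, c < a ∧ a < e ∧ ∃ B : Set (Fin m → R), OpenBox B ∧ b ∈ B ∧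
      ∀ x ∈ B, ({y | ∃ d, 0 < d ∧ y ∈ Z x d} ∩ Set.Icc c e).encard ≤ N := by
  obtain ⟨N, hN, p, q, hpq, U, ⟨k, l, rfl⟩, hb, h⟩ :=
    hLUF2 (m + 2) (lufset Z) (lufset_def hlt hZ) a (Fin.append b ![0, a])
  rw [interior_Icc] at hpq
  have hb0 := hb (Fin.natAdd m 0)
  have hb1 := hb (Fin.natAdd m 1)
  simp only [Fin.append_right, Matrix.cons_val_zero, Matrix.cons_val_one] at hb0 hb1
  obtain ⟨c, hc1, hc2⟩ := exists_between (max_lt hpq.1 hb1.1)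
  obtain ⟨e, he1, he2⟩ := exists_between (lt_min hpq.2 hb1.2)
  refine ⟨N, hN, c, e, hc2, he1,
    {x | ∀ i, k (Fin.castAdd 2 i) < x i ∧ x i < l (Fin.castAdd 2 i)}, ⟨_, _, rfl⟩, ?_, ?_⟩
  · intro i
    simpa using hb (Fin.castAdd 2 i)
  · intro x hx
    refine core hlt hDC (fun d => hZ.dset x d) (hs.1 x) (hs.2 x) hb0.2 fun d hd hdd u hcu hue => ?_
    have h1 := h (Fin.append x ![d, u]) ?_ c e ?_ ?_
    · rwa [lufset_fiber_inter _ _ _ _ _ _ hue] at h1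
    · intro i
      refine Fin.addCases (fun j => ?_) (fun j => ?_) i
      · simpa using hx j
      · fin_cases j
        · simpa using ⟨hb0.1.trans hd, hdd⟩
        · have h2 := ((le_max_right _ _).trans_lt hc1).trans_le hcu
          have h3 := hue.trans_lt (he2.trans_le (min_le_right _ _))
          simpa using ⟨h2, h3⟩
    · rw [interior_Icc]; exact ⟨hc2, he1⟩
    · exact Set.Icc_subset_Icc ((le_max_left _ _).trans hc1.le) (he2.le.trans (min_le_left _ _))

theorem lemmaA_core (hlt : IsDefinable L {v : Fin 2 → R | v 0 < v 1})
    (hDC : DCProp L R) {m : ℕ} {Z : (Fin m → R) → R → Set R}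
    (hZ : DFam1 L Z) (hs : SepFam Z) (a p q : R) (hpq : a ∈ interior (Set.Icc p q)) (N : ℕ)
    (h : ∀ (x : Fin (m + 2) → R), ∀ p' q' : R,
        a ∈ interior (Set.Icc p' q') → Set.Icc p' q' ⊆ Set.Icc p q →
          (fiber1 (lufset Z) x ∩ Set.Icc p' q').Infinite ∨
          (fiber1 (lufset Z) x ∩ Set.Icc p' q').ncard ≤ N) (x : Fin m → R) :
    ({y | ∃ d, 0 < d ∧ y ∈ Z x d} ∩ Set.Icc p q).encard ≤ N := by
  obtain ⟨d0, hd0⟩ := exists_gt (0 : R)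
  refine core hlt hDC (fun d => hZ.dset x d) (hs.1 x) (hs.2 x) hd0 fun d hd hdd u hcu hue => ?_
  have h1 := h (Fin.append x ![d, u]) p q hpq subset_rfl
  rwa [lufset_fiber_inter _ _ _ _ _ _ hue] at h1

/-- One-dimensional pointwise version. -/
theorem lemmaA0 (hlt : IsDefinable L {v : Fin 2 → R | v 0 < v 1})
    (hDC : DCProp L R) (hLUF2 : LUF2 L R) {Z : R → Set R}
    (hZ : Dfn L (fun v : Fin 2 → R => v 1 ∈ Z (v 0)))
    (hsep : ∀ d, 0 < d → Sep d (Z d)) (hmono : ∀ d d', 0 < d → d ≤ d' → Z d' ⊆ Z d) (a : R) :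
    ∃ c e : R, c < a ∧ a < e ∧ ({y | ∃ d, 0 < d ∧ y ∈ Z d} ∩ Set.Icc c e).Finite := by
  have hF : DFam1 L (fun (_ : Fin 0 → R) => Z) := by
    apply DFam1.mk
    exact Dfn.memG hZ (F := fun w i => w (Sum.inr i)) (fun _ => Tm.var _)
  obtain ⟨N, -, c, e, hc, he, B, -, hB, h⟩ := lemmaA2 hlt hDC hLUF2 hF
    ⟨fun _ => hsep, fun _ => hmono⟩ a Fin.elim0
  exact ⟨c, e, hc, he, Set.finite_of_encard_le_coe (h _ hB)⟩

/-- Order-theoretic interior. -/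
def Intr (S : Set R) (y : R) : Prop :=
  ∃ p q, p < y ∧ y < q ∧ ∀ z, p < z → z < q → z ∈ S

theorem lemmaB (hlt : IsDefinable L {v : Fin 2 → R | v 0 < v 1})
    (hadd : IsDefinable L {v : Fin 3 → R | v 0 + v 1 = v 2})
    (hDC : DCProp L R) (hLUF2 : LUF2 L R) {S : Set R} (hS : DSet L S) (a : R) :
    ∃ e, a < e ∧ ((∀ z, a < z → z < e → z ∈ S) ∨
      ∀ p q, a ≤ p → p < q → q ≤ e → ∃ z, p < z ∧ z < q ∧ z ∉ S) := by
  have hI : DSet L {y | Intr S y} := by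
    apply DSet.mk
    simp only [Intr, Set.mem_ofPred_eq]
    repeat' first
      | exact Tm.var _ | exact Tm.const _ | apply Dfn.lt hlt | refine hS ?_ | apply Dfn.not
      | apply Dfn.and | apply Dfn.ex | apply Dfn.all | apply Dfn.imp
  obtain ⟨c, e, hc, he, hfin⟩ := lemmaA0 hlt hDC hLUF2
    (Z := fun d => {y | ¬ Intr S y ∧ ∀ z, y < z → z < y + d → z ∈ S}) (by
      simp only [Set.mem_ofPred_eq]
      have hI' : ∀ {α : Type} {f : (α → R) → R}, Tm L f → Dfn L (fun w => Intr S (f w)) := hI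
      repeat' first
        | exact Tm.var _ | exact Tm.const _ | apply Tm.add hadd | apply Dfn.lt hlt | refine hS ?_
        | refine hI' ?_ | apply Dfn.not | apply Dfn.and | apply Dfn.ex | apply Dfn.all
        | apply Dfn.imp)
    (by
      rintro d hd y ⟨-, hy⟩ y' ⟨hy', -⟩ hyy
      by_contra hcon
      exact hy' ⟨y, y + d, hyy, not_le.1 hcon, hy⟩)
    (by
      rintro d d' hd hdd y ⟨h1, h2⟩
      exact ⟨h1, fun z hz hz' => h2 z hz (hz'.trans_le (by gcongr))⟩) a
  obtain ⟨e', he', hee, hno⟩ := finite_Ioo_right hfin a e he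
  by_cases hex : ∃ z, a < z ∧ z < e' ∧ Intr S z
  · obtain ⟨z, haz, hze, hz⟩ := hex
    refine ⟨z, haz, Or.inl ?_⟩
    by_contra hcon
    push Not at hcon
    obtain ⟨y0, hy1, hy2, hy3⟩ := hcon
    have hA : DSet L {y | y < z ∧ ¬ Intr S y} := by
      apply DSet.mk
      exact Dfn.and (Dfn.lt hlt (Tm.var _) (Tm.const _)) (Dfn.not (hI (Tm.var _)))
    have hy0 : ¬ Intr S y0 := fun ⟨p, q, h1, h2, h3⟩ => hy3 (h3 _ h1 h2)
    obtain ⟨w, hw⟩ := exists_lub hDC hA ⟨y0, hy2, hy0⟩ ⟨z, fun y hy => hy.1.le⟩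
    have hy0w : y0 ≤ w := hw.1 ⟨hy2, hy0⟩
    have hwz : w ≤ z := hw.2 fun y hy => hy.1.le
    have hwI : ¬ Intr S w := by
      rintro ⟨p, q, h1, h2, h3⟩
      obtain ⟨y, hy, hpy, hyw⟩ := hw.exists_between h1
      exact hy.2 ⟨p, q, hpy, hyw.trans_lt h2, h3⟩
    have hwz' : w < z := lt_of_le_of_ne hwz (fun h => hwI (h ▸ hz))
    refine hno w (hy1.trans_le hy0w) (hwz'.trans hze) ⟨⟨z - w, sub_pos.2 hwz', hwI, ?_⟩, ?_⟩
    · intro u hu hu'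
      rw [add_sub_cancel] at hu'
      by_contra huS
      have : ¬ Intr S u := fun ⟨p, q, h1, h2, h3⟩ => huS (h3 _ h1 h2)
      exact absurd (hw.1 ⟨hu', this⟩) (not_le.2 hu)
    · exact ⟨(hc.trans (hy1.trans_le hy0w)).le, ((hwz'.trans hze).trans_le hee).le⟩
  · refine ⟨e', he', Or.inr fun p q hp hpq hq => ?_⟩
    by_contra hcon
    push Not at hcon
    obtain ⟨z, hz1, hz2⟩ := exists_between hpq
    exact hex ⟨z, hp.trans_lt hz1, hz2.trans_le hq, p, q, hz1, hz2, hcon⟩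

theorem finite_isolated {F : Set R} (hF : F.Finite) (a : R) :
    ∃ η, 0 < η ∧ ∀ z ∈ F, z ≠ a → η ≤ |z - a| := by
  induction F, hF using Set.Finite.induction_on with
  | empty => obtain ⟨d, hd⟩ := exists_gt (0 : R); exact ⟨d, hd, by simp⟩
  | @insert y F _ _ ih =>
    obtain ⟨e, he, h⟩ := ih
    by_cases hy : y = a
    · refine ⟨e, he, ?_⟩
      rintro z (rfl | hz) hza
      · exact absurd hy hza
      · exact h z hz hza
    · refine ⟨min e |y - a|, lt_min he (abs_pos.2 (sub_ne_zero.2 hy)), ?_⟩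
      rintro z (rfl | hz) hza
      · exact min_le_right _ _
      · exact (min_le_left _ _).trans (h z hz hza)

theorem sep_compact (hlt : IsDefinable L {v : Fin 2 → R | v 0 < v 1})
    (hadd : IsDefinable L {v : Fin 3 → R | v 0 + v 1 = v 2})
    (hDC : DCProp L R) {S : Set R} (hS : DSet L S) {c d : R} (hcd : c ≤ d)
    (hfin : ∀ a, c ≤ a → a ≤ d → ∃ p q, p < a ∧ a < q ∧ (S ∩ Set.Icc p q).Finite) :
    ∃ δ, 0 < δ ∧ Sep δ (S ∩ Set.Icc c d) := by
  have hiso : ∀ a, c ≤ a → a ≤ d → ∃ η, 0 < η ∧ ∀ z ∈ S, |z - a| < η → z = a := by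
    intro a ha1 ha2
    obtain ⟨p, q, hp, hq, hf⟩ := hfin a ha1 ha2
    obtain ⟨η, hη, h⟩ := finite_isolated hf a
    refine ⟨min η (min (a - p) (q - a)),
      lt_min hη (lt_min (sub_pos.2 hp) (sub_pos.2 hq)), fun z hz hza => ?_⟩
    simp only [lt_min_iff] at hza
    obtain ⟨h1, h2, h3⟩ := hza
    by_contra hne
    refine absurd h1 (not_lt.2 (h z ⟨hz, ?_, ?_⟩ hne))
    · have := (abs_lt.1 h2).1
      rw [neg_sub] at this
      exact ((sub_lt_sub_iff_right a).1 this).le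
    · have := (abs_lt.1 h3).2
      exact ((sub_lt_sub_iff_right a).1 this).le
  obtain ⟨d1, hd1⟩ := exists_gt (0 : R)
  have hcA : c ∈ {z | c ≤ z ∧ z ≤ d ∧ ∃ δ, 0 < δ ∧ Sep δ (S ∩ Set.Icc c z)} := by
    refine ⟨le_rfl, hcd, d1, hd1, ?_⟩
    rintro y ⟨-, h1, h2⟩ y' ⟨-, h3, h4⟩ h
    exact absurd (h.trans_le h4) (not_lt.2 h1)
  have hA : DSet L {z | c ≤ z ∧ z ≤ d ∧ ∃ δ, 0 < δ ∧ Sep δ (S ∩ Set.Icc c z)} := by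
    apply DSet.mk
    simp only [Set.mem_ofPred_eq, Sep, Set.mem_inter_iff, Set.mem_Icc]
    repeat' first
      | exact Tm.var _ | exact Tm.const _ | apply Tm.add hadd | apply Dfn.lt hlt
      | apply Dfn.le hlt | refine hS ?_
      | apply Dfn.not | apply Dfn.and | apply Dfn.ex | apply Dfn.all | apply Dfn.imp
  obtain ⟨w, hw⟩ := exists_lub hDC hA ⟨c, hcA⟩ ⟨d, fun y hy => hy.2.1⟩
  have hcw : c ≤ w := hw.1 hcA
  have hwd : w ≤ d := hw.2 fun y hy => hy.2.1
  obtain ⟨η, hη, hw1⟩ := hiso w hcw hwd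
  obtain ⟨z0, ⟨hz1, hz2, δ, hδ, hz3⟩, hz4, hz5⟩ := hw.exists_between (sub_lt_self w hη)
  have claim : ∀ u, u < w + η → Sep (min δ η) (S ∩ Set.Icc c u) := by
    rintro u hu y ⟨hyS, hy1, hy2⟩ y' ⟨hyS', hy1', hy2'⟩ hyy
    rcases le_or_gt y' z0 with h | h
    · have := hz3 y ⟨hyS, hy1, hyy.le.trans h⟩ y' ⟨hyS', hy1', h⟩ hyy
      exact le_trans (by gcongr; exact min_le_left _ _) this
    · have hy'w : y' = w := by
        apply hw1 _ hyS'
        rw [abs_lt]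
        constructor
        · have := hz4.trans h
          rw [neg_lt, neg_sub]
          exact sub_lt_comm.1 this
        · rw [sub_lt_iff_lt_add']
          exact hy2'.trans_lt hu
      subst hy'w
      have : y + η ≤ y' := by
        by_contra hcon
        rw [not_le] at hcon
        refine hyy.ne (hw1 y hyS ?_)
        rw [abs_sub_comm, abs_of_pos (sub_pos.2 hyy), sub_lt_iff_lt_add']
        exact hcon
      exact le_trans (by gcongr; exact min_le_right _ _) this
  have hwd' : w = d := by
    by_contra hne
    have hlt' := lt_of_le_of_ne hwd hne
    obtain ⟨u, hu1, hu2⟩ := exists_between (lt_min hlt' (lt_add_of_pos_right w hη))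
    have huA : u ∈ {z | c ≤ z ∧ z ≤ d ∧ ∃ δ, 0 < δ ∧ Sep δ (S ∩ Set.Icc c z)} :=
      ⟨hcw.trans hu1.le, hu2.le.trans (min_le_left _ _), _, lt_min hδ hη,
        claim u (hu2.trans_le (min_le_right _ _))⟩
    exact absurd (hw.1 huA) (not_le.2 hu1)
  exact ⟨_, lt_min hδ hη, claim d (hwd' ▸ lt_add_of_pos_right w hη)⟩

theorem germ (hlt : IsDefinable L {v : Fin 2 → R | v 0 < v 1})
    (hadd : IsDefinable L {v : Fin 3 → R | v 0 + v 1 = v 2})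
    (hDC : DCProp L R) (hLUF2 : LUF2 L R) {Y : R → R → Set R}
    (hY : ∀ {α : Type} {f g h : (α → R) → R}, Tm L f → Tm L g → Tm L h →
      Dfn L (fun w => h w ∈ Y (f w) (g w)))
    (hcl : ∀ r s, 0 < r → 0 < s → ∀ y, y ∉ Y r s →
      ∃ p q, p < y ∧ y < q ∧ ∀ z, p < z → z < q → z ∉ Y r s)
    (hr : ∀ r r' s, 0 < r → 0 < s → r ≤ r' → Y r s ⊆ Y r' s)
    (hs : ∀ r s s', 0 < r → 0 < s → s ≤ s' → Y r s' ⊆ Y r s) (a : R) :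
    ∃ e, a < e ∧ ((∀ z, a < z → z < e → z ∈ {y | ∃ r, 0 < r ∧ ∃ s, 0 < s ∧ y ∈ Y r s}) ∨
      (∀ z, a < z → z < e → z ∉ {y | ∃ r, 0 < r ∧ ∃ s, 0 < s ∧ y ∈ Y r s})) := by
  set S : Set R := {y | ∃ r, 0 < r ∧ ∃ s, 0 < s ∧ y ∈ Y r s} with hSdef
  have hS : DSet L S := by
    apply DSet.mk
    simp only [hSdef, Set.mem_ofPred_eq]
    repeat' first
      | exact Tm.var _ | exact Tm.const _ | apply Dfn.lt hlt | refine hY ?_ ?_ ?_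
      | apply Dfn.and | apply Dfn.ex
  have hSc : DSet L Sᶜ := by
    apply DSet.mk
    exact Dfn.not (hS (Tm.var _))
  obtain ⟨e1, he1, h1⟩ := lemmaB hlt hadd hDC hLUF2 hS a
  rcases h1 with h1 | h1
  · exact ⟨e1, he1, Or.inl h1⟩
  obtain ⟨e2, he2, h2⟩ := lemmaB hlt hadd hDC hLUF2 hSc a
  rcases h2 with h2 | h2
  · exact ⟨e2, he2, Or.inr h2⟩
  exfalso
  -- now `S` is dense and codense in `(a, e)`
  set e := min e1 e2 with he
  have hae : a < e := lt_min he1 he2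
  have hcod : ∀ p q, a ≤ p → p < q → q ≤ e → ∃ z, p < z ∧ z < q ∧ z ∉ S :=
    fun p q h3 h4 h5 => h1 p q h3 h4 (h5.trans (min_le_left _ _))
  have hden : ∀ p q, a ≤ p → p < q → q ≤ e → ∃ z, p < z ∧ z < q ∧ z ∈ S := by
    intro p q h3 h4 h5
    obtain ⟨z, hz1, hz2, hz3⟩ := h2 p q h3 h4 (h5.trans (min_le_right _ _))
    exact ⟨z, hz1, hz2, not_not.1 hz3⟩
  have step1 : ∀ r s, 0 < r → 0 < s → ∀ a', a < a' → a' < e →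
      ∃ e', a' < e' ∧ ∀ z, a' < z → z < e' → z ∉ Y r s := by
    intro r s hr0 hs0 a' ha1 ha2
    have hYc : DSet L (Y r s)ᶜ := by
      apply DSet.mk
      exact Dfn.not (hY (Tm.const _) (Tm.const _) (Tm.var _))
    obtain ⟨e', he', h3⟩ := lemmaB hlt hadd hDC hLUF2 hYc a'
    rcases h3 with h3 | h3
    · exact ⟨e', he', h3⟩
    exfalso
    obtain ⟨z, hz1, hz2, hz3⟩ := hcod a' (min e' e) ha1.le (lt_min he' ha2) (min_le_right _ _)
    have hzY : z ∉ Y r s := fun hz => hz3 ⟨r, hr0, s, hs0, hz⟩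
    obtain ⟨p, q, hp, hq, hpq⟩ := hcl r s hr0 hs0 z hzY
    obtain ⟨u, hu1, hu2, hu3⟩ := h3 (max p a') (min q e') (le_max_right _ _)
      (by
        have hze : z < e' := hz2.trans_le (min_le_left _ _)
        exact (max_lt hp hz1).trans (lt_min hq hze)) (min_le_right _ _)
    exact hu3 (hpq u ((le_max_left _ _).trans_lt hu1) (hu2.trans_le (min_le_left _ _)))
  have step2 : ∀ r, 0 < r → ∀ a', a < a' → a' < e →
      ∃ p q, p < a' ∧ a' < q ∧ ({y | ∃ s, 0 < s ∧ y ∈ Y r s} ∩ Set.Icc p q).Finite := by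
    intro r hr0 a' ha1 ha2
    have hF : DFam1 L (fun (x : Fin 1 → R) (δ : R) =>
        {y | y ∈ Y r (x 0) ∧ ∀ z, y < z → z < y + δ → z ∉ Y r (x 0)}) := by
      apply DFam1.mk
      simp only [Set.mem_ofPred_eq]
      repeat' first
        | exact Tm.var _ | exact Tm.const _ | apply Tm.add hadd | apply Dfn.lt hlt
        | refine hY ?_ ?_ ?_ | apply Dfn.not | apply Dfn.and | apply Dfn.all | apply Dfn.imp
    obtain ⟨N, -, p, q, hp, hq, B, ⟨k, l, rfl⟩, hB, h⟩ := lemmaA2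
      (Z := fun (x : Fin 1 → R) (δ : R) =>
        {y | y ∈ Y r (x 0) ∧ ∀ z, y < z → z < y + δ → z ∉ Y r (x 0)}) hlt hDC hLUF2 hF
      ⟨by
        rintro x d hd y ⟨-, hy⟩ y' ⟨hy', -⟩ hyy
        by_contra hcon
        exact hy y' hyy (not_le.1 hcon) hy',
       by
        rintro x d d' hd hdd y ⟨h1, h2⟩
        exact ⟨h1, fun z hz hz' => h2 z hz (hz'.trans_le (by gcongr))⟩⟩ a' (fun _ => 0)
    obtain ⟨p', hp1, hp2⟩ := exists_between (max_lt hp ha1)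
    obtain ⟨q', hq1, hq2⟩ := exists_between (lt_min hq ha2)
    refine ⟨p', q', hp2, hq1, Set.finite_of_encard_le_coe (k := N) ?_⟩
    refine directed_encard (hs r · · hr0) (exists_between (hB 0).2) fun s hs0 hsl => ?_
    refine le_trans (Set.encard_le_encard ?_) (h (fun _ => s) ?_)
    · rintro y ⟨hy, hy1, hy2⟩
      refine ⟨?_, ((le_max_left _ _).trans hp1.le).trans hy1,
        hy2.trans (hq2.le.trans (min_le_left _ _))⟩
      obtain ⟨e', he', hno⟩ := step1 r s hr0 hs0 y
        (((le_max_right _ _).trans_lt hp1).trans_le hy1)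
        (hy2.trans_lt (hq2.trans_le (min_le_right _ _)))
      refine ⟨e' - y, sub_pos.2 he', hy, fun z hz hz' => hno z hz ?_⟩
      rwa [add_sub_cancel] at hz'
    · intro i
      fin_cases i
      exact ⟨(hB 0).1.trans hs0, hsl⟩
  obtain ⟨c, hc1, hc2⟩ := exists_between hae
  obtain ⟨d, hd1, hd2⟩ := exists_between hc2
  have step3 : ∀ r, 0 < r → ∃ δ, 0 < δ ∧ Sep δ ({y | ∃ s, 0 < s ∧ y ∈ Y r s} ∩ Set.Icc c d) := by
    intro r hr0
    refine sep_compact hlt hadd hDC ?_ hd1.le fun a' ha1 ha2 =>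
      step2 r hr0 a' (hc1.trans_le ha1) (ha2.trans_lt hd2)
    apply DSet.mk
    simp only [Set.mem_ofPred_eq]
    repeat' first
      | exact Tm.var _ | exact Tm.const _ | apply Dfn.lt hlt | refine hY ?_ ?_ ?_
      | apply Dfn.and | apply Dfn.ex
  obtain ⟨o, ho1, ho2⟩ := exists_between hd1
  obtain ⟨p, q, hp, hq, hfin⟩ := lemmaA0 hlt hDC hLUF2
    (Z := fun δ => {y | c ≤ y ∧ y ≤ d ∧ ∃ r, 0 < r ∧ (∃ s, 0 < s ∧ y ∈ Y r s) ∧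
      Sep δ ({y | ∃ s, 0 < s ∧ y ∈ Y r s} ∩ Set.Icc c d)})
    (by
      simp only [Set.mem_ofPred_eq, Sep, Set.mem_inter_iff, Set.mem_Icc]
      repeat' first
        | exact Tm.var _ | exact Tm.const _ | apply Tm.add hadd | apply Dfn.lt hlt
        | apply Dfn.le hlt | refine hY ?_ ?_ ?_
        | apply Dfn.not | apply Dfn.and | apply Dfn.ex | apply Dfn.all | apply Dfn.imp)
    (by
      rintro δ hδ y ⟨hy1, hy2, r, hr0, ⟨s, hs0, hy⟩, hsep⟩ y' ⟨hy1', hy2', r', hr0', ⟨s', hs0', hy'⟩, hsep'⟩ hyy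
      rcases le_total r r' with h | h
      · exact hsep' y ⟨⟨s, hs0, hr _ _ _ hr0 hs0 h hy⟩, hy1, hy2⟩ y' ⟨⟨s', hs0', hy'⟩, hy1', hy2'⟩ hyy
      · exact hsep y ⟨⟨s, hs0, hy⟩, hy1, hy2⟩ y'
          ⟨⟨s', hs0', hr _ _ _ hr0' hs0' h hy'⟩, hy1', hy2'⟩ hyy)
    (by
      rintro δ δ' hδ hδδ y ⟨hy1, hy2, r, hr0, hy, hsep⟩
      exact ⟨hy1, hy2, r, hr0, hy, fun y hy y' hy' hyy =>
        le_trans (by gcongr) (hsep y hy y' hy' hyy)⟩) o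
  obtain ⟨e', he', hee, hno⟩ := finite_Ioo_right hfin o (min q d) (lt_min hq ho2)
  obtain ⟨z, hz1, hz2, r, hr0, s, hs0, hz⟩ := hden o e' (hc1.trans ho1).le he'
    (hee.trans ((min_le_right _ _).trans hd2.le))
  obtain ⟨δ, hδ, hsep⟩ := step3 r hr0
  refine hno z hz1 hz2 ⟨⟨δ, hδ, (ho1.trans hz1).le,
    (hz2.trans_le (hee.trans (min_le_right _ _))).le, r, hr0, ⟨s, hs0, hz⟩, hsep⟩,
    (hp.trans hz1).le, (hz2.trans_le (hee.trans (min_le_left _ _))).le⟩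

/-- Order-theoretic boundary. -/
def Bd (S : Set R) : Set R :=
  {y | ∀ p q, p < y → y < q → (∃ z, p < z ∧ z < q ∧ z ∈ S) ∧ ∃ z, p < z ∧ z < q ∧ z ∉ S}

theorem Bd_compl (S : Set R) : Bd Sᶜ = Bd S := by
  ext y
  simp only [Bd, Set.mem_ofPred_eq, Set.mem_compl_iff, not_not]
  constructor <;> exact fun h p q hp hq => (h p q hp hq).symm

theorem conn_aux (hlt : IsDefinable L {v : Fin 2 → R | v 0 < v 1})
    (hDC : DCProp L R) {S : Set R} (hS : DSet L S) {c d : R}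
    (hno : ∀ y, c < y → y < d → y ∉ Bd S) {u v : R} (hcu : c < u) (huv : u < v) (hvd : v < d)
    (hu : u ∈ S) (hv : v ∉ S) : False := by
  have hA : DSet L {y | y ≤ v ∧ y ∈ S} := by
    apply DSet.mk
    exact Dfn.and (Dfn.le hlt (Tm.var _) (Tm.const _)) (hS (Tm.var _))
  obtain ⟨w, hw⟩ := exists_lub hDC hA ⟨u, huv.le, hu⟩ ⟨v, fun y hy => hy.1⟩
  have huw : u ≤ w := hw.1 ⟨huv.le, hu⟩
  have hwv : w ≤ v := hw.2 fun y hy => hy.1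
  refine hno w (hcu.trans_le huw) (hwv.trans_lt hvd) fun p q hp hq => ⟨?_, ?_⟩
  · obtain ⟨y, hy, h1, h2⟩ := hw.exists_between hp
    exact ⟨y, h1, h2.trans_lt hq, hy.2⟩
  · rcases hwv.lt_or_eq with h | h
    · obtain ⟨z, hz1, hz2⟩ := exists_between (lt_min hq h)
      refine ⟨z, hp.trans hz1, hz2.trans_le (min_le_left _ _), fun hz => ?_⟩
      exact absurd (hw.1 ⟨(hz2.trans_le (min_le_right _ _)).le, hz⟩) (not_le.2 hz1)
    · exact ⟨w, hp, hq, h ▸ hv⟩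

theorem conn (hlt : IsDefinable L {v : Fin 2 → R | v 0 < v 1})
    (hDC : DCProp L R) {S : Set R} (hS : DSet L S) {c d : R}
    (hno : ∀ y, c < y → y < d → y ∉ Bd S) :
    S ∩ Set.Ioo c d = ∅ ∨ S ∩ Set.Ioo c d = Set.Ioo c d := by
  by_contra hcon
  push Not at hcon
  obtain ⟨⟨u, hu, hu1, hu2⟩, h2⟩ := hcon
  have : ∃ v, c < v ∧ v < d ∧ v ∉ S := by
    by_contra h
    push Not at h
    exact h2 (Set.inter_eq_right.2 fun v hv => h v hv.1 hv.2)
  obtain ⟨v, hv1, hv2, hv⟩ := this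
  rcases lt_trichotomy u v with h | h | h
  · exact conn_aux hlt hDC hS hno hu1 h hv2 hu hv
  · exact hv (h ▸ hu)
  · have hSc : DSet L Sᶜ := by
      apply DSet.mk
      exact Dfn.not (hS (Tm.var _))
    exact conn_aux hlt hDC hSc (by rwa [Bd_compl]) hv1 h hu2 hv (not_not.2 hu)

theorem pieces (hlt : IsDefinable L {v : Fin 2 → R | v 0 < v 1})
    (hDC : DCProp L R) {S : Set R} (hS : DSet L S) (N : ℕ) : ∀ (c d : R),
    (Bd S ∩ Set.Ioo c d).encard ≤ N →
    UnionAtMostPtsOpenIntervals N (N + 1) (S ∩ Set.Ioo c d) := by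
  classical
  induction N using Nat.strong_induction_on with
  | _ N ih =>
  intro c d h
  by_cases hne : (Bd S ∩ Set.Ioo c d).Nonempty
  · obtain ⟨o, ho, ho1, ho2⟩ := hne
    have hfin : (Bd S ∩ Set.Ioo c d).Finite := Set.finite_of_encard_le_coe h
    have hf1 : (Bd S ∩ Set.Ioo c o).Finite := hfin.subset fun y hy => ⟨hy.1, hy.2.1, hy.2.2.trans ho2⟩
    have hf2 : (Bd S ∩ Set.Ioo o d).Finite := hfin.subset fun y hy => ⟨hy.1, ho1.trans hy.2.1, hy.2.2⟩
    have hsum : (Bd S ∩ Set.Ioo c o).ncard + (Bd S ∩ Set.Ioo o d).ncard + 1 ≤ N := by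
      have hd1 : Disjoint (Bd S ∩ Set.Ioo c o) (Bd S ∩ Set.Ioo o d) := by
        rw [Set.disjoint_left]
        exact fun y hy hy' => absurd hy.2.2 (not_lt.2 hy'.2.1.le)
      have hno : o ∉ (Bd S ∩ Set.Ioo c o) ∪ (Bd S ∩ Set.Ioo o d) := by
        rintro (h | h)
        · exact lt_irrefl _ h.2.2
        · exact lt_irrefl _ h.2.1
      rw [← Set.ncard_union_eq hd1 hf1 hf2, ← Set.ncard_insert_of_notMem hno (hf1.union hf2)]
      have hle : (Bd S ∩ Set.Ioo c d).ncard ≤ N := by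
        rw [← hfin.cast_ncard_eq] at h
        exact_mod_cast h
      refine le_trans (Set.ncard_le_ncard ?_ hfin) hle
      rintro y (rfl | hy | hy)
      · exact ⟨ho, ho1, ho2⟩
      · exact ⟨hy.1, hy.2.1, hy.2.2.trans ho2⟩
      · exact ⟨hy.1, ho1.trans hy.2.1, hy.2.2⟩
    obtain ⟨P1, Q1, hP1, hQ1, h1⟩ := ih _ (by omega) c o (hf1.cast_ncard_eq.symm.le)
    obtain ⟨P2, Q2, hP2, hQ2, h2⟩ := ih _ (by omega) o d (hf2.cast_ncard_eq.symm.le)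
    obtain ⟨I, hI1, hI2⟩ : ∃ I : Finset R, I.card ≤ 1 ∧ ∀ y, y ∈ I ↔ (y = o ∧ o ∈ S) := by
      by_cases hoS : o ∈ S
      · exact ⟨{o}, by simp, by simp [hoS]⟩
      · exact ⟨∅, by simp, by simp [hoS]⟩
    refine ⟨P1 ∪ P2 ∪ I, Q1 ∪ Q2, ?_, ?_, ?_⟩
    · have h4 := Finset.card_union_le (P1 ∪ P2) I
      have h5 := Finset.card_union_le P1 P2
      omega
    · have h5 := Finset.card_union_le Q1 Q2
      omega
    · have h6 : S ∩ Set.Ioo c d = (S ∩ Set.Ioo c o) ∪ (S ∩ Set.Ioo o d) ∪ (I : Set R) := by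
        ext y
        constructor
        · rintro ⟨hy, hy1, hy2⟩
          rcases lt_trichotomy y o with h | h | h
          · exact Or.inl (Or.inl ⟨hy, hy1, h⟩)
          · subst h
            exact Or.inr ((hI2 _).2 ⟨rfl, hy⟩)
          · exact Or.inl (Or.inr ⟨hy, h, hy2⟩)
        · rintro ((hy | hy) | hy)
          · exact ⟨hy.1, hy.2.1, hy.2.2.trans ho2⟩
          · exact ⟨hy.1, ho1.trans hy.2.1, hy.2.2⟩
          · obtain ⟨rfl, hoS⟩ := (hI2 _).1 hy
            exact ⟨hoS, ho1, ho2⟩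
      rw [h6, h1, h2]
      ext y
      simp only [Set.mem_union, Finset.mem_coe, Finset.mem_union, Set.mem_iUnion, or_and_right,
        exists_or, exists_prop]
      generalize (∃ i ∈ Q1, y ∈ Set.Ioo i.1 i.2) = A1
      generalize (∃ i ∈ Q2, y ∈ Set.Ioo i.1 i.2) = A2
      clear * -
      tauto
  · rcases conn hlt hDC hS (c := c) (d := d) fun y h1 h2 h3 => hne ⟨y, h3, h1, h2⟩ with h | h
    · exact ⟨∅, ∅, by simp, by simp, by simp [h]⟩
    · exact ⟨∅, {(c, d)}, by simp, by simp, by simp [h]⟩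

theorem Bd_isolated {S : Set R} {a : R}
    (h : ∃ e, a < e ∧ ((∀ z, a < z → z < e → z ∈ S) ∨ (∀ z, a < z → z < e → z ∉ S))) :
    ∃ e, a < e ∧ ∀ z, a < z → z < e → z ∉ Bd S := by
  obtain ⟨e, he, h⟩ := h
  refine ⟨e, he, fun z hz1 hz2 hz => ?_⟩
  obtain ⟨⟨u, hu1, hu2, hu⟩, ⟨v, hv1, hv2, hv⟩⟩ := hz a e hz1 hz2
  rcases h with h | h
  · exact hv (h v hv1 hv2)
  · exact h u hu1 hu2 hu

/-- The boundary points isolated from the right at scale `δ`. -/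
def ZB {m : ℕ} (X : Set (Fin (m + 1) → R)) (x : Fin m → R) (δ : R) : Set R :=
  {y | y ∈ Bd (fiber1 X x) ∧ ∀ z, y < z → z < y + δ → z ∉ Bd (fiber1 X x)}

theorem ZB_sep {m : ℕ} (X : Set (Fin (m + 1) → R)) : SepFam (ZB X) := by
  refine ⟨?_, ?_⟩
  · rintro x d hd y ⟨-, hy⟩ y' ⟨hy', -⟩ hyy
    by_contra hcon
    exact hy y' hyy (not_le.1 hcon) hy'
  · rintro x d d' hd hdd y ⟨h1, h2⟩
    exact ⟨h1, fun z hz hz' => h2 z hz (hz'.trans_le (by gcongr))⟩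

theorem fiber_mem {m : ℕ} {X : Set (Fin (m + 1) → R)} {F : Set (Fin (2 + (m + 1)) → R)}
    (hX : X = ⋃ (r : R) (_ : 0 < r) (s : R) (_ : 0 < s), famFiber F r s) (x : Fin m → R) :
    fiber1 X x = {y | ∃ r, 0 < r ∧ ∃ s, 0 < s ∧
      (Fin.append ![r, s] (Fin.snoc x y : Fin (m + 1) → R)) ∈ F} := by
  ext y
  simp only [fiber1, hX, famFiber, Set.mem_ofPred_eq, Set.mem_iUnion, exists_prop]

theorem fiber_dfam (hlt : IsDefinable L {v : Fin 2 → R | v 0 < v 1})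
    {m : ℕ} {X : Set (Fin (m + 1) → R)} (hX : IsDSigma L X) : DFam L (fiber1 X) := by
  obtain ⟨F, ⟨hF, -⟩, hX⟩ := hX
  apply DFam.mk
  simp only [fiber_mem hX, Set.mem_ofPred_eq]
  apply Dfn.ex
  apply Dfn.and (Dfn.lt hlt (Tm.const _) (Tm.var _))
  apply Dfn.ex
  apply Dfn.and (Dfn.lt hlt (Tm.const _) (Tm.var _))
  exact Dfn.mem hF (Tm.append2 (Tm.var _) (Tm.var _) (Tm.snoc (fun i => Tm.var _) (Tm.var _)))

theorem ZB_dfam (hlt : IsDefinable L {v : Fin 2 → R | v 0 < v 1})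
    (hadd : IsDefinable L {v : Fin 3 → R | v 0 + v 1 = v 2})
    {m : ℕ} {X : Set (Fin (m + 1) → R)} (hX : DFam L (fiber1 X)) : DFam1 L (ZB X) := by
  apply DFam1.mk
  simp only [ZB, Bd, Set.mem_ofPred_eq]
  repeat' first
    | exact Tm.var _ | exact Tm.const _ | apply Tm.add hadd | apply Dfn.lt hlt
    | refine hX (fun i => Tm.var _) ?_
    | apply Dfn.not | apply Dfn.and | apply Dfn.ex | apply Dfn.all | apply Dfn.imp

theorem fiber_germ (hlt : IsDefinable L {v : Fin 2 → R | v 0 < v 1})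
    (hadd : IsDefinable L {v : Fin 3 → R | v 0 + v 1 = v 2})
    (hDC : DCProp L R) (hLUF2 : LUF2 L R)
    {m : ℕ} {X : Set (Fin (m + 1) → R)} (hX : IsDSigma L X) (x : Fin m → R) (a : R) :
    ∃ e, a < e ∧ ((∀ z, a < z → z < e → z ∈ fiber1 X x) ∨
      (∀ z, a < z → z < e → z ∉ fiber1 X x)) := by
  obtain ⟨F, ⟨hF, hc, hr, hs⟩, hX⟩ := hX
  rw [fiber_mem hX]
  refine germ (Y := fun r s => {y | (Fin.append ![r, s] (Fin.snoc x y : Fin (m + 1) → R)) ∈ F})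
    hlt hadd hDC hLUF2 ?_ ?_ ?_ ?_ a
  · intro α f g h hf hg hh
    exact Dfn.mem hF (Tm.append2 hf hg (Tm.snoc (fun i => Tm.const _) hh))
  · intro r s hr0 hs0 y hy
    have hcl := (hc r s hr0 hs0).2.1
    have hcont : Continuous (fun y : R => (Fin.snoc x y : Fin (m + 1) → R)) := by
      refine continuous_pi fun i => ?_
      refine Fin.lastCases ?_ (fun j => ?_) i
      · simpa using continuous_id'
      · simpa using continuous_const
    have ho := (hcl.preimage hcont).isOpen_compl
    obtain ⟨p, q, ⟨hp, hq⟩, hpq⟩ := mem_nhds_iff_exists_Ioo_subset.1 (ho.mem_nhds hy)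
    exact ⟨p, q, hp, hq, fun z h1 h2 => hpq ⟨h1, h2⟩⟩
  · intro r r' s h1 h2 h3 y hy
    exact hr r r' s h1 h2 h3 hy
  · intro r s s' h1 h2 h3 y hy
    exact hs r s s' h1 h2 h3 hy

theorem ZB_union (hlt : IsDefinable L {v : Fin 2 → R | v 0 < v 1})
    (hadd : IsDefinable L {v : Fin 3 → R | v 0 + v 1 = v 2})
    (hDC : DCProp L R) (hLUF2 : LUF2 L R)
    {m : ℕ} {X : Set (Fin (m + 1) → R)} (hX : IsDSigma L X) (x : Fin m → R) :
    {y | ∃ d, 0 < d ∧ y ∈ ZB X x d} = Bd (fiber1 X x) := by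
  ext y
  constructor
  · rintro ⟨d, -, hy⟩
    exact hy.1
  · intro hy
    obtain ⟨e, he, h⟩ := Bd_isolated (fiber_germ hlt hadd hDC hLUF2 hX x y)
    refine ⟨e - y, sub_pos.2 he, hy, fun z h1 h2 => h z h1 ?_⟩
    rwa [add_sub_cancel] at h2

theorem finish (hlt : IsDefinable L {v : Fin 2 → R | v 0 < v 1})
    (hadd : IsDefinable L {v : Fin 3 → R | v 0 + v 1 = v 2})
    (hDC : DCProp L R) (hLUF2 : LUF2 L R)
    {m : ℕ} {X : Set (Fin (m + 1) → R)} (hX : IsDSigma L X) (x : Fin m → R) (c d : R) (N : ℕ)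
    (h : ({y | ∃ d, 0 < d ∧ y ∈ ZB X x d} ∩ Set.Icc c d).encard ≤ N) :
    UnionAtMostPtsOpenIntervals N (N + 1) (fiber1 X x ∩ Set.Ioo c d) := by
  rw [ZB_union hlt hadd hDC hLUF2 hX] at h
  refine pieces hlt hDC (DFam.dset (fiber_dfam hlt hX) x) N c d
    ((Set.encard_le_encard ?_).trans h)
  exact Set.inter_subset_inter_right _ Set.Ioo_subset_Icc_self

end Main

end DS


/-- (Uniform bound on fibers of a `D_Σ`-set, with the `LUF₁` and
`SLUF` refinements.) Let `𝓡` be a definably complete expansion of a densely linearly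
ordered abelian group satisfying `LUF₂` and let `X ⊆ R^{m+1}` be a `D_Σ`-set. For every
`a ∈ R` and `b ∈ R^m` there are positive integers `N₁, N₂`, an open interval `I ∋ a`
and an open box `B ∋ b` such that `X_x ∩ I` is a union of at most `N₁` points and `N₂`
open intervals for every `x ∈ B`. Moreover `B` can be taken to be `R^m` if `𝓡 ⊨ LUF₁`,
and `I` can be taken independently of `X` if `𝓡 ⊨ SLUF`. -/
theorem dSigma_fibers_uniformly_few_pieces
    {R : Type*} (L : FirstOrder.Language) [L.Structure R]
    [LinearOrder R] [DenselyOrdered R] [AddCommGroup R]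
    [CovariantClass R R (· + ·) (· < ·)] [TopologicalSpace R] [OrderTopology R]
    (hlt : IsDefinable L {v : Fin 2 → R | v 0 < v 1})
    (hadd : IsDefinable L {v : Fin 3 → R | v 0 + v 1 = v 2})
    (hDC : DCProp L R) (hLUF2 : LUF2 L R) :
    (∀ (m : ℕ) (X : Set (Fin (m + 1) → R)), IsDSigma L X →
      ∀ (a : R) (b : Fin m → R),
        ∃ N₁ N₂ : ℕ, 0 < N₁ ∧ 0 < N₂ ∧ ∃ c d : R, c < a ∧ a < d ∧
          ∃ B : Set (Fin m → R), OpenBox B ∧ b ∈ B ∧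
            ∀ x ∈ B, UnionAtMostPtsOpenIntervals N₁ N₂ (fiber1 X x ∩ Set.Ioo c d)) ∧
    (LUF1 L R → ∀ (m : ℕ) (X : Set (Fin (m + 1) → R)), IsDSigma L X → ∀ a : R,
      ∃ N₁ N₂ : ℕ, 0 < N₁ ∧ 0 < N₂ ∧ ∃ c d : R, c < a ∧ a < d ∧
        ∀ x : Fin m → R, UnionAtMostPtsOpenIntervals N₁ N₂ (fiber1 X x ∩ Set.Ioo c d)) ∧
    (SLUF L R → ∀ a : R, ∃ c d : R, c < a ∧ a < d ∧
      ∀ (m : ℕ) (X : Set (Fin (m + 1) → R)), IsDSigma L X →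
        ∃ N₁ N₂ : ℕ, 0 < N₁ ∧ 0 < N₂ ∧
          ∀ x : Fin m → R, UnionAtMostPtsOpenIntervals N₁ N₂ (fiber1 X x ∩ Set.Ioo c d)) := by
  have : IsOrderedAddMonoid R := by
    refine { add_le_add_left := fun a b h c => ?_ }
    rcases h.lt_or_eq with h | rfl
    · rw [add_comm a, add_comm b]
      exact (CovariantClass.elim (μ := (· + ·)) (r := (· < ·)) c h : c + a < c + b).le
    · exact le_rfl
  have : Nontrivial R := by
    obtain ⟨N, -, p, q, -, U, ⟨k, l, rfl⟩, hb, -⟩ :=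
      hLUF2 1 ∅ (Set.definable_empty (L := L)) 0 (fun _ => 0)
    exact ⟨k 0, 0, (hb 0).1.ne⟩
  refine ⟨?_, ?_, ?_⟩
  · intro m X hX a b
    obtain ⟨N, hN, c, d, hc, hd, B, hB, hb, h⟩ := DS.lemmaA2 (Z := DS.ZB X) hlt hDC hLUF2
      (DS.ZB_dfam hlt hadd (DS.fiber_dfam hlt hX)) (DS.ZB_sep X) a b
    exact ⟨N, N + 1, hN, N.succ_pos, c, d, hc, hd, B, hB, hb, fun x hx =>
      DS.finish hlt hadd hDC hLUF2 hX x c d N (h x hx)⟩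
  · intro hL m X hX a
    have hZ : DS.DFam1 L (DS.ZB X) := DS.ZB_dfam hlt hadd (DS.fiber_dfam hlt hX)
    obtain ⟨N, hN, p, q, hpq, h⟩ := hL (m + 2) (DS.lufset (DS.ZB X)) (DS.lufset_def hlt hZ) a
    have hpq' := hpq
    rw [interior_Icc] at hpq'
    exact ⟨N, N + 1, hN, N.succ_pos, p, q, hpq'.1, hpq'.2, fun x =>
      DS.finish hlt hadd hDC hLUF2 hX x p q N
        (DS.lemmaA_core hlt hDC hZ (DS.ZB_sep X) a p q hpq N h x)⟩
  · intro hL a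
    obtain ⟨p, q, hpq, hL⟩ := hL a
    have hpq' := hpq
    rw [interior_Icc] at hpq'
    refine ⟨p, q, hpq'.1, hpq'.2, fun m X hX => ?_⟩
    have hZ : DS.DFam1 L (DS.ZB X) := DS.ZB_dfam hlt hadd (DS.fiber_dfam hlt hX)
    obtain ⟨N, hN, h⟩ := hL (m + 2) (DS.lufset (DS.ZB X)) (DS.lufset_def hlt hZ)
    exact ⟨N, N + 1, hN, N.succ_pos, fun x =>
      DS.finish hlt hadd hDC hLUF2 hX x p q N
        (DS.lemmaA_core hlt hDC hZ (DS.ZB_sep X) a p q hpq N h x)⟩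
end

section
/- Let 𝓡 = (R, <, +, 0, …) be an expansion of a densely linearly ordered abelian group with 𝓡 ⊨ DC and 𝓡 ⊨ LUF₂. Every D_Σ-subset of R^n of dimension zero is discrete and closed; in particular, it is constructible. -/
open FirstOrder Set Topology

namespace DSig

section Toolkit

variable {R : Type*} (L : FirstOrder.Language) [L.Structure R] {α β : Type}

/-- Definable predicate on tuples. -/
def DP (P : (α → R) → Prop) : Prop := Set.Definable (Set.univ : Set R) L {v | P v}

/-- Definable function on tuples. -/
def DF (f : (α → R) → R) : Prop := Set.DefinableFun L (Set.univ : Set R) f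

variable {L}

theorem DF.var (a : α) : DF L (fun v : α → R => v a) := Set.DefinableFun.proj L

theorem DF.const (c : R) : DF L (fun _ : α → R => c) :=
  L.definableFun_const α (Set.mem_univ c)

theorem DP.and {P Q : (α → R) → Prop} (hP : DP L P) (hQ : DP L Q) :
    DP L (fun v => P v ∧ Q v) := Set.Definable.inter hP hQ

theorem DP.or {P Q : (α → R) → Prop} (hP : DP L P) (hQ : DP L Q) :
    DP L (fun v => P v ∨ Q v) := Set.Definable.union hP hQ

theorem DP.not {P : (α → R) → Prop} (hP : DP L P) :
    DP L (fun v => ¬ P v) := Set.Definable.compl hP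

theorem DP.congr {P Q : (α → R) → Prop} (hP : DP L P) (h : ∀ v, P v ↔ Q v) : DP L Q := by
  have : P = Q := funext fun v => propext (h v)
  exact this ▸ hP

theorem DP.imp {P Q : (α → R) → Prop} (hP : DP L P) (hQ : DP L Q) :
    DP L (fun v => P v → Q v) :=
  (hP.not.or hQ).congr fun v => by tauto

theorem DP.exN [Finite β] {P : (α → R) → (β → R) → Prop}
    (h : DP L (fun w : α ⊕ β → R => P (fun a => w (Sum.inl a)) (fun b => w (Sum.inr b)))) :
    DP L (fun v : α → R => ∃ y : β → R, P v y) :=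
  Set.Definable.exists_of_finite h

theorem DP.allN [Finite β] {P : (α → R) → (β → R) → Prop}
    (h : DP L (fun w : α ⊕ β → R => P (fun a => w (Sum.inl a)) (fun b => w (Sum.inr b)))) :
    DP L (fun v : α → R => ∀ y : β → R, P v y) :=
  Set.Definable.forall_of_finite h

theorem DP.ex {P : (α → R) → R → Prop}
    (h : DP L (fun w : α ⊕ Unit → R => P (fun a => w (Sum.inl a)) (w (Sum.inr ())))) :
    DP L (fun v : α → R => ∃ y : R, P v y) :=
  (DP.exN (P := fun v (y : Unit → R) => P v (y ())) h).congr fun _ =>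
    ⟨fun ⟨y, hy⟩ => ⟨y (), hy⟩, fun ⟨y, hy⟩ => ⟨fun _ => y, hy⟩⟩

theorem DP.all {P : (α → R) → R → Prop}
    (h : DP L (fun w : α ⊕ Unit → R => P (fun a => w (Sum.inl a)) (w (Sum.inr ())))) :
    DP L (fun v : α → R => ∀ y : R, P v y) :=
  (DP.allN (P := fun v (y : Unit → R) => P v (y ())) h).congr fun _ =>
    ⟨fun hy y => hy (fun _ => y), fun hy y => hy (y ())⟩

theorem DP.fall {ι : Type} [Finite ι] {P : ι → (α → R) → Prop} (h : ∀ i, DP L (P i)) :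
    DP L (fun v => ∀ i, P i v) := by
  have := Set.definable_iInter_of_finite h
  unfold DP
  convert! this using 1
  ext v
  simp

theorem DP.prop (p : Prop) : DP L (fun _ : α → R => p) := by
  unfold DP
  by_cases h : p
  · convert! (Set.definable_univ : Set.Definable (Set.univ : Set R) L (Set.univ : Set (α → R)))
    simp [h]
  · convert! (Set.definable_empty : Set.Definable (Set.univ : Set R) L (∅ : Set (α → R)))
    simp [h]

theorem DP.subst [Finite β] {P : (β → R) → Prop} (h : DP L P) (f : β → (α → R) → R)
    (hf : ∀ b, DF L (f b)) : DP L (fun v => P (fun b => f b v)) :=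
  Set.Definable.preimage_map (F := fun v b => f b v) hf h

theorem DP.eq {f g : (α → R) → R} (hf : DF L f) (hg : DF L g) :
    DP L (fun v => f v = g v) := Set.DefinableFun.ofPred_eq hf hg

theorem DP.app1 {P : R → Prop} (h : DP L (fun v : Fin 1 → R => P (v 0)))
    {f : (α → R) → R} (hf : DF L f) : DP L (fun v => P (f v)) :=
  h.subst (fun _ => f) (fun _ => hf)

theorem DP.app2 {P : R → R → Prop} (h : DP L (fun v : Fin 2 → R => P (v 0) (v 1)))
    {f g : (α → R) → R} (hf : DF L f) (hg : DF L g) : DP L (fun v => P (f v) (g v)) :=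
  h.subst ![f, g] (fun b => by fin_cases b <;> assumption)

theorem DP.app3 {P : R → R → R → Prop} (h : DP L (fun v : Fin 3 → R => P (v 0) (v 1) (v 2)))
    {f g k : (α → R) → R} (hf : DF L f) (hg : DF L g) (hk : DF L k) :
    DP L (fun v => P (f v) (g v) (k v)) :=
  h.subst ![f, g, k] (fun b => by fin_cases b <;> assumption)

theorem DP.appN [Finite β] {P : R → (β → R) → Prop}
    (h : DP L (fun v : Option β → R => P (v none) (fun b => v (some b))))
    {f : (α → R) → R} {g : β → (α → R) → R} (hf : DF L f) (hg : ∀ b, DF L (g b)) :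
    DP L (fun v => P (f v) (fun b => g b v)) :=
  h.subst (fun o => o.elim f g) (fun b => by cases b <;> simp [*])

/-- the ambient hypothesis: order and addition are definable, and `DC` holds. -/
structure Amb (L : FirstOrder.Language) (R : Type*) [L.Structure R] [LinearOrder R]
    [AddCommGroup R] : Prop where
  hlt : IsDefinable L {v : Fin 2 → R | v 0 < v 1}
  hadd : IsDefinable L {v : Fin 3 → R | v 0 + v 1 = v 2}
  hDC : DCProp L R

variable [LinearOrder R] [AddCommGroup R]

theorem Amb.lt (H : Amb L R) {f g : (α → R) → R} (hf : DF L f) (hg : DF L g) :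
    DP L (fun v => f v < g v) := DP.app2 (P := fun x y => x < y) H.hlt hf hg

theorem Amb.le (H : Amb L R) {f g : (α → R) → R} (hf : DF L f) (hg : DF L g) :
    DP L (fun v => f v ≤ g v) := (H.lt hg hf).not.congr fun _ => not_lt

theorem Amb.add (H : Amb L R) {f g : (α → R) → R} (hf : DF L f) (hg : DF L g) :
    DF L (fun v => f v + g v) := by
  have h2 : Set.DefinableFun L (Set.univ : Set R) (fun v : Fin 2 → R => v 0 + v 1) := by
    have := DP.app3 (P := fun x y z => x + y = z) H.hadd
      (DF.var (some 0 : Option (Fin 2))) (DF.var (some 1)) (DF.var none)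
    simpa [Set.DefinableFun, Function.tupleGraph] using! this
  exact Set.DefinableFun.comp (g := fun v => ![f v, g v])
    (by intro i; fin_cases i <;> assumption) h2

end Toolkit

section Order

variable {R : Type*} {L : FirstOrder.Language} [L.Structure R]
  [LinearOrder R] [AddCommGroup R] [IsOrderedAddMonoid R]

theorem Amb.sup (H : Amb L R) {S : Set R} (hS : DP L (fun v : Fin 1 → R => v 0 ∈ S))
    (hne : S.Nonempty) (hb : BddAbove S) : ∃ a, IsLUB S a := H.hDC S hS hne hb

theorem cluster_coord (H : Amb L R) [Nontrivial R] {n : ℕ} (K : R → Set (Fin n → R))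
    (hK : DP L (fun v : Option (Fin n) → R => (fun b => v (some b)) ∈ K (v none)))
    (j : Fin n) (p q : R) (hb : ∀ ε, 0 < ε → ∀ x ∈ K ε, p ≤ x j ∧ x j ≤ q)
    (hmono : ∀ ε ε', 0 < ε → ε ≤ ε' → K ε ⊆ K ε') (hne : ∀ ε, 0 < ε → (K ε).Nonempty) :
    ∃ c, ∀ ε, 0 < ε → ∃ x ∈ K ε, x j ≤ c + ε ∧ c ≤ x j + ε := by
  obtain ⟨e0, he0⟩ := exists_zero_lt (α := R)
  have hS : DP L (fun v : Fin 1 → R =>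
      v 0 ∈ {t : R | ∃ ε, 0 < ε ∧ ∀ x : Fin n → R, x ∈ K ε → t ≤ x j}) :=
    DP.ex (DP.and (H.lt (.const 0) (.var _)) (DP.allN (DP.imp
      (DP.appN (P := fun e x => x ∈ K e) hK (.var _) (fun b => .var _))
      (H.le (.var _) (.var _)))))
  obtain ⟨c, hc⟩ := H.sup hS ⟨p, e0, he0, fun x hx => (hb _ he0 x hx).1⟩ ⟨q, by
    rintro t ⟨ε, hε, ht⟩
    obtain ⟨x, hx⟩ := hne ε hε
    exact (ht x hx).trans (hb ε hε x hx).2⟩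
  refine ⟨c, fun ε hε => ?_⟩
  obtain ⟨t, ⟨ε1, hε1, ht⟩, hct⟩ := (lt_isLUB_iff hc).1 (sub_lt_self c hε)
  have h1 : ¬ (∀ x : Fin n → R, x ∈ K (min ε ε1) → c + ε ≤ x j) := fun h =>
    absurd (hc.1 ⟨_, lt_min hε hε1, h⟩) (not_le.2 (lt_add_of_pos_right c hε))
  push Not at h1
  obtain ⟨x, hx, hxc⟩ := h1
  refine ⟨x, hmono _ _ (lt_min hε hε1) (min_le_left _ _) hx, hxc.le, ?_⟩
  have := ht x (hmono _ _ (lt_min hε hε1) (min_le_right _ _) hx)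
  exact sub_le_iff_le_add.1 (hct.le.trans this)

theorem cluster_all (H : Amb L R) [Nontrivial R] {n : ℕ} (K : R → Set (Fin n → R))
    (hK : DP L (fun v : Option (Fin n) → R => (fun b => v (some b)) ∈ K (v none)))
    (p q : R) (hb : ∀ ε, 0 < ε → ∀ x ∈ K ε, ∀ j, p ≤ x j ∧ x j ≤ q)
    (hmono : ∀ ε ε', 0 < ε → ε ≤ ε' → K ε ⊆ K ε') (hne : ∀ ε, 0 < ε → (K ε).Nonempty)
    (T : Finset (Fin n)) :
    ∃ c : Fin n → R, ∀ ε, 0 < ε → ∃ x ∈ K ε, ∀ j ∈ T, x j ≤ c j + ε ∧ c j ≤ x j + ε := by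
  induction T using Finset.induction_on with
  | empty =>
    refine ⟨fun _ => 0, fun ε hε => ?_⟩
    obtain ⟨x, hx⟩ := hne ε hε
    exact ⟨x, hx, by simp⟩
  | insert j T hj ih =>
    obtain ⟨c, hc⟩ := ih
    obtain ⟨d, hd⟩ := cluster_coord H
      (fun ε => {x | x ∈ K ε ∧ ∀ j : Fin n, j ∈ T → x j ≤ c j + ε ∧ c j ≤ x j + ε})
      (DP.and hK (DP.fall fun j => DP.imp (DP.prop _) (DP.and
        (H.le (.var _) (H.add (.const _) (.var _))) (H.le (.const _) (H.add (.var _) (.var _))))))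
      j p q (fun ε hε x hx => hb ε hε x hx.1 j)
      (fun ε ε' hε h x hx => ⟨hmono _ _ hε h hx.1, fun j hj =>
        ⟨(hx.2 j hj).1.trans (by gcongr), (hx.2 j hj).2.trans (by gcongr)⟩⟩)
      (fun ε hε => by
        obtain ⟨x, hx, h⟩ := hc ε hε
        exact ⟨x, hx, h⟩)
    refine ⟨Function.update c j d, fun ε hε => ?_⟩
    obtain ⟨x, ⟨hx, h1⟩, h2⟩ := hd ε hε
    refine ⟨x, hx, fun i hi => ?_⟩
    by_cases hij : i = j
    · subst hij; simpa using h2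
    · simpa [hij] using h1 i ((Finset.mem_insert.1 hi).resolve_left hij)

theorem half [DenselyOrdered R] {δ : R} (hδ : 0 < δ) : ∃ ε, 0 < ε ∧ ε + ε < δ := by
  obtain ⟨e, he, hed⟩ := exists_between hδ
  obtain ⟨ε, h1, h2⟩ := exists_between (lt_min he (sub_pos.2 hed))
  refine ⟨ε, h1, ?_⟩
  have := add_lt_add (lt_of_lt_of_le h2 (min_le_left _ _)) (lt_of_lt_of_le h2 (min_le_right _ _))
  simpa using this

/-- local finiteness in the line -/
def LF (Z : Set R) : Prop := ∀ a, ∃ u v, u < a ∧ a < v ∧ (Z ∩ Set.Icc u v).Finite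

/-- separated sets -/
def Sep (x : R) (Z : Set R) : Prop := ∀ y ∈ Z, ∀ z ∈ Z, y < z → y + x ≤ z

theorem sep_min (H : Amb L R) {Z : Set R} (hZ : DP L (fun v : Fin 1 → R => v 0 ∈ Z))
    {x : R} (hx : 0 < x) (hs : Sep x Z) {u z : R} (hz : z ∈ Z) (huz : u ≤ z) :
    ∃ m ∈ Z, u ≤ m ∧ ∀ w ∈ Z, u ≤ w → m ≤ w := by
  have hS : DP L (fun v : Fin 1 → R => v 0 ∈ {t : R | ∀ w, w ∈ Z → u ≤ w → t ≤ w}) :=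
    DP.all (DP.imp (DP.app1 (P := fun x => x ∈ Z) hZ (.var _)) (DP.imp
      (H.le (.const _) (.var _)) (H.le (.var _) (.var _))))
  obtain ⟨m, hm⟩ := H.sup hS ⟨u, fun w _ h => h⟩ ⟨z, fun t ht => ht z hz huz⟩
  have hlow : ∀ w ∈ Z, u ≤ w → m ≤ w := fun w hw huw => hm.2 fun t ht => ht w hw huw
  have hum : u ≤ m := hm.1 fun w _ h => h
  refine ⟨m, ?_, hum, hlow⟩
  have key : ∀ t, m < t → ∃ w ∈ Z, u ≤ w ∧ w < t := by
    intro t ht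
    by_contra hcon
    push Not at hcon
    exact absurd (hm.1 (show t ∈ {t : R | ∀ w, w ∈ Z → u ≤ w → t ≤ w} from hcon)) (not_le.2 ht)
  obtain ⟨w, hw, huw, hwm⟩ := key (m + x) (lt_add_of_pos_right m hx)
  rcases (hlow w hw huw).eq_or_lt with h | h
  · exact h ▸ hw
  · obtain ⟨w', hw', huw', hw'm⟩ := key w h
    have h1 := hs w' hw' w hw hw'm
    have h2 := hlow w' hw' huw'
    exact absurd ((add_le_add_left h2 x).trans h1) (not_le.2 hwm)

theorem sep_initial (H : Amb L R) {Z : Set R} (hZ : DP L (fun v : Fin 1 → R => v 0 ∈ Z))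
    {x : R} (hx : 0 < x) (hs : Sep x Z) {u v : R} (k : ℕ)
    (hk : (Z ∩ Set.Icc u v).Infinite ∨ k < (Z ∩ Set.Icc u v).ncard) :
    ∃ d ∈ Z, u ≤ d ∧ d ≤ v ∧ (Z ∩ Set.Icc u d).Finite ∧ (Z ∩ Set.Icc u d).ncard = k + 1 := by
  induction k with
  | zero =>
    have : (Z ∩ Set.Icc u v).Nonempty := by
      rcases hk with h | h
      · exact h.nonempty
      · exact Set.nonempty_of_ncard_ne_zero h.ne'
    obtain ⟨z, hz, huz, hzv⟩ := this
    obtain ⟨m, hm, hum, hmin⟩ := sep_min H hZ hx hs hz huz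
    have : Z ∩ Set.Icc u m = {m} := by
      ext w
      constructor
      · rintro ⟨h1, h2, h3⟩
        exact le_antisymm h3 (hmin w h1 h2)
      · rintro rfl
        exact ⟨hm, hum, le_rfl⟩
    exact ⟨m, hm, hum, (hmin z hz huz).trans hzv, by simp [this], by simp [this]⟩
  | succ k ih =>
    obtain ⟨d, hd, hud, hdv, hfin, hcard⟩ := ih (hk.imp id (by omega))
    have : ∃ z ∈ Z, d < z ∧ z ≤ v := by
      by_contra hcon
      push Not at hcon
      have heq : Z ∩ Set.Icc u v = Z ∩ Set.Icc u d := by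
        ext w
        constructor
        · rintro ⟨h1, h2, h3⟩
          exact ⟨h1, h2, not_lt.1 fun h => absurd h3 (not_le.2 (hcon w h1 h))⟩
        · rintro ⟨h1, h2, h3⟩
          exact ⟨h1, h2, h3.trans hdv⟩
      rw [heq] at hk
      rcases hk with h | h
      · exact h hfin
      · omega
    obtain ⟨z, hz, hdz, hzv⟩ := this
    obtain ⟨m, hm, hum, hmin⟩ := sep_min H hZ hx hs hz (hs d hd z hz hdz)
    have hdm : d < m := (lt_add_of_pos_right d hx).trans_le hum
    have : Z ∩ Set.Icc u m = insert m (Z ∩ Set.Icc u d) := by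
      ext w
      constructor
      · rintro ⟨h1, h2, h3⟩
        rcases le_or_gt w d with h | h
        · exact Or.inr ⟨h1, h2, h⟩
        · exact Or.inl (le_antisymm h3 (hmin w h1 (hs d hd w h1 h)))
      · rintro (rfl | ⟨h1, h2, h3⟩)
        · exact ⟨hm, hud.trans hdm.le, le_rfl⟩
        · exact ⟨h1, h2, h3.trans hdm.le⟩
    refine ⟨m, hm, hud.trans hdm.le, (hmin z hz (hs d hd z hz hdz)).trans hzv, ?_, ?_⟩
    · rw [this]; exact hfin.insert m
    · rw [this, Set.ncard_insert_of_notMem _ hfin, hcard]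
      rintro ⟨_, _, h⟩
      exact absurd h (not_le.2 hdm)

end Order

section Topo

variable {R : Type*} {L : FirstOrder.Language} [L.Structure R]
  [LinearOrder R] [AddCommGroup R] [IsOrderedAddMonoid R]

theorem finite_sep [Nontrivial R] {T : Set R} (hT : T.Finite) : ∃ x, 0 < x ∧ Sep x T := by
  obtain ⟨e0, he0⟩ := exists_zero_lt (α := R)
  have hfin : ((fun p : R × R => p.2 - p.1) '' (T ×ˢ T)).Finite := (hT.prod hT).image _
  have : ∀ S : Set R, S.Finite → ∃ x, 0 < x ∧ ∀ s ∈ S, 0 < s → x ≤ s := by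
    intro S hS
    induction S, hS using Set.Finite.induction_on with
    | empty => exact ⟨e0, he0, by simp⟩
    | @insert a S _ _ ih =>
      obtain ⟨x, hx, h⟩ := ih
      by_cases ha : 0 < a
      · refine ⟨min x a, lt_min hx ha, ?_⟩
        rintro s (rfl | hs) h0
        · exact min_le_right _ _
        · exact (min_le_left _ _).trans (h s hs h0)
      · refine ⟨x, hx, ?_⟩
        rintro s (rfl | hs) h0
        · exact absurd h0 ha
        · exact h s hs h0
  obtain ⟨x, hx, h⟩ := this _ hfin
  refine ⟨x, hx, fun y hy z hz hyz => ?_⟩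
  have := h (z - y) ⟨(y, z), ⟨hy, hz⟩, rfl⟩ (sub_pos.2 hyz)
  exact add_comm y x ▸ le_sub_iff_add_le.1 this

theorem locfin_sep (H : Amb L R) [Nontrivial R] [DenselyOrdered R] {Y : Set R}
    (hY : DP L (fun v : Fin 1 → R => v 0 ∈ Y)) {p q : R} (hb : ∀ y ∈ Y, p ≤ y ∧ y ≤ q)
    (hlf : LF Y) : ∃ x, 0 < x ∧ Sep x Y := by
  by_contra hcon
  push Not at hcon
  have hne : ∀ ε, 0 < ε → ∃ y ∈ Y, ∃ z ∈ Y, y < z ∧ z < y + ε := by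
    intro ε hε
    have := hcon ε hε
    simp only [Sep] at this
    push Not at this
    exact this
  obtain ⟨c, hc⟩ := cluster_coord H
    (fun ε => {t : Fin 1 → R | t 0 ∈ Y ∧ ∃ z, z ∈ Y ∧ t 0 < z ∧ z < t 0 + ε})
    (DP.and (DP.app1 (P := fun x => x ∈ Y) hY (.var _)) (DP.ex (DP.and
      (DP.app1 (P := fun x => x ∈ Y) hY (.var _)) (DP.and (H.lt (.var _) (.var _))
        (H.lt (.var _) (H.add (.var _) (.var _)))))))
    0 p q (fun ε hε x hx => hb _ hx.1)
    (fun ε ε' hε h x ⟨h1, z, hz, h2, h3⟩ => ⟨h1, z, hz, h2, h3.trans_le (by gcongr)⟩)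
    (fun ε hε => by
      obtain ⟨y, hy, z, hz, h1, h2⟩ := hne ε hε
      exact ⟨fun _ => y, hy, z, hz, h1, h2⟩)
  obtain ⟨u, v, hu, hv, hfin⟩ := hlf c
  obtain ⟨x, hx, hsep⟩ := finite_sep hfin
  obtain ⟨e, he, hee⟩ := half (lt_min (sub_pos.2 hu) (sub_pos.2 hv))
  have hε : 0 < min x e := lt_min hx he
  obtain ⟨t, ⟨hy, z, hz, h1, h2⟩, h3, h4⟩ := hc _ hε
  have hex : min x e ≤ x := min_le_left _ _
  have hee' : min x e ≤ e := min_le_right _ _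
  generalize min x e = ε at *
  have a1 : e + e < c - u := hee.trans_le (min_le_left _ _)
  have a2 : e + e < v - c := hee.trans_le (min_le_right _ _)
  have b1 : u ≤ t 0 := by
    have : u + (e + e) < c := by rw [add_comm]; exact lt_sub_iff_add_lt.1 a1
    have h5 : c ≤ t 0 + (e + e) := h4.trans (by gcongr; exact hee'.trans (by simpa using he.le))
    exact (le_of_add_le_add_right (this.le.trans h5))
  have b2 : z ≤ v := by
    have : (e + e) + c < v := lt_sub_iff_add_lt.1 a2
    refine (h2.le.trans ?_).trans this.le
    calc t 0 + ε ≤ (c + ε) + ε := by gcongr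
      _ ≤ (c + e) + e := by gcongr
      _ = _ := by abel
  have := hsep (t 0) ⟨hy, b1, h1.le.trans b2⟩ z ⟨hz, b1.trans h1.le, b2⟩ h1
  exact absurd (h2.trans_le (by gcongr)) (not_lt.2 this)

variable [TopologicalSpace R] [OrderTopology R]

theorem locfin_of_sep_family (H : Amb L R) (hL : LUF2 L R) [Nontrivial R] [DenselyOrdered R]
    (Z : R → Set R) (hZ : DP L (fun v : Fin 2 → R => v 1 ∈ Z (v 0)))
    (hmono : ∀ x x', 0 < x → x ≤ x' → Z x' ⊆ Z x) (hsep : ∀ x, 0 < x → Sep x (Z x)) :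
    LF {y | ∃ x, 0 < x ∧ y ∈ Z x} := by
  intro a
  have hX : DP L (fun w : Fin 4 → R => 0 < w 0 ∧ w 3 ∈ Z (w 0) ∧ w 1 ≤ w 3 ∧ w 3 ≤ w 2) :=
    DP.and (H.lt (.const 0) (.var _)) (DP.and (DP.app2 (P := fun x y => y ∈ Z x) hZ (.var _) (.var _))
      (DP.and (H.le (.var _) (.var _)) (H.le (.var _) (.var _))))
  obtain ⟨N, hN, p, q, ha, U, ⟨cU, dU, rfl⟩, hbU, hmain⟩ := hL 3 _ hX a ![0, a, a]
  have ha' := ha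
  rw [interior_Icc] at ha'
  have h0 := hbU 0
  have h1 := hbU 1
  have h2 := hbU 2
  simp at h0 h1 h2
  obtain ⟨u, hu1, hu2⟩ := exists_between (max_lt (max_lt h1.1 h2.1) ha'.1)
  obtain ⟨v, hv1, hv2⟩ := exists_between (lt_min (lt_min h1.2 h2.2) ha'.2)
  simp only [max_lt_iff] at hu1
  simp only [lt_min_iff] at hv2
  refine ⟨u, v, hu2, hv1, ?_⟩
  by_contra hinf
  obtain ⟨S, hS, hcard⟩ := Set.Infinite.exists_subset_card_eq hinf (N + 1)
  have hcommon : ∀ S : Finset R, (∀ y ∈ S, ∃ x, 0 < x ∧ y ∈ Z x) →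
      ∃ x, 0 < x ∧ x < dU 0 ∧ ∀ y ∈ S, y ∈ Z x := by
    intro S
    induction S using Finset.induction_on with
    | empty =>
      intro _
      obtain ⟨x, hx, hx'⟩ := exists_between h0.2
      exact ⟨x, hx, hx', by simp⟩
    | insert y S _ ih =>
      intro h
      obtain ⟨x, hx, hxd, hxS⟩ := ih fun y hy => h y (Finset.mem_insert_of_mem hy)
      obtain ⟨x', hx', hy⟩ := h y (Finset.mem_insert_self _ _)
      refine ⟨min x x', lt_min hx hx', (min_le_left _ _).trans_lt hxd, fun z hz => ?_⟩
      rcases Finset.mem_insert.1 hz with rfl | hz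
      · exact hmono _ _ (lt_min hx hx') (min_le_right _ _) hy
      · exact hmono _ _ (lt_min hx hx') (min_le_left _ _) (hxS z hz)
  obtain ⟨x, hx, hxd, hxS⟩ := hcommon S fun y hy => (hS hy).1
  have hbig : (Z x ∩ Set.Icc u v).Infinite ∨ N < (Z x ∩ Set.Icc u v).ncard := by
    by_cases hf : (Z x ∩ Set.Icc u v).Infinite
    · exact Or.inl hf
    · right
      have := Set.ncard_le_ncard (s := (S : Set R)) (t := Z x ∩ Set.Icc u v)
        (fun y hy => ⟨hxS y hy, (hS hy).2⟩) (Set.not_infinite.1 hf)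
      rw [Set.ncard_coe_finset, hcard] at this
      omega
  obtain ⟨d, hd, hud, hdv, hfin, hc⟩ := sep_initial H
    (DP.app2 (P := fun x y => y ∈ Z x) hZ (.const x) (.var 0)) hx (hsep x hx) N hbig
  have hfib : fiber1 {w : Fin 4 → R | 0 < w 0 ∧ w 3 ∈ Z (w 0) ∧ w 1 ≤ w 3 ∧ w 3 ≤ w 2} ![x, u, d]
      ∩ Set.Icc p q = Z x ∩ Set.Icc u d := by
    ext y
    constructor
    · rintro ⟨⟨_, h1, h2, h3⟩, _⟩
      exact ⟨h1, h2, h3⟩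
    · rintro ⟨h1, h2, h3⟩
      exact ⟨⟨hx, h1, h2, h3⟩, hu1.2.le.trans h2, (h3.trans hdv).trans hv2.2.le⟩
  have := hmain ![x, u, d] (by
    intro i
    have hdlt := hdv.trans_lt hv2.1.1
    have hdlt2 := hdv.trans_lt hv2.1.2
    have hltd := hu1.1.1.trans_le hud
    have hltd2 := hu1.1.2.trans_le hud
    fin_cases i
    · exact ⟨h0.1.trans hx, hxd⟩
    · exact ⟨hu1.1.1, (hud.trans hdv).trans_lt hv2.1.1⟩
    · exact ⟨hltd2, hdlt2⟩) p q ha le_rfl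
  rw [hfib, hc] at this
  rcases this with h | h
  · exact h hfin
  · omega

theorem chain_locfin (H : Amb L R) (hL : LUF2 L R) [Nontrivial R] [DenselyOrdered R]
    (Z : R → Set R) (hZ : DP L (fun v : Fin 2 → R => v 1 ∈ Z (v 0)))
    (hchain : ∀ t t', 0 < t → 0 < t' → Z t ⊆ Z t' ∨ Z t' ⊆ Z t)
    (hsep : ∀ t, 0 < t → ∃ x, 0 < x ∧ Sep x (Z t)) :
    LF {y | ∃ t, 0 < t ∧ y ∈ Z t} := by
  have hZ' := fun (α : Type) (f g : (α → R) → R) (hf : DF L f) (hg : DF L g) =>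
    DP.app2 (P := fun x y => y ∈ Z x) hZ hf hg
  have := locfin_of_sep_family H hL
    (fun x => {y | ∃ t, 0 < t ∧ y ∈ Z t ∧ ∀ y, y ∈ Z t → ∀ z, z ∈ Z t → y < z → y + x ≤ z})
    (DP.ex (DP.and (H.lt (.const 0) (.var _)) (DP.and (hZ' _ _ _ (.var _) (.var _))
      (DP.all (DP.imp (hZ' _ _ _ (.var _) (.var _)) (DP.all (DP.imp (hZ' _ _ _ (.var _) (.var _))
        (DP.imp (H.lt (.var _) (.var _)) (H.le (H.add (.var _) (.var _)) (.var _))))))))))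
    (by
      rintro x x' hx hxx y ⟨t, ht, hy, hs⟩
      exact ⟨t, ht, hy, fun y hy z hz hyz => le_trans (by gcongr) (hs y hy z hz hyz)⟩)
    (by
      rintro x hx y ⟨t, ht, hy, hs⟩ z ⟨t', ht', hz, hs'⟩ hyz
      rcases hchain t t' ht ht' with h | h
      · exact hs' y (h hy) z hz hyz
      · exact hs y hy z (h hz) hyz)
  convert! this using 1
  ext y
  constructor
  · rintro ⟨t, ht, hy⟩
    obtain ⟨x, hx, hs⟩ := hsep t ht
    exact ⟨x, hx, t, ht, hy, hs⟩
  · rintro ⟨x, hx, t, ht, hy, hs⟩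
    exact ⟨t, ht, hy⟩

theorem closed_locfin (H : Amb L R) (hL : LUF2 L R) [Nontrivial R] [DenselyOrdered R]
    {Y : Set R} (hY : DP L (fun v : Fin 1 → R => v 0 ∈ Y)) (hcl : IsClosed Y)
    (hint : interior Y = ∅) : LF Y := by
  have hY' := fun (α : Type) (f : (α → R) → R) (hf : DF L f) =>
    DP.app1 (P := fun x => x ∈ Y) hY hf
  have hE := locfin_of_sep_family H hL
    (fun x => {y | y ∈ Y ∧ ∀ z, z ∈ Y → y < z → y + x ≤ z})
    (DP.and (hY' _ _ (.var _)) (DP.all (DP.imp (hY' _ _ (.var _)) (DP.imp (H.lt (.var _) (.var _))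
      (H.le (H.add (.var _) (.var _)) (.var _))))))
    (fun x x' hx hxx y hy => ⟨hy.1, fun z hz hyz => le_trans (by gcongr) (hy.2 z hz hyz)⟩)
    (fun x hx y hy z hz hyz => hy.2 z hz.1 hyz)
  have key : ∀ y ∈ Y, ∀ y' ∈ Y, y < y' → ∃ e, y ≤ e ∧ e < y' ∧
      e ∈ {y | ∃ x, 0 < x ∧ y ∈ {y | y ∈ Y ∧ ∀ z, z ∈ Y → y < z → y + x ≤ z}} := by
    intro y hy y' hy' hyy
    have : ∃ w, y < w ∧ w < y' ∧ w ∉ Y := by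
      by_contra hcon
      push Not at hcon
      obtain ⟨w, hw⟩ := exists_between hyy
      have : w ∈ interior Y := mem_interior.2 ⟨Set.Ioo y y', fun w hw => hcon w hw.1 hw.2, isOpen_Ioo, hw⟩
      rw [hint] at this
      exact this
    obtain ⟨w, hyw, hwy, hw⟩ := this
    obtain ⟨e, he⟩ := H.sup (S := Y ∩ Set.Iic w)
      (DP.and (hY' _ _ (.var _)) (H.le (.var _) (.const _))) ⟨y, hy, hyw.le⟩ ⟨w, fun t ht => ht.2⟩
    have hm := he.mem_of_isClosed ⟨y, hy, hyw.le⟩ (hcl.inter isClosed_Iic)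
    have hew : e < w := lt_of_le_of_ne hm.2 fun h => hw (h ▸ hm.1)
    refine ⟨e, he.1 ⟨hy, hyw.le⟩, hew.trans hwy, w - e, sub_pos.2 hew, hm.1, fun z hz hez => ?_⟩
    rw [add_sub_cancel]
    by_contra h
    exact absurd (he.1 ⟨hz, (not_le.1 h).le⟩) (not_le.2 hez)
  intro a
  obtain ⟨u, v, hu, hv, hfin⟩ := hE a
  refine ⟨u, v, hu, hv, ?_⟩
  have hg : ∀ y ∈ Y ∩ Set.Icc u v, ∀ y' ∈ Y ∩ Set.Icc u v, y < y' → ∃ e,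
      e ∈ {y | ∃ x, 0 < x ∧ y ∈ {y | y ∈ Y ∧ ∀ z, z ∈ Y → y < z → y + x ≤ z}} ∩ Set.Icc u v ∧
      y ≤ e ∧ e < y' := by
    intro y hy y' hy' h
    obtain ⟨e, h1, h2, h3⟩ := key y hy.1 y' hy'.1 h
    exact ⟨e, ⟨h3, hy.2.1.trans h1, h2.le.trans hy'.2.2⟩, h1, h2⟩
  generalize {y | ∃ x, 0 < x ∧ y ∈ {y | y ∈ Y ∧ ∀ z, z ∈ Y → y < z → y + x ≤ z}} ∩ Set.Icc u v = E
    at hfin hg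
  refine Set.Finite.of_finite_image (f := fun y => {e ∈ E | e < y})
    (hfin.finite_subsets.subset ?_) ?_
  · rintro _ ⟨y, _, rfl⟩
    exact fun e he => he.1
  · have aux : ∀ y ∈ Y ∩ Set.Icc u v, ∀ y' ∈ Y ∩ Set.Icc u v, y < y' →
        {e ∈ E | e < y} ≠ {e ∈ E | e < y'} := by
      intro y hy y' hy' h heq
      obtain ⟨e, he, h1, h2⟩ := hg y hy y' hy' h
      have : e ∈ {e ∈ E | e < y} := heq ▸ (⟨he, h2⟩ : e ∈ {e ∈ E | e < y'})
      exact absurd this.2 (not_lt.2 h1)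
    intro y hy y' hy' heq
    rcases lt_trichotomy y y' with h | h | h
    · exact absurd heq (aux y hy y' hy' h)
    · exact h
    · exact absurd heq.symm (aux y' hy' y hy h)

theorem exists_eps [Nontrivial R] [DenselyOrdered R] {a : R} {s : Set R} (hs : s ∈ 𝓝 a) :
    ∃ ε, 0 < ε ∧ ∀ b, b ≤ a + ε → a ≤ b + ε → b ∈ s := by
  obtain ⟨l, r, ⟨hl, hr⟩, h⟩ := mem_nhds_iff_exists_Ioo_subset.1 hs
  obtain ⟨ε, h1, h2⟩ := exists_between (lt_min (sub_pos.2 hl) (sub_pos.2 hr))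
  rw [lt_min_iff] at h2
  refine ⟨ε, h1, fun b hb1 hb2 => h ⟨?_, ?_⟩⟩
  · have : ε + l < a := lt_sub_iff_add_lt.1 h2.1
    rw [add_comm] at this
    exact lt_of_add_lt_add_right (this.trans_le hb2)
  · have : ε + a < r := lt_sub_iff_add_lt.1 h2.2
    rw [add_comm] at this
    exact hb1.trans_lt this

theorem mem_of_cluster [Nontrivial R] [DenselyOrdered R] {n : ℕ} {K : Set (Fin n → R)}
    (hK : IsClosed K) (c : Fin n → R)
    (h : ∀ ε, 0 < ε → ∃ x ∈ K, ∀ j, x j ≤ c j + ε ∧ c j ≤ x j + ε) : c ∈ K := by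
  rw [← hK.closure_eq, mem_closure_iff]
  intro U hU hcU
  obtain ⟨I, u, hu, hsub⟩ := isOpen_pi_iff.1 hU c hcU
  obtain ⟨e0, he0⟩ := exists_zero_lt (α := R)
  have : ∀ J : Finset (Fin n), J ⊆ I →
      ∃ ε, 0 < ε ∧ ∀ j ∈ J, ∀ b, b ≤ c j + ε → c j ≤ b + ε → b ∈ u j := by
    intro J
    induction J using Finset.induction_on with
    | empty => exact fun _ => ⟨e0, he0, by simp⟩
    | insert i J _ ih =>
      intro hJ
      obtain ⟨ε, hε, h1⟩ := ih fun j hj => hJ (Finset.mem_insert_of_mem hj)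
      have hi := hu i (hJ (Finset.mem_insert_self _ _))
      obtain ⟨ε', hε', h2⟩ := exists_eps (hi.1.mem_nhds hi.2)
      refine ⟨min ε ε', lt_min hε hε', fun j hj b hb1 hb2 => ?_⟩
      rcases Finset.mem_insert.1 hj with rfl | hj
      · exact h2 b (hb1.trans (by gcongr; exact min_le_right _ _))
          (hb2.trans (by gcongr; exact min_le_right _ _))
      · exact h1 j hj b (hb1.trans (by gcongr; exact min_le_left _ _))
          (hb2.trans (by gcongr; exact min_le_left _ _))
  obtain ⟨ε, hε, h1⟩ := this I (fun _ h => h)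
  obtain ⟨x, hx, hxc⟩ := h ε hε
  exact ⟨x, hsub fun j hj => h1 j hj _ (hxc j).1 (hxc j).2, hx⟩

theorem proj_closed (H : Amb L R) [Nontrivial R] [DenselyOrdered R] {n : ℕ} {K : Set (Fin n → R)}
    (hdef : DP L (fun v : Fin n → R => v ∈ K)) (hK : IsClosed K) (hb : BddSet K) (i : Fin n) :
    IsClosed {y | ∃ x : Fin n → R, x ∈ K ∧ x i = y} := by
  obtain ⟨p, q, hb⟩ := hb
  refine isClosed_of_closure_subset fun y hy => ?_
  have hne : ∀ ε, 0 < ε → ∃ x ∈ K, x i ≤ y + ε ∧ y ≤ x i + ε := by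
    intro ε hε
    have hn : Set.Ioo (y - ε) (y + ε) ∈ 𝓝 y := Ioo_mem_nhds (sub_lt_self y hε) (lt_add_of_pos_right y hε)
    obtain ⟨_, h, x, hx, rfl⟩ := mem_closure_iff_nhds.1 hy _ hn
    exact ⟨x, hx, h.2.le, (sub_lt_iff_lt_add.1 h.1).le⟩
  obtain ⟨c, hc⟩ := cluster_all H (fun ε => {x | x ∈ K ∧ x i ≤ y + ε ∧ y ≤ x i + ε})
    (DP.and (hdef.subst _ (fun b => DF.var (some b))) (DP.and
      (H.le (.var _) (H.add (.const _) (.var _))) (H.le (.const _) (H.add (.var _) (.var _)))))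
    p q (fun ε _ x hx => hb x hx.1)
    (fun ε ε' _ h x hx => ⟨hx.1, hx.2.1.trans (by gcongr), hx.2.2.trans (by gcongr)⟩)
    (fun ε hε => hne ε hε) Finset.univ
  refine ⟨c, mem_of_cluster hK c fun ε hε => ?_, ?_⟩
  · obtain ⟨x, hx, h⟩ := hc ε hε
    exact ⟨x, hx.1, fun j => h j (Finset.mem_univ j)⟩
  · rcases lt_trichotomy (c i) y with h | h | h
    · obtain ⟨ε, hε, h2⟩ := half (sub_pos.2 h)
      obtain ⟨x, hx, hxc⟩ := hc ε hε
      have h3 := (hxc i (Finset.mem_univ i)).1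
      have h4 := hx.2.2
      have h5 : (ε + ε) + c i < y := lt_sub_iff_add_lt.1 h2
      have h6 : y ≤ (ε + ε) + c i := h4.trans (by
        calc x i + ε ≤ (c i + ε) + ε := by gcongr
          _ = _ := by abel)
      exact absurd h5 (not_lt.2 h6)
    · exact h
    · obtain ⟨ε, hε, h2⟩ := half (sub_pos.2 h)
      obtain ⟨x, hx, hxc⟩ := hc ε hε
      have h3 := (hxc i (Finset.mem_univ i)).2
      have h4 := hx.2.1
      have h5 : (ε + ε) + y < c i := lt_sub_iff_add_lt.1 h2
      have h6 : c i ≤ (ε + ε) + y := h3.trans (by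
        calc x i + ε ≤ (y + ε) + ε := by gcongr
          _ = _ := by abel)
      exact absurd h5 (not_lt.2 h6)

theorem proj_lf (H : Amb L R) (hL : LUF2 L R) [Nontrivial R] [DenselyOrdered R] {n : ℕ}
    {F : Set (Fin (2 + n) → R)} (hF : IsDSigmaFamily L F) (c d : Fin n → R) (i : Fin n)
    (hint : interior {y | ∃ r, 0 < r ∧ ∃ s, 0 < s ∧ ∃ x : Fin n → R,
      (x ∈ famFiber F r s ∧ ∀ j, c j ≤ x j ∧ x j ≤ d j) ∧ x i = y} = ∅) :
    LF {y | ∃ r, 0 < r ∧ ∃ s, 0 < s ∧ ∃ x : Fin n → R,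
      (x ∈ famFiber F r s ∧ ∀ j, c j ≤ x j ∧ x j ≤ d j) ∧ x i = y} := by
  obtain ⟨hdef, hCBD, hr, hs⟩ := hF
  have hfam : ∀ (α : Type) (f g : (α → R) → R) (k : Fin n → (α → R) → R), DF L f → DF L g →
      (∀ j, DF L (k j)) → DP L (fun v => (fun j => k j v) ∈ famFiber F (f v) (g v)) := by
    intro α f g k hf hg hk
    have := DP.subst (P := fun v => v ∈ F) hdef (Fin.append ![f, g] k) (fun b => by
      refine Fin.addCases (fun b => ?_) (fun b => ?_) b
      · rw [Fin.append_left]; fin_cases b <;> assumption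
      · rw [Fin.append_right]; exact hk b)
    refine this.congr fun v => ?_
    have : (fun b => Fin.append ![f, g] k b v) = Fin.append ![f v, g v] (fun j => k j v) := by
      funext b
      refine Fin.addCases (fun b => ?_) (fun b => ?_) b
      · rw [Fin.append_left, Fin.append_left]; fin_cases b <;> rfl
      · rw [Fin.append_right, Fin.append_right]
    rw [this]
    rfl
  have hbox : ∀ (α : Type) (k : Fin n → (α → R) → R), (∀ j, DF L (k j)) →
      DP L (fun v => ∀ j, c j ≤ k j v ∧ k j v ≤ d j) := fun α k hk =>
    DP.fall fun j => DP.and (H.le (.const _) (hk j)) (H.le (hk j) (.const _))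
  set Y : R → R → Set R := fun r s => {y | ∃ x : Fin n → R,
      (x ∈ famFiber F r s ∧ ∀ j, c j ≤ x j ∧ x j ≤ d j) ∧ x i = y} with hYdef
  have hY3 : DP L (fun v : Fin 3 → R => v 2 ∈ Y (v 0) (v 1)) :=
    DP.exN (DP.and (DP.and (hfam _ _ _ _ (.var _) (.var _) (fun j => .var _))
      (hbox _ _ (fun j => .var _))) (DP.eq (.var _) (.var _)))
  have hY' := fun (α : Type) (f g k : (α → R) → R) (hf : DF L f) (hg : DF L g) (hk : DF L k) =>
    DP.app3 (P := fun r s y => y ∈ Y r s) hY3 hf hg hk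
  have hYb : ∀ r s, ∀ y ∈ Y r s, c i ≤ y ∧ y ≤ d i := by
    rintro r s y ⟨x, hx, rfl⟩
    exact hx.2 i
  have hYlf : ∀ r s, 0 < r → 0 < s → LF (Y r s) := by
    intro r s h1 h2
    obtain ⟨_, hcl, p, q, hb⟩ := hCBD r s h1 h2
    refine closed_locfin H hL (hY' _ _ _ _ (.const r) (.const s) (.var 0)) ?_ ?_
    · refine proj_closed H (K := {x | x ∈ famFiber F r s ∧ ∀ j, c j ≤ x j ∧ x j ≤ d j})
        (DP.and (hfam _ _ _ _ (.const r) (.const s) (fun j => .var j))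
          (hbox _ _ (fun j => .var j))) ?_ ⟨p, q, fun x hx => hb x hx.1⟩ i
      refine hcl.inter ?_
      have : {x : Fin n → R | ∀ j, c j ≤ x j ∧ x j ≤ d j} = Set.Icc c d := by
        ext x
        simp [Pi.le_def, forall_and]
      change IsClosed {x : Fin n → R | ∀ j, c j ≤ x j ∧ x j ≤ d j}
      rw [this]
      exact isClosed_Icc
    · rw [← Set.subset_empty_iff, ← hint]
      exact interior_mono fun y hy => ⟨r, h1, s, h2, hy⟩
  have hYr : ∀ r, 0 < r → LF {y | ∃ s, 0 < s ∧ y ∈ Y r s} := by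
    intro r h1
    refine chain_locfin H hL (fun s => Y r s) (hY' _ _ _ _ (.const r) (.var _) (.var _)) ?_ ?_
    · intro s s' h2 h3
      rcases le_total s s' with h | h
      · right
        rintro y ⟨x, ⟨hx, hx'⟩, rfl⟩
        exact ⟨x, ⟨hs r s s' h1 h2 h hx, hx'⟩, rfl⟩
      · left
        rintro y ⟨x, ⟨hx, hx'⟩, rfl⟩
        exact ⟨x, ⟨hs r s' s h1 h3 h hx, hx'⟩, rfl⟩
    · intro s h2
      exact locfin_sep H (hY' _ _ _ _ (.const r) (.const s) (.var 0)) (hYb r s) (hYlf r s h1 h2)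
  refine chain_locfin H hL (fun r => {y | ∃ s, 0 < s ∧ y ∈ Y r s})
    (DP.ex (DP.and (H.lt (.const 0) (.var _)) (hY' _ _ _ _ (.var _) (.var _) (.var _)))) ?_ ?_
  · intro r r' h1 h1'
    rcases le_total r r' with h | h
    · left
      rintro y ⟨s, h2, x, ⟨hx, hx'⟩, rfl⟩
      exact ⟨s, h2, x, ⟨hr r r' s h1 h2 h hx, hx'⟩, rfl⟩
    · right
      rintro y ⟨s, h2, x, ⟨hx, hx'⟩, rfl⟩
      exact ⟨s, h2, x, ⟨hr r' r s h1' h2 h hx, hx'⟩, rfl⟩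
  · intro r h1
    exact locfin_sep H (DP.ex (DP.and (H.lt (.const 0) (.var _))
      (hY' _ _ _ _ (.const r) (.var _) (.var _))))
      (fun y ⟨s, _, hy⟩ => hYb r s y hy) (hYr r h1)

end Topo

theorem closed_discrete_of_locFin {α : Type*} [TopologicalSpace α] [T1Space α] {X : Set α}
    (h : LocFin X) : DiscreteSet X ∧ IsClosed X ∧ IsConstructibleSet X := by
  have hcl : IsClosed X := by
    rw [← isOpen_compl_iff, isOpen_iff_mem_nhds]
    intro x hx
    obtain ⟨U, hU, hxU, hfin⟩ := h x
    filter_upwards [(hU.sdiff hfin.isClosed).mem_nhds ⟨hxU, fun h => hx h.1⟩] with z hz hzX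
    exact hz.2 ⟨hzX, hz.1⟩
  refine ⟨fun y hy => ?_, hcl, ?_⟩
  · obtain ⟨U, hU, hyU, hfin⟩ := h y
    refine ⟨U \ ((X ∩ U) \ {y}), hU.sdiff (hfin.subset Set.diff_subset).isClosed,
      ⟨hyU, fun h => h.2 rfl⟩, ?_⟩
    ext z
    constructor
    · rintro ⟨⟨h1, h2⟩, h3⟩
      by_contra hz
      exact h2 ⟨⟨h3, h1⟩, hz⟩
    · rintro rfl
      exact ⟨⟨hyU, fun h => h.2 rfl⟩, hy⟩
  · rw [← compl_compl X]
    exact .compl _ (.of_isOpen _ hcl.isOpen_compl)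

end DSig

theorem dSigma_dim_zero_discrete_closed
    {R : Type*} (L : FirstOrder.Language) [L.Structure R]
    [LinearOrder R] [DenselyOrdered R] [AddCommGroup R]
    [CovariantClass R R (· + ·) (· < ·)] [TopologicalSpace R] [OrderTopology R]
    (hlt : IsDefinable L {v : Fin 2 → R | v 0 < v 1})
    (hadd : IsDefinable L {v : Fin 3 → R | v 0 + v 1 = v 2})
    (hDC : DCProp L R) (hLUF2 : LUF2 L R)
    {n : ℕ} (X : Set (Fin n → R)) (hX : IsDSigma L X)
    (hdim : setDim X = ((0 : ℕ∞) : WithBot ℕ∞)) :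
    DiscreteSet X ∧ IsClosed X ∧ IsConstructibleSet X := by
  have hcov : ∀ a b c : R, b < c → a + b < a + c := fun a b c h =>
    CovariantClass.elim (μ := fun x y : R => x + y) (r := fun x y => x < y) a h
  haveI : IsOrderedAddMonoid R :=
    { add_le_add_left := fun a b h c => by
        rcases h.eq_or_lt with rfl | h
        · exact le_rfl
        · rw [add_comm a c, add_comm b c]
          exact (hcov c a b h).le }
  have H : DSig.Amb L R := ⟨hlt, hadd, hDC⟩
  apply DSig.closed_discrete_of_locFin
  intro x
  obtain ⟨F, hF, rfl⟩ := hX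
  set X : Set (Fin n → R) := ⋃ (r : R) (_ : 0 < r) (s : R) (_ : 0 < s), famFiber F r s with hXdef
  have hbox : ∃ B : Set (Fin n → R), OpenBox B ∧ x ∈ B ∧ ∀ f : Fin 1 → Fin n,
      Function.Injective f → ¬ (interior ((fun y => y ∘ f) '' (B ∩ X))).Nonempty := by
    by_contra hcon
    push Not at hcon
    have h1 : (((1 : ℕ) : ℕ∞) : WithBot ℕ∞) ≤ locDim X x := le_sSup ⟨1, rfl, fun B hB hxB => by
      obtain ⟨f, hf, h⟩ := hcon B hB hxB
      exact ⟨f, hf, h⟩⟩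
    have h2 : locDim X x ≤ setDim X := le_iSup (fun x => locDim X x) x
    rw [hdim] at h2
    have h3 := h1.trans h2
    exact absurd (WithBot.coe_le_coe.1 h3) (by simp)
  obtain ⟨B, ⟨c, d, rfl⟩, hxB, hB⟩ := hbox
  choose c' hc1 hc2 using fun i => exists_between (hxB i).1
  choose d' hd1 hd2 using fun i => exists_between (hxB i).2
  have hlf : ∀ i : Fin n, DSig.LF {y | ∃ r, 0 < r ∧ ∃ s, 0 < s ∧ ∃ x : Fin n → R,
      (x ∈ famFiber F r s ∧ ∀ j, c' j ≤ x j ∧ x j ≤ d' j) ∧ x i = y} := by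
    intro i
    haveI : Nontrivial R := ⟨⟨c i, x i, (hxB i).1.ne⟩⟩
    refine DSig.proj_lf H hLUF2 hF c' d' i ?_
    by_contra hne
    obtain ⟨y, hy⟩ := Set.nonempty_iff_ne_empty.2 hne
    refine hB (fun _ => i) (fun _ _ _ => Subsingleton.elim _ _) ⟨fun _ => y, mem_interior.2
      ⟨(fun w : Fin 1 → R => w 0) ⁻¹' (interior _), ?_,
        isOpen_interior.preimage (continuous_apply 0), hy⟩⟩
    intro w hw
    obtain ⟨r, h1, s, h2, z, ⟨hz, hz'⟩, hzw⟩ := interior_subset hw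
    refine ⟨z, ⟨fun j => ⟨(hc1 j).trans_le (hz' j).1, (hz' j).2.trans_lt (hd2 j)⟩, ?_⟩, ?_⟩
    · simp only [hXdef, Set.mem_iUnion]
      exact ⟨r, h1, s, h2, hz⟩
    · funext k
      rw [Subsingleton.elim k 0]
      exact hzw
  choose u v hu hv hfin using fun i => hlf i (x i)
  refine ⟨Set.pi Set.univ fun i => Set.Ioo (max (c' i) (u i)) (min (d' i) (v i)),
    isOpen_set_pi Set.finite_univ fun _ _ => isOpen_Ioo,
    fun i _ => ⟨max_lt (hc2 i) (hu i), lt_min (hd1 i) (hv i)⟩, ?_⟩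
  refine (Set.Finite.pi' hfin).subset ?_
  rintro z ⟨hz, hzU⟩ i
  simp only [hXdef, Set.mem_iUnion] at hz
  obtain ⟨r, h1, s, h2, hz⟩ := hz
  have hz' := fun j => hzU j (Set.mem_univ j)
  simp only [Set.mem_Ioo, max_lt_iff, lt_min_iff] at hz'
  exact ⟨⟨r, h1, s, h2, z, ⟨hz, fun j => ⟨(hz' j).1.1.le, (hz' j).2.1.le⟩⟩, rfl⟩,
    (hz' i).1.2.le, (hz' i).2.2.le⟩
end
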